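/- arXiv:2312.02687 — 3 statements merged into one kernel-verified Lean document; each statement's English description precedes it below -/
import Mathlib

section
/- Let G be a generalized caterpillar graph. If J_G^2 = J_G^(2), then J_G^i = J_G^(i) for every integer i ≥ 1. -/
open MvPolynomial

/-- The binomial edge ideal of a simple graph `G`, in the polynomial ring
`k[x_i, y_i : i ∈ V]` (variables indexed by `V ⊕ V`: `Sum.inl i ↦ x_i`, `Sum.inr i ↦ y_i`),
generated by the binomials `x_i y_j - x_j y_i` for edges `{i, j}` of `G`. -/
noncomputable def binomialEdgeIdeal (k : Type) [Field k] {V : Type} (G : SimpleGraph V) :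
    Ideal (MvPolynomial (V ⊕ V) k) :=
  Ideal.span {f | ∃ i j, G.Adj i j ∧
    f = X (Sum.inl i) * X (Sum.inr j) - X (Sum.inl j) * X (Sum.inr i)}

/-- The `t`-th symbolic power of an ideal `I`: the intersection, over all minimal primes `p`
of `I`, of the contraction to `S` of the extension of `I ^ t` to the localization `S_p`. -/
noncomputable def symbolicPower {S : Type*} [CommRing S] (I : Ideal S) (t : ℕ) : Ideal S :=
  ⨅ (p : Ideal S) (hp : p ∈ I.minimalPrimes),
    haveI : p.IsPrime := hp.1.1
    (Ideal.map (algebraMap S (Localization.AtPrime p)) (I ^ t)).comap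
      (algebraMap S (Localization.AtPrime p))

/-- A graph `G` is weakly closed if its vertices admit a labelling by `1, …, n` such that
for all `i < j < k`, if `{i, k}` is an edge then `{i, j}` or `{j, k}` is an edge. -/
def WeaklyClosed {V : Type} [Fintype V] (G : SimpleGraph V) : Prop :=
  ∃ f : V ≃ Fin (Fintype.card V), ∀ a b c : V,
    f a < f b → f b < f c → G.Adj a c → G.Adj a b ∨ G.Adj b c

/-- The net: the graph on six vertices obtained from the triangle `{0, 1, 2}` by attaching
the pendant vertices `3, 4, 5` to `0, 1, 2` respectively. -/
def netGraph : SimpleGraph (Fin 6) :=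
  SimpleGraph.fromRel fun a b =>
    (a = 0 ∧ b = 1) ∨ (a = 1 ∧ b = 2) ∨ (a = 0 ∧ b = 2) ∨
    (a = 0 ∧ b = 3) ∨ (a = 1 ∧ b = 4) ∨ (a = 2 ∧ b = 5)

/-- A graph is net-free if it has no induced subgraph isomorphic to the net, i.e. there is
no graph embedding (induced subgraph embedding) of the net into it. -/
def NetFree {V : Type} (G : SimpleGraph V) : Prop := IsEmpty (netGraph ↪g G)

/-- Auxiliary relation for the construction of a generalized caterpillar graph from a
caterpillar tree `H` with central path `p`: the clique vertices `c : C` are attached to the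
edge `{p.getVert (g c), p.getVert (g c + 1)}` of the path (clique joins via pairwise distinct
edges of `p` correspond to the fibers of `g`), and the whisker vertices `w : W` are pendant
vertices attached to `f w`. -/
def genCatRel {V₀ C W : Type} (H : SimpleGraph V₀) {u v : V₀} (p : H.Walk u v)
    (g : C → ℕ) (f : W → V₀ ⊕ C) : (V₀ ⊕ C) ⊕ W → (V₀ ⊕ C) ⊕ W → Prop
  | .inl (.inl a), .inl (.inl b) => H.Adj a b
  | .inl (.inl a), .inl (.inr c) => a = p.getVert (g c) ∨ a = p.getVert (g c + 1)
  | .inl (.inr c), .inl (.inr c') => g c = g c'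
  | .inr w, .inl z => z = f w
  | _, _ => False

/-- The graph obtained from a caterpillar tree `H` with central path `p` by clique joins of
complete graphs via (pairwise distinct) edges of `p` and adding whiskers: two vertices are
adjacent iff they are distinct and related by `genCatRel`. -/
def genCatGraph {V₀ C W : Type} (H : SimpleGraph V₀) {u v : V₀} (p : H.Walk u v)
    (g : C → ℕ) (f : W → V₀ ⊕ C) : SimpleGraph ((V₀ ⊕ C) ⊕ W) :=
  SimpleGraph.fromRel (genCatRel H p g f)

/-- A generalized caterpillar graph: a graph obtained from a caterpillar tree `H` with a
central path `p` (a path such that every vertex of `H` is on `p` or adjacent to a vertex of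
`p`) by successively performing clique joins of complete graphs via pairwise distinct edges
of `p` (encoded by `g : C → ℕ` sending each new clique vertex to the index of its path edge),
and finally possibly adding whiskers to some vertices (encoded by `f : W → V₀ ⊕ C`). -/
def IsGeneralizedCaterpillar {V : Type} (G : SimpleGraph V) : Prop :=
  ∃ (V₀ C W : Type) (_ : Fintype V₀) (_ : Fintype C) (_ : Fintype W)
    (H : SimpleGraph V₀) (u v : V₀) (p : H.Walk u v)
    (g : C → ℕ) (f : W → V₀ ⊕ C),
    H.IsTree ∧ p.IsPath ∧
    (∀ z : V₀, z ∈ p.support ∨ ∃ y ∈ p.support, H.Adj z y) ∧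
    (∀ c, g c < p.length) ∧
    Nonempty (G ≃g genCatGraph H p g f)

set_option linter.unusedSectionVars false

namespace BinomialEdge


section Basics

variable {k V : Type} [Field k] [DecidableEq V]

/-- The polynomial ring in the coordinates of one plane vector per vertex. -/
abbrev EdgeRing (k V : Type) [Field k] : Type := MvPolynomial (V ⊕ V) k

/-- Evaluation of a polynomial at a configuration of plane vectors over a `k`-algebra. -/
noncomputable def ev {B : Type} [CommRing B] [Algebra k B] (P : V → B × B) :
    EdgeRing k V →ₐ[k] B :=
  aeval (Sum.elim (fun w => (P w).1) (fun w => (P w).2))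

/-- The bracket `x_i y_j - x_j y_i`. -/
noncomputable def br (i j : V) : EdgeRing k V :=
  X (Sum.inl i) * X (Sum.inr j) - X (Sum.inl j) * X (Sum.inr i)

/-- The tautological configuration. -/
noncomputable def gp (w : V) : EdgeRing k V × EdgeRing k V := (X (Sum.inl w), X (Sum.inr w))

section

variable {B : Type} [CommRing B] [Algebra k B]

@[simp] lemma ev_inl (P : V → B × B) (w : V) :
    ev P (X (Sum.inl w) : EdgeRing k V) = (P w).1 := by simp [ev]

@[simp] lemma ev_inr (P : V → B × B) (w : V) :
    ev P (X (Sum.inr w) : EdgeRing k V) = (P w).2 := by simp [ev]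

lemma ev_br (P : V → B × B) (i j : V) :
    ev P (br i j : EdgeRing k V) = (P i).1 * (P j).2 - (P j).1 * (P i).2 := by
  simp [br]

lemma map_ev {B' : Type} [CommRing B'] [Algebra k B'] (φ : B →ₐ[k] B') (P : V → B × B)
    (f : EdgeRing k V) : φ (ev P f) = ev (fun w => (φ (P w).1, φ (P w).2)) f := by
  have : φ.comp (ev P) = ev (fun w => (φ (P w).1, φ (P w).2)) := by
    ext i
    rcases i with i | i <;> simp
  exact DFunLike.congr_fun this f

lemma ev_gp (f : EdgeRing k V) : ev gp f = f := by
  have : ev gp = AlgHom.id k (EdgeRing k V) := by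
    ext1 i
    rcases i with i | i <;> simp [gp]
  exact DFunLike.congr_fun this f

end

lemma br_swap (i j : V) : (br j i : EdgeRing k V) = -br i j := by simp [br]

/-- The multidegree of a variable: both coordinates of the vector at `w` have degree `w`. -/
noncomputable def vdeg : V ⊕ V → (V → ℕ) :=
  Sum.elim (fun w => Pi.single w 1) (fun w => Pi.single w 1)

/-- Multihomogeneity of degree `δ`. -/
def Hom (δ : V → ℕ) (f : EdgeRing k V) : Prop := IsWeightedHomogeneous vdeg f δ

lemma hom_inl (w : V) : Hom (Pi.single w 1) (X (Sum.inl w) : EdgeRing k V) :=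
  isWeightedHomogeneous_X k vdeg (Sum.inl w)

lemma hom_inr (w : V) : Hom (Pi.single w 1) (X (Sum.inr w) : EdgeRing k V) :=
  isWeightedHomogeneous_X k vdeg (Sum.inr w)

lemma Hom.mul {δ γ : V → ℕ} {f g : EdgeRing k V} (hf : Hom δ f) (hg : Hom γ g) :
    Hom (δ + γ) (f * g) := IsWeightedHomogeneous.mul hf hg

lemma Hom.add {δ : V → ℕ} {f g : EdgeRing k V} (hf : Hom δ f) (hg : Hom δ g) :
    Hom δ (f + g) := IsWeightedHomogeneous.add hf hg

lemma Hom.sub {δ : V → ℕ} {f g : EdgeRing k V} (hf : Hom δ f) (hg : Hom δ g) :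
    Hom δ (f - g) := (weightedHomogeneousSubmodule k vdeg δ).sub_mem hf hg

lemma hom_zero (δ : V → ℕ) : Hom δ (0 : EdgeRing k V) := isWeightedHomogeneous_zero k vdeg δ

lemma hom_br (i j : V) : Hom (Pi.single i 1 + Pi.single j 1) (br i j : EdgeRing k V) :=
  ((hom_inl i).mul (hom_inr j)).sub (by
    rw [add_comm]
    exact (hom_inl j).mul (hom_inr i))

/-- Homogeneous components. -/
noncomputable def comp (δ : V → ℕ) : EdgeRing k V →ₗ[k] EdgeRing k V :=
  weightedHomogeneousComponent vdeg δ

lemma hom_comp (δ : V → ℕ) (f : EdgeRing k V) : Hom δ (comp δ f) :=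
  weightedHomogeneousComponent_isWeightedHomogeneous δ f

lemma Hom.comp_eq {δ : V → ℕ} {f : EdgeRing k V} (hf : Hom δ f) : comp δ f = f :=
  IsWeightedHomogeneous.weightedHomogeneousComponent_same hf

lemma Hom.comp_ne {δ γ : V → ℕ} {f : EdgeRing k V} (hf : Hom δ f) (h : γ ≠ δ) :
    comp γ f = 0 :=
  IsWeightedHomogeneous.weightedHomogeneousComponent_ne γ hf h

lemma exists_sum_comp (f : EdgeRing k V) : ∃ s : Finset (V → ℕ), f = ∑ γ ∈ s, comp γ f := by
  have h := finsum_weightedHomogeneousComponent vdeg f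
  have hfin := weightedHomogeneousComponent_finsupp (w := (vdeg : V ⊕ V → (V → ℕ))) f
  refine ⟨hfin.toFinset, ?_⟩
  conv_lhs => rw [← h]
  exact finsum_eq_sum _ hfin

lemma comp_mul {d γ : V → ℕ} {b : EdgeRing k V} (hb : Hom d b) (r : EdgeRing k V) :
    comp (γ + d) (r * b) = comp γ r * b := by
  obtain ⟨s, hs⟩ := exists_sum_comp r
  have h1 : comp (γ + d) (r * b) = ∑ c ∈ s, comp (γ + d) (comp c r * b) := by
    conv_lhs => rw [hs]
    rw [Finset.sum_mul, map_sum]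
  have h2 : comp γ r = ∑ c ∈ s, comp γ (comp c r) := by
    conv_lhs => rw [hs]
    rw [map_sum]
  rw [h1, h2, Finset.sum_mul]
  refine Finset.sum_congr rfl fun c _ => ?_
  by_cases hc : c = γ
  · subst hc
    rw [((hom_comp c r).mul hb).comp_eq, (hom_comp c r).comp_eq]
  · rw [((hom_comp c r).mul hb).comp_ne, (hom_comp c r).comp_ne (Ne.symm hc), zero_mul]
    intro h
    exact hc (add_right_cancel h).symm

lemma comp_mul_eq_zero {d δ : V → ℕ} {b : EdgeRing k V} (hb : Hom d b) (r : EdgeRing k V)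
    (h : ∀ γ, γ + d ≠ δ) : comp δ (r * b) = 0 := by
  obtain ⟨s, hs⟩ := exists_sum_comp r
  rw [hs, Finset.sum_mul, map_sum]
  exact Finset.sum_eq_zero fun c _ => ((hom_comp c r).mul hb).comp_ne (Ne.symm (h c))

end Basics

section Finite

variable {k V : Type} [Field k] [DecidableEq V] [Fintype V]

lemma weight_vdeg_apply (d : V ⊕ V →₀ ℕ) (w : V) :
    Finsupp.weight vdeg d w = d (Sum.inl w) + d (Sum.inr w) := by
  rw [Finsupp.weight_apply, Finsupp.sum_fintype _ _ (by simp)]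
  simp only [vdeg, Finset.sum_apply, Pi.smul_apply, Fintype.sum_sum_type, Sum.elim_inl,
    Sum.elim_inr, Pi.single_apply, smul_eq_mul, mul_ite, mul_one, mul_zero,
    Finset.sum_ite_eq, Finset.mem_univ, if_true]

lemma ev_eq_sum {B : Type} [CommRing B] [Algebra k B] (P : V → B × B) (f : EdgeRing k V) :
    ev P f = ∑ d ∈ f.support, algebraMap k B (f.coeff d) *
      ∏ w, ((P w).1 ^ d (Sum.inl w) * (P w).2 ^ d (Sum.inr w)) := by
  rw [ev, aeval_def, eval₂_eq']
  refine Finset.sum_congr rfl fun d _ => ?_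
  rw [Fintype.prod_sum_type, Finset.prod_mul_distrib]
  rfl

lemma ev_smul {B : Type} [CommRing B] [Algebra k B] {δ : V → ℕ} {f : EdgeRing k V}
    (hf : Hom δ f) (s : V → B) (P : V → B × B) :
    ev (fun w => s w • P w) f = (∏ w, s w ^ δ w) * ev P f := by
  rw [ev_eq_sum, ev_eq_sum, Finset.mul_sum]
  refine Finset.sum_congr rfl fun d hd => ?_
  have hδ : Finsupp.weight vdeg d = δ := hf (mem_support_iff.mp hd)
  rw [mul_left_comm, ← Finset.prod_mul_distrib]
  congr 1
  refine Finset.prod_congr rfl fun w _ => ?_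
  rw [← hδ, weight_vdeg_apply]
  simp only [Prod.smul_fst, Prod.smul_snd, smul_eq_mul]
  ring

lemma ev_congr {B : Type} [CommRing B] [Algebra k B] {δ : V → ℕ} {f : EdgeRing k V}
    (hf : Hom δ f) {P P' : V → B × B} (h : ∀ w, δ w ≠ 0 → P w = P' w) : ev P f = ev P' f := by
  have key : ∀ Q : V → B × B, ev Q f = ev (fun w => (if δ w = 0 then (0 : B) else 1) • Q w) f := by
    intro Q
    rw [ev_smul hf, Finset.prod_eq_one, one_mul]
    intro w _
    split_ifs with h0 <;> simp [h0]
  rw [key P, key P']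
  congr 2
  funext w
  split_ifs with h0
  · simp
  · rw [h w h0]

lemma hom_ev {δ : V → ℕ} {f : EdgeRing k V} (hf : Hom δ f) (P : V → EdgeRing k V × EdgeRing k V)
    (η : V → V → ℕ) (h1 : ∀ w, Hom (η w) (P w).1) (h2 : ∀ w, Hom (η w) (P w).2) :
    Hom (∑ w, δ w • η w) (ev P f) := by
  rw [ev_eq_sum]
  refine IsWeightedHomogeneous.sum _ _ _ fun d hd => ?_
  have hδ : Finsupp.weight vdeg d = δ := hf (mem_support_iff.mp hd)
  have h : Hom (∑ w, (d (Sum.inl w) • η w + d (Sum.inr w) • η w))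
      (∏ w, ((P w).1 ^ d (Sum.inl w) * (P w).2 ^ d (Sum.inr w))) :=
    IsWeightedHomogeneous.prod _ _ _ fun w _ => (IsWeightedHomogeneous.pow (h1 w) _).mul
      (IsWeightedHomogeneous.pow (h2 w) _)
  have h0 := (isWeightedHomogeneous_C vdeg (f.coeff d)).mul h
  rw [zero_add] at h0
  have h3 : ∑ w, δ w • η w = ∑ w, (d (Sum.inl w) • η w + d (Sum.inr w) • η w) := by
    refine Finset.sum_congr rfl fun w _ => ?_
    rw [← hδ, weight_vdeg_apply, add_smul]
  rw [h3]
  exact h0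

end Finite

section Substitution

variable {k V : Type} [Field k] [DecidableEq V]

/-- Replace the vector at `v` by the vector at `u`. -/
noncomputable def subst (u v : V) : EdgeRing k V →ₐ[k] EdgeRing k V :=
  ev (Function.update gp v (gp u))

lemma ev_subst {B : Type} [CommRing B] [Algebra k B] (P : V → B × B) (u v : V)
    (f : EdgeRing k V) : ev P (subst u v f) = ev (Function.update P v (P u)) f := by
  rw [subst, map_ev]
  congr 2
  funext w
  by_cases h : w = v
  · subst h
    simp [gp]
  · simp [gp, h]

lemma subst_inl_same (u v : V) :
    subst u v (X (Sum.inl v) : EdgeRing k V) = X (Sum.inl u) := by simp [subst, gp]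

lemma subst_inr_same (u v : V) :
    subst u v (X (Sum.inr v) : EdgeRing k V) = X (Sum.inr u) := by simp [subst, gp]

lemma subst_inl_ne {u v w : V} (h : w ≠ v) :
    subst u v (X (Sum.inl w) : EdgeRing k V) = X (Sum.inl w) := by simp [subst, gp, h]

lemma subst_inr_ne {u v w : V} (h : w ≠ v) :
    subst u v (X (Sum.inr w) : EdgeRing k V) = X (Sum.inr w) := by simp [subst, gp, h]

variable [Fintype V]

lemma subst_eq_self {u v : V} {δ : V → ℕ} {f : EdgeRing k V} (hf : Hom δ f) (h : δ v = 0) :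
    subst u v f = f := by
  conv_rhs => rw [← ev_gp f]
  refine ev_congr hf fun w hw => ?_
  rw [Function.update_of_ne]
  rintro rfl
  exact hw h

lemma hom_subst (u v : V) {δ : V → ℕ} {f : EdgeRing k V} (hf : Hom δ f) :
    Hom (Function.update δ v 0 + Pi.single u (δ v)) (subst u v f) := by
  have h := hom_ev hf (Function.update gp v (gp u)) (fun w => Pi.single (if w = v then u else w) 1)
    (fun w => ?_) (fun w => ?_)
  · have h2 : ∑ w, δ w • (Pi.single (if w = v then u else w) 1 : V → ℕ) =
        Function.update δ v 0 + Pi.single u (δ v) := by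
      have : ∀ w, δ w • (Pi.single (if w = v then u else w) 1 : V → ℕ) =
          Pi.single w (Function.update δ v 0 w) +
            (if w = v then Pi.single u (δ v) else 0) := by
        intro w
        by_cases hw : w = v
        · subst hw
          simp [← Pi.single_smul]
        · simp [hw, ← Pi.single_smul]
      rw [Finset.sum_congr rfl fun w _ => this w, Finset.sum_add_distrib,
        Finset.univ_sum_single]
      simp
    rw [h2] at h
    exact h
  · by_cases hw : w = v
    · subst hw
      simpa [gp] using hom_inl u
    · simpa [gp, hw] using hom_inl w
  · by_cases hw : w = v
    · subst hw
      simpa [gp] using hom_inr u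
    · simpa [gp, hw] using hom_inr w

lemma br_dvd_of_subst_eq_zero {u v : V} (huv : u ≠ v) {δ : V → ℕ} {f : EdgeRing k V}
    (hf : Hom δ f) (h : subst u v f = 0) : br u v ∣ f := by
  have e1 : ev (fun w => (if w = v then X (Sum.inl u) else 1 : EdgeRing k V) • gp w) f =
      X (Sum.inl u) ^ δ v * f := by
    rw [ev_smul hf, ev_gp]
    congr 1
    simp [ite_pow, Finset.prod_ite_eq']
  have e2 : ev (fun w => (if w = v then X (Sum.inl v) else 1 : EdgeRing k V) •
      (Function.update gp v (gp u) w : EdgeRing k V × EdgeRing k V)) f = 0 := by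
    rw [ev_smul hf]
    change _ * subst u v f = 0
    rw [h, mul_zero]
  have hdvd : br u v ∣ X (Sum.inl u) ^ δ v * f := by
    rw [← Ideal.mem_span_singleton, ← Ideal.Quotient.eq_zero_iff_mem, ← e1,
      ← Ideal.Quotient.mkₐ_eq_mk k, ← map_zero (Ideal.Quotient.mkₐ k _), ← e2, map_ev, map_ev]
    congr 2
    funext w
    by_cases hw : w = v
    · subst hw
      ext
      · simp [gp, mul_comm]
      · simp only [gp, if_true, Prod.smul_snd, smul_eq_mul, Function.update_self,
          Ideal.Quotient.mkₐ_eq_mk]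
        rw [Ideal.Quotient.eq, Ideal.mem_span_singleton, br]
    · simp [gp, hw]
  obtain ⟨g, hg⟩ := hdvd
  have hnd : ¬ (X (Sum.inl u) : EdgeRing k V) ∣ br u v := by
    rintro ⟨c, hc⟩
    have := congrArg (ev (fun w => if w = u then ((0 : k), (1 : k)) else (1, 0))) hc
    simp [ev_br, huv.symm] at this
  obtain ⟨c, hc⟩ := (X_prime (R := k) (i := (Sum.inl u : V ⊕ V))).pow_dvd_of_dvd_mul_left (δ v) hnd
    (Dvd.intro f hg)
  refine ⟨c, ?_⟩
  refine mul_left_cancel₀ (pow_ne_zero (δ v) (X_ne_zero (R := k) (Sum.inl u : V ⊕ V))) ?_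
  rw [hg, hc]
  ring

end Substitution

section Graded

variable {k V : Type} [Field k] [DecidableEq V]

/-- Ideals closed under taking homogeneous components. -/
def HomIdeal (I : Ideal (EdgeRing k V)) : Prop := ∀ f ∈ I, ∀ δ, comp δ f ∈ I

lemma homIdeal_top : HomIdeal (⊤ : Ideal (EdgeRing k V)) := fun _ _ _ => trivial

lemma comp_mem_closure {I : Ideal (EdgeRing k V)} (hI : HomIdeal I) {Z : Set (EdgeRing k V)}
    (hZ : ∀ z ∈ Z, ∃ d, Hom d z) {f : EdgeRing k V} (hf : f ∈ I * Ideal.span Z) (δ : V → ℕ) :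
    comp δ f ∈ AddSubmonoid.closure {x | ∃ r z γ d, r ∈ I ∧ z ∈ Z ∧ Hom γ r ∧ Hom d z ∧
      γ + d = δ ∧ x = r * z} := by
  have key : ∀ s ∈ Ideal.span Z, ∀ i ∈ I, comp δ (i * s) ∈ AddSubmonoid.closure
      {x | ∃ r z γ d, r ∈ I ∧ z ∈ Z ∧ Hom γ r ∧ Hom d z ∧ γ + d = δ ∧ x = r * z} := by
    intro s hs
    induction hs using Submodule.span_induction with
    | mem z hz =>
      intro i hi
      obtain ⟨d, hd⟩ := hZ z hz
      by_cases h : ∃ γ, γ + d = δ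
      · obtain ⟨γ, rfl⟩ := h
        rw [comp_mul hd]
        exact AddSubmonoid.subset_closure
          ⟨_, z, γ, d, hI i hi γ, hz, hom_comp γ i, hd, rfl, rfl⟩
      · rw [comp_mul_eq_zero hd i (fun γ hγ => h ⟨γ, hγ⟩)]
        exact zero_mem _
    | zero =>
      intro i _
      rw [mul_zero, map_zero]
      exact zero_mem _
    | add x y _ _ hx hy =>
      intro i hi
      rw [mul_add, map_add]
      exact add_mem (hx i hi) (hy i hi)
    | smul a x _ hx =>
      intro i hi
      rw [smul_eq_mul, ← mul_assoc]
      exact hx _ (I.mul_mem_right a hi)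
  refine Submodule.mul_induction_on hf (fun i hi s hs => key s hs i hi) fun x y hx hy => ?_
  rw [map_add]
  exact add_mem hx hy

lemma HomIdeal.mul_span {I : Ideal (EdgeRing k V)} (hI : HomIdeal I) {Z : Set (EdgeRing k V)}
    (hZ : ∀ z ∈ Z, ∃ d, Hom d z) : HomIdeal (I * Ideal.span Z) := by
  intro f hf δ
  have h := comp_mem_closure hI hZ hf δ
  refine AddSubmonoid.closure_le (S := (I * Ideal.span Z).toAddSubmonoid) |>.2 ?_ h
  rintro x ⟨r, z, γ, d, hr, hz, -, -, -, rfl⟩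
  exact Ideal.mul_mem_mul hr (Ideal.subset_span hz)

lemma mul_span_induction {I : Ideal (EdgeRing k V)} (hI : HomIdeal I) {Z : Set (EdgeRing k V)}
    (hZ : ∀ z ∈ Z, ∃ d, Hom d z) {δ : V → ℕ} {p : EdgeRing k V → Prop} (h0 : p 0)
    (hadd : ∀ a b, p a → p b → p (a + b))
    (hmul : ∀ r z γ d, r ∈ I → z ∈ Z → Hom γ r → Hom d z → γ + d = δ → p (r * z))
    {f : EdgeRing k V} (hf : f ∈ I * Ideal.span Z) (hδ : Hom δ f) : p f := by
  have h := comp_mem_closure hI hZ hf δ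
  rw [hδ.comp_eq] at h
  clear hf hδ
  induction h using AddSubmonoid.closure_induction with
  | mem x hx =>
    obtain ⟨r, z, γ, d, hr, hz, h1, h2, h3, rfl⟩ := hx
    exact hmul r z γ d hr hz h1 h2 h3
  | zero => exact h0
  | add a b _ _ ha hb => exact hadd a b ha hb

lemma exists_hom_of_mul {d δ : V → ℕ} {b f : EdgeRing k V} (hb : Hom d b)
    (h : Hom δ (b * f)) : b * f = 0 ∨ ∃ γ f', γ + d = δ ∧ Hom γ f' ∧ b * f = b * f' := by
  by_cases hγ : ∃ γ, γ + d = δ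
  · obtain ⟨γ, rfl⟩ := hγ
    refine Or.inr ⟨γ, comp γ f, rfl, hom_comp γ f, ?_⟩
    conv_lhs => rw [← h.comp_eq]
    rw [mul_comm b f, comp_mul hb, mul_comm]
  · left
    rw [← h.comp_eq, mul_comm]
    exact comp_mul_eq_zero hb f fun γ h => hγ ⟨γ, h⟩

/-- The ideal of the two coordinates at `w`. -/
noncomputable def mv (w : V) : Ideal (EdgeRing k V) :=
  Ideal.span {X (Sum.inl w), X (Sum.inr w)}

lemma hom_of_mem_coords {w : V} {z : EdgeRing k V}
    (hz : z ∈ ({X (Sum.inl w), X (Sum.inr w)} : Set (EdgeRing k V))) : Hom (Pi.single w 1) z := by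
  rcases hz with rfl | rfl
  · exact hom_inl w
  · exact hom_inr w

/-- Brackets of the edges of `G` inside `U`. -/
def edgeBrackets (k : Type) [Field k] (G : SimpleGraph V) (U : Finset V) :
    Set (EdgeRing k V) :=
  {f | ∃ i ∈ U, ∃ j ∈ U, G.Adj i j ∧ f = br i j}

/-- The binomial edge ideal of the subgraph induced on `U`. -/
noncomputable def edgeIdeal (k : Type) [Field k] (G : SimpleGraph V) (U : Finset V) :
    Ideal (EdgeRing k V) := Ideal.span (edgeBrackets k G U)

lemma exists_hom_of_mem_edgeBrackets {G : SimpleGraph V} {U : Finset V} {z : EdgeRing k V}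
    (hz : z ∈ edgeBrackets k G U) : ∃ d, Hom d z := by
  obtain ⟨i, -, j, -, -, rfl⟩ := hz
  exact ⟨_, hom_br i j⟩

lemma br_mem_edgeIdeal {G : SimpleGraph V} {U : Finset V} {i j : V} (hi : i ∈ U) (hj : j ∈ U)
    (h : G.Adj i j) : (br i j : EdgeRing k V) ∈ edgeIdeal k G U :=
  Ideal.subset_span ⟨i, hi, j, hj, h, rfl⟩

lemma edgeIdeal_mono {G : SimpleGraph V} {U U' : Finset V} (h : U ⊆ U') :
    edgeIdeal k G U ≤ edgeIdeal k G U' := by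
  refine Ideal.span_mono ?_
  rintro _ ⟨i, hi, j, hj, hij, rfl⟩
  exact ⟨i, h hi, j, h hj, hij, rfl⟩

variable [Fintype V]

/-- The ideal `J_{G[U]} ^ t * ∏ w, (x_w, y_w) ^ e w`. -/
noncomputable def mixed (k : Type) [Field k] (G : SimpleGraph V) (U : Finset V) (t : ℕ)
    (e : V → ℕ) : Ideal (EdgeRing k V) :=
  edgeIdeal k G U ^ t * ∏ w, mv w ^ e w

variable {G : SimpleGraph V} {U : Finset V}

lemma mixed_zero_zero : mixed k G U 0 0 = ⊤ := by
  simp [mixed, Ideal.one_eq_top]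

lemma mixed_succ (t : ℕ) (e : V → ℕ) :
    mixed k G U (t + 1) e = mixed k G U t e * edgeIdeal k G U := by
  rw [mixed, mixed, pow_succ, mul_assoc, mul_assoc, mul_comm (edgeIdeal k G U)]

lemma mixed_add (t : ℕ) (e e' : V → ℕ) :
    mixed k G U t (e + e') = mixed k G U t e * ∏ w, mv w ^ e' w := by
  simp only [mixed, Pi.add_apply, pow_add, Finset.prod_mul_distrib, mul_assoc]

lemma prod_mv_single (w : V) (n : ℕ) :
    ∏ a, (mv a : Ideal (EdgeRing k V)) ^ (Pi.single w n : V → ℕ) a = mv w ^ n := by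
  rw [Finset.prod_eq_single w]
  · simp
  · intro b _ hb
    simp [hb]
  · simp

lemma mixed_add_single (t : ℕ) (e : V → ℕ) (w : V) (n : ℕ) :
    mixed k G U t (e + Pi.single w n) = mixed k G U t e * mv w ^ n := by
  rw [mixed_add, prod_mv_single]

lemma mixed_mono {U U' : Finset V} (h : U ⊆ U') (t : ℕ) (e : V → ℕ) :
    mixed k G U t e ≤ mixed k G U' t e :=
  Ideal.mul_mono_left (Ideal.pow_right_mono (edgeIdeal_mono h) t)

lemma degree_induction {p : (V → ℕ) → Prop} (h0 : p 0)
    (hs : ∀ e w, p e → p (e + Pi.single w 1)) (e : V → ℕ) : p e := by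
  induction hn : ∑ w, e w generalizing e with
  | zero =>
    have : e = 0 := by
      funext w
      exact (Finset.sum_eq_zero_iff.mp hn) w (Finset.mem_univ w)
    rwa [this]
  | succ n ih =>
    obtain ⟨w, -, hw⟩ : ∃ w ∈ Finset.univ, e w ≠ 0 :=
      Finset.exists_ne_zero_of_sum_ne_zero (by omega)
    have he : e = (e - Pi.single w 1) + Pi.single w 1 := by
      funext a
      by_cases h : a = w
      · subst h
        simp
        omega
      · simp [h]
    rw [he]
    refine hs _ _ (ih _ ?_)
    rw [he] at hn
    simp only [Pi.add_apply, Finset.sum_add_distrib, Finset.sum_pi_single', Finset.mem_univ,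
      if_true] at hn
    omega

lemma mixed_induction {p : ℕ → (V → ℕ) → Prop} (h0 : p 0 0) (hJ : ∀ t, p t 0 → p (t + 1) 0)
    (hm : ∀ t e w, p t e → p t (e + Pi.single w 1)) (t : ℕ) (e : V → ℕ) : p t e := by
  refine degree_induction ?_ (fun e w h => hm t e w h) e
  induction t with
  | zero => exact h0
  | succ t ih => exact hJ t ih

lemma homIdeal_mixed (t : ℕ) (e : V → ℕ) : HomIdeal (mixed k G U t e) := by
  refine mixed_induction (p := fun t e => HomIdeal (mixed k G U t e)) ?_ ?_ ?_ t e
  · rw [mixed_zero_zero]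
    exact homIdeal_top
  · intro t ih
    rw [mixed_succ]
    exact ih.mul_span fun z hz => exists_hom_of_mem_edgeBrackets hz
  · intro t e w ih
    rw [mixed_add_single, pow_one]
    exact ih.mul_span fun z hz => ⟨_, hom_of_mem_coords hz⟩

lemma mem_prod_mv {δ : V → ℕ} {f : EdgeRing k V} (hf : Hom δ f) : f ∈ ∏ w, mv w ^ δ w := by
  rw [← ev_gp f, ev_eq_sum]
  refine Ideal.sum_mem _ fun d hd => Ideal.mul_mem_left _ _ (Ideal.prod_mem_prod fun w _ => ?_)
  have hδ : Finsupp.weight vdeg d = δ := hf (mem_support_iff.mp hd)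
  rw [← hδ, weight_vdeg_apply, pow_add]
  exact Ideal.mul_mem_mul (Ideal.pow_mem_pow (Ideal.subset_span (by simp [gp])) _)
    (Ideal.pow_mem_pow (Ideal.subset_span (by simp [gp])) _)

lemma prod_mv_anti {e δ : V → ℕ} (h : e ≤ δ) :
    (∏ w, mv w ^ δ w : Ideal (EdgeRing k V)) ≤ ∏ w, mv w ^ e w :=
  Finset.prod_le_prod' fun w _ => Ideal.pow_le_pow_right (h w)

lemma mem_mixed_zero {e δ : V → ℕ} {f : EdgeRing k V} (hf : Hom δ f) (h : e ≤ δ) :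
    f ∈ mixed k G U 0 e := by
  rw [mixed, pow_zero, one_mul]
  exact prod_mv_anti h (mem_prod_mv hf)

lemma mem_mv_pow {δ : V → ℕ} {f : EdgeRing k V} (hf : Hom δ f) (v : V) : f ∈ mv v ^ δ v := by
  rw [← prod_mv_single]
  refine prod_mv_anti ?_ (mem_prod_mv hf)
  intro a
  by_cases h : a = v
  · subst h
    simp
  · simp [h]

end Graded

section Lifting

variable {k V : Type} [Field k] [DecidableEq V]

lemma exists_degree_split {γ' γ d s : V → ℕ} (h : γ' + d = γ + s)
    (hds : ∀ a, d a = 0 ∨ s a = 0) : ∃ γ₁, γ' = γ₁ + s ∧ γ = γ₁ + d := by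
  refine ⟨γ - d, ?_, ?_⟩ <;> funext a <;> have ha := congrFun h a <;>
    rcases hds a with h0 | h0 <;> simp only [Pi.add_apply, Pi.sub_apply, h0] at ha ⊢ <;> omega

lemma single_eq_zero_or {u v : V} (h : u ≠ v) (m n : ℕ) (a : V) :
    (Pi.single u m : V → ℕ) a = 0 ∨ (Pi.single v n : V → ℕ) a = 0 := by
  by_cases hu : a = u
  · subst hu
    simp [h]
  · simp [hu]

variable [Fintype V] {G : SimpleGraph V}

/-- A homogeneous element of a mixed ideal not involving `v` already lies in the product of
this ideal with the power of `(x_v, y_v)` prescribed by its degree. -/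
lemma mem_mixed_mul_mv_pow {H : Finset V} {v : V} (hv : v ∉ H) (t : ℕ) (e : V → ℕ)
    (hev : e v = 0) {δ : V → ℕ} {f : EdgeRing k V} (hf : f ∈ mixed k G H t e) (hδ : Hom δ f) :
    f ∈ mixed k G H t e * mv v ^ δ v := by
  have step : ∀ (I : Ideal (EdgeRing k V)) (Z : Set (EdgeRing k V)), HomIdeal I →
      (∀ z ∈ Z, ∃ d : V → ℕ, Hom d z ∧ d v = 0) →
      (∀ δ f, f ∈ I → Hom δ f → f ∈ I * mv v ^ δ v) →
      ∀ δ f, f ∈ I * Ideal.span Z → Hom δ f → f ∈ I * Ideal.span Z * mv v ^ δ v := by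
    intro I Z hI hZ hVV δ f hf hδ
    refine mul_span_induction hI (fun z hz => (hZ z hz).imp fun _ h => h.1)
      (p := fun f => f ∈ I * Ideal.span Z * mv v ^ δ v) (zero_mem _)
      (fun a b ha hb => add_mem ha hb) ?_ hf hδ
    intro r z γ d hr hz hγ hd hγd
    by_cases hz0 : z = 0
    · rw [hz0, mul_zero]
      exact zero_mem _
    obtain ⟨d', hd', hd'v⟩ := hZ z hz
    have : d = d' := IsWeightedHomogeneous.inj_right hz0 hd hd'
    have h1 : δ v = γ v := by
      rw [← hγd, Pi.add_apply, this, hd'v, add_zero]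
    rw [h1, mul_right_comm]
    exact Ideal.mul_mem_mul (hVV γ r hr hγ) (Ideal.subset_span hz)
  refine mixed_induction (p := fun t e => e v = 0 → ∀ (δ : V → ℕ) (f : EdgeRing k V),
    f ∈ mixed k G H t e → Hom δ f → f ∈ mixed k G H t e * mv v ^ δ v) ?_ ?_ ?_ t e hev δ f hf hδ
  · intro _ δ f _ hδ
    rw [mixed_zero_zero, ← Ideal.one_eq_top, one_mul]
    exact mem_mv_pow hδ v
  · intro t ih _
    rw [mixed_succ]
    refine step _ _ (homIdeal_mixed t 0) ?_ (ih rfl)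
    rintro _ ⟨i, hi, j, hj, -, rfl⟩
    refine ⟨_, hom_br i j, ?_⟩
    have h1 : v ≠ i := fun h => hv (h ▸ hi)
    have h2 : v ≠ j := fun h => hv (h ▸ hj)
    simp [h1, h2]
  · intro t e w ih hev
    have hwv : v ≠ w := by
      rintro rfl
      simp at hev
    rw [mixed_add_single, pow_one]
    refine step _ _ (homIdeal_mixed t e) (fun z hz => ⟨_, hom_of_mem_coords hz, by simp [hwv]⟩)
      (ih ?_)
    simp only [Pi.add_apply] at hev
    omega

lemma exists_subst_eq {v w : V} (q : ℕ) {γ : V → ℕ} (hw : γ w = 0)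
    {g : EdgeRing k V} (hg : Hom (γ + Pi.single v q) g) :
    ∃ F, Hom (γ + Pi.single w q) F ∧ subst v w F = g := by
  induction q generalizing g with
  | zero =>
    refine ⟨g, by simpa using hg, subst_eq_self hg ?_⟩
    simp [hw]
  | succ q ih =>
    have hmem : g ∈ (⊤ : Ideal (EdgeRing k V)) * mv v := by
      rw [← Ideal.one_eq_top, one_mul, ← pow_one (mv v)]
      refine Ideal.pow_le_pow_right ?_ (mem_mv_pow hg v)
      simp only [Pi.add_apply, Pi.single_eq_same]
      omega
    refine mul_span_induction homIdeal_top (fun z hz => ⟨_, hom_of_mem_coords hz⟩)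
      (p := fun g => ∃ F, Hom (γ + Pi.single w (q + 1)) F ∧ subst v w F = g)
      ⟨0, hom_zero _, map_zero _⟩ ?_ ?_ hmem hg
    · rintro a b ⟨A, hA, rfl⟩ ⟨B, hB, rfl⟩
      exact ⟨A + B, hA.add hB, map_add _ _ _⟩
    · intro r z γ' d _ hz hr hd hγ'
      have hz1 := hom_of_mem_coords hz
      have hz0 : z ≠ 0 := by
        rcases hz with rfl | rfl <;> exact X_ne_zero _
      obtain rfl : d = Pi.single v 1 := IsWeightedHomogeneous.inj_right hz0 hd hz1
      rw [Pi.single_add, ← add_assoc] at hγ'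
      obtain rfl := add_right_cancel hγ'
      obtain ⟨F, hF, rfl⟩ := ih hr
      rw [Pi.single_add, ← add_assoc]
      rcases hz with rfl | rfl
      · exact ⟨F * X (Sum.inl w), hF.mul (hom_inl w), by rw [map_mul, subst_inl_same]⟩
      · exact ⟨F * X (Sum.inr w), hF.mul (hom_inr w), by rw [map_mul, subst_inr_same]⟩

/-- Lifting along the substitution `w ↦ v` of a vertex `w` which, inside `H`, is adjacent to
all neighbours of `v`. -/
lemma exists_mem_mixed_subst_eq {H U : Finset V} {v w : V} (hHU : H ⊆ U) (hwU : w ∈ U)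
    (hwH : w ∉ H) (hvw : v ≠ w) (hadj : ∀ b ∈ H, G.Adj v b → G.Adj w b) (t : ℕ) (e : V → ℕ)
    (hew : e w = 0) {q : ℕ} {γ : V → ℕ} (hγw : γ w = 0) (hγv : e v ≤ γ v) {g : EdgeRing k V}
    (hg : g ∈ mixed k G H t e) (hδ : Hom (γ + Pi.single v q) g) :
    ∃ F ∈ mixed k G U t e, Hom (γ + Pi.single w q) F ∧ subst v w F = g := by
  refine mixed_induction (p := fun t e => e w = 0 → ∀ (q : ℕ) (γ : V → ℕ) (g : EdgeRing k V),
    γ w = 0 → e v ≤ γ v → g ∈ mixed k G H t e → Hom (γ + Pi.single v q) g →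
    ∃ F ∈ mixed k G U t e, Hom (γ + Pi.single w q) F ∧ subst v w F = g)
    ?_ ?_ ?_ t e hew q γ g hγw hγv hg hδ
  · intro _ q γ g hγw _ _ hδ
    obtain ⟨F, hF, hFg⟩ := exists_subst_eq q hγw hδ
    refine ⟨F, ?_, hF, hFg⟩
    rw [mixed_zero_zero]
    trivial
  · intro t ih _ q γ g hγw _ hg hδ
    cases q with
    | zero =>
      refine ⟨g, mixed_mono hHU _ _ hg, by simpa using hδ, subst_eq_self hδ ?_⟩
      simp [hγw]
    | succ q =>
      rw [mixed_succ] at hg ⊢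
      refine mul_span_induction (homIdeal_mixed t 0)
        (fun z hz => exists_hom_of_mem_edgeBrackets hz)
        (p := fun g => ∃ F ∈ mixed k G U t 0 * edgeIdeal k G U,
          Hom (γ + Pi.single w (q + 1)) F ∧ subst v w F = g)
        ⟨0, zero_mem _, hom_zero _, map_zero _⟩ ?_ ?_ hg hδ
      · rintro a b ⟨A, hA', hA, rfl⟩ ⟨B, hB', hB, rfl⟩
        exact ⟨A + B, add_mem hA' hB', hA.add hB, map_add _ _ _⟩
      · intro r z γ' d hrm hz hr hd hγ'
        by_cases hz0 : z = 0
        · exact ⟨0, zero_mem _, hom_zero _, by rw [hz0, mul_zero, map_zero]⟩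
        obtain ⟨i, hi, j, hj, hij, rfl⟩ := hz
        obtain rfl : d = _ := IsWeightedHomogeneous.inj_right hz0 hd (hom_br i j)
        have hiw : i ≠ w := fun h => hwH (h ▸ hi)
        have hjw : j ≠ w := fun h => hwH (h ▸ hj)
        have main : ∀ b ∈ H, G.Adj v b → γ' + Pi.single b 1 = γ + Pi.single v q →
            ∃ F ∈ mixed k G U t 0 * edgeIdeal k G U,
              Hom (γ + Pi.single w (q + 1)) F ∧ subst v w F = r * br v b := by
          intro b hb hvb hdeg
          have hbw : b ≠ w := fun h => hwH (h ▸ hb)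
          obtain ⟨γ₁, rfl, rfl⟩ := exists_degree_split hdeg (single_eq_zero_or hvb.ne' _ _)
          obtain ⟨F, hFm, hF, rfl⟩ := ih rfl q γ₁ r (by simpa [hbw.symm] using hγw)
            (Nat.zero_le _) hrm hr
          refine ⟨F * br w b, Ideal.mul_mem_mul hFm
            (br_mem_edgeIdeal hwU (hHU hb) (hadj b hb hvb)), ?_, ?_⟩
          · convert hF.mul (hom_br w b) using 1
            rw [Pi.single_add]
            abel
          · rw [map_mul]
            congr 1
            simp [br, subst_inl_same, subst_inr_same, subst_inl_ne hbw, subst_inr_ne hbw]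
        by_cases hiv : i = v
        · subst hiv
          refine main j hj hij ?_
          rw [Pi.single_add] at hγ'
          refine add_right_cancel (b := Pi.single i 1) ?_
          rw [add_assoc, add_assoc, ← hγ']
          abel
        by_cases hjv : j = v
        · subst hjv
          obtain ⟨F, h1, h2, h3⟩ := main i hi hij.symm (by
            rw [Pi.single_add] at hγ'
            refine add_right_cancel (b := Pi.single j 1) ?_
            rw [add_assoc, add_assoc, ← hγ'])
          refine ⟨-F, neg_mem h1, ?_, ?_⟩
          · simpa using (hom_zero _).sub h2
          · rw [map_neg, h3, br_swap i j, mul_neg, neg_neg]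
        · obtain ⟨γ₁, rfl, rfl⟩ := exists_degree_split hγ' (by
            intro a
            by_cases ha : a = v
            · subst ha
              simp [Ne.symm hiv, Ne.symm hjv]
            · simp [ha])
          obtain ⟨F, hFm, hF, rfl⟩ := ih rfl (q + 1) γ₁ r
            (by simpa [hiw.symm, hjw.symm] using hγw) (Nat.zero_le _) hrm hr
          refine ⟨F * br i j, Ideal.mul_mem_mul hFm
            (br_mem_edgeIdeal (hHU hi) (hHU hj) hij), ?_, ?_⟩
          · convert hF.mul (hom_br i j) using 1
            abel
          · rw [map_mul]
            congr 1
            simp [br, subst_inl_ne hiw, subst_inr_ne hiw, subst_inl_ne hjw, subst_inr_ne hjw]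
  · intro t e a ih hew q γ g hγw hγv hg hδ
    have haw : a ≠ w := by
      rintro rfl
      simp at hew
    have hew' : e w = 0 := by simpa [haw.symm] using hew
    rw [mixed_add_single, pow_one] at hg ⊢
    refine mul_span_induction (homIdeal_mixed t e) (fun z hz => ⟨_, hom_of_mem_coords hz⟩)
      (p := fun g => ∃ F ∈ mixed k G U t e * mv a,
        Hom (γ + Pi.single w q) F ∧ subst v w F = g)
      ⟨0, zero_mem _, hom_zero _, map_zero _⟩ ?_ ?_ hg hδ
    · rintro a b ⟨A, hA', hA, rfl⟩ ⟨B, hB', hB, rfl⟩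
      exact ⟨A + B, add_mem hA' hB', hA.add hB, map_add _ _ _⟩
    · intro r z γ' d hrm hz hr hd hγ'
      have hz1 := hom_of_mem_coords hz
      have hz0 : z ≠ 0 := by
        rcases hz with rfl | rfl <;> exact X_ne_zero _
      obtain rfl : d = Pi.single a 1 := IsWeightedHomogeneous.inj_right hz0 hd hz1
      have hsplit : ∃ γ₁ : V → ℕ, γ' = γ₁ + Pi.single v q ∧ γ = γ₁ + Pi.single a 1 := by
        by_cases hav : a = v
        · subst hav
          refine ⟨γ - Pi.single a 1, ?_, ?_⟩ <;> funext b <;> have hb := congrFun hγ' b <;>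
            by_cases hba : b = a <;> (try subst hba) <;>
            simp_all only [Pi.add_apply, Pi.sub_apply, Pi.single_eq_same, ne_eq,
              not_false_eq_true, Pi.single_eq_of_ne] <;> omega
        · exact exists_degree_split hγ' (single_eq_zero_or hav _ _)
      obtain ⟨γ₁, rfl, rfl⟩ := hsplit
      simp only [Pi.add_apply] at hγv
      obtain ⟨F, hFm, hF, rfl⟩ := ih hew' q γ₁ r (by simpa [haw.symm] using hγw)
        (by omega) hrm hr
      refine ⟨F * z, Ideal.mul_mem_mul hFm (Ideal.subset_span hz), ?_, ?_⟩
      · convert hF.mul hd using 1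
        abel
      · rw [map_mul]
        congr 1
        rcases hz with rfl | rfl
        · exact subst_inl_ne haw
        · exact subst_inr_ne haw

/-- Trading powers of `(x_u, y_u)` for powers of the fresh vector at `v`. -/
lemma exists_mem_mixed_subst_eq_of_add {H : Finset V} {u v : V} (t d : ℕ) (e : V → ℕ)
    {γ : V → ℕ} (hγv : γ v = 0) {g : EdgeRing k V}
    (hg : g ∈ mixed k G H t (e + Pi.single u d)) (hδ : Hom (γ + Pi.single u d) g) :
    ∃ F ∈ mixed k G H t e, Hom (γ + Pi.single v d) F ∧ subst u v F = g := by
  induction d generalizing g with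
  | zero =>
    refine ⟨g, by simpa using hg, by simpa using hδ, subst_eq_self hδ ?_⟩
    simp [hγv]
  | succ d ih =>
    rw [Pi.single_add, ← add_assoc, mixed_add_single, pow_one] at hg
    have hI : HomIdeal (mixed k G H t (e + Pi.single u d)) := homIdeal_mixed _ _
    refine mul_span_induction hI
      (fun z hz => ⟨_, hom_of_mem_coords hz⟩)
      (p := fun g => ∃ F ∈ mixed k G H t e, Hom (γ + Pi.single v (d + 1)) F ∧ subst u v F = g)
      ⟨0, zero_mem _, hom_zero _, map_zero _⟩ ?_ ?_ hg hδ
    · rintro a b ⟨A, hA', hA, rfl⟩ ⟨B, hB', hB, rfl⟩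
      exact ⟨A + B, add_mem hA' hB', hA.add hB, map_add _ _ _⟩
    · intro r z γ' d' hrm hz hr hd hγ'
      have hz1 := hom_of_mem_coords hz
      have hz0 : z ≠ 0 := by
        rcases hz with rfl | rfl <;> exact X_ne_zero _
      obtain rfl : d' = Pi.single u 1 := IsWeightedHomogeneous.inj_right hz0 hd hz1
      rw [Pi.single_add, ← add_assoc] at hγ'
      obtain rfl := add_right_cancel hγ'
      obtain ⟨F, hFm, hF, rfl⟩ := ih hrm hr
      rw [Pi.single_add, ← add_assoc]
      rcases hz with rfl | rfl
      · exact ⟨F * X (Sum.inl v), Ideal.mul_mem_right _ _ hFm, hF.mul (hom_inl v),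
          by rw [map_mul, subst_inl_same]⟩
      · exact ⟨F * X (Sum.inr v), Ideal.mul_mem_right _ _ hFm, hF.mul (hom_inr v),
          by rw [map_mul, subst_inr_same]⟩

lemma sup_pow_succ_le {R : Type} [CommRing R] (I K : Ideal R) (t : ℕ) :
    (I ⊔ K) ^ (t + 1) ≤ I ^ (t + 1) ⊔ K * (I ⊔ K) ^ t := by
  induction t with
  | zero => simp
  | succ t ih =>
    calc (I ⊔ K) ^ (t + 1 + 1) = (I ⊔ K) ^ (t + 1) * (I ⊔ K) := pow_succ _ _
      _ ≤ (I ^ (t + 1) ⊔ K * (I ⊔ K) ^ t) * (I ⊔ K) := Ideal.mul_mono_left ih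
      _ = (I ^ (t + 1) * I ⊔ I ^ (t + 1) * K) ⊔ K * (I ⊔ K) ^ (t + 1) := by
        rw [Ideal.sup_mul, Ideal.mul_sup, mul_assoc K, ← pow_succ (I ⊔ K)]
      _ ≤ I ^ (t + 1 + 1) ⊔ K * (I ⊔ K) ^ (t + 1) := by
        refine sup_le (sup_le ?_ ?_) le_sup_right
        · rw [← pow_succ]
          exact le_sup_left
        · rw [mul_comm]
          exact le_sup_of_le_right (Ideal.mul_mono_right (Ideal.pow_right_mono le_sup_left _))

/-- Splitting off the only edge at a pendant vertex. -/
lemma exists_eq_add_br_mul {H U : Finset V} {u v : V}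
    (hU : edgeIdeal k G U ≤ edgeIdeal k G H ⊔ Ideal.span {br u v}) (hHU : H ⊆ U)
    (huv : br u v ∈ edgeIdeal k G U) {t : ℕ} {e δ : V → ℕ} {f : EdgeRing k V}
    (hf : f ∈ mixed k G U (t + 1) e) (hδ : Hom δ f) :
    ∃ f₀ f', f₀ ∈ mixed k G H (t + 1) e ∧ f' ∈ mixed k G U t e ∧ Hom δ f₀ ∧
      f = f₀ + br u v * f' ∧
      (f' = 0 ∨ ∃ γ, γ + (Pi.single u 1 + Pi.single v 1) = δ ∧ Hom γ f') := by
  have hle : edgeIdeal k G H ⊔ Ideal.span {br u v} ≤ edgeIdeal k G U :=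
    sup_le (edgeIdeal_mono hHU) ((Ideal.span_singleton_le_iff_mem _).mpr huv)
  have h1 : mixed k G U (t + 1) e ≤
      mixed k G H (t + 1) e ⊔ Ideal.span {br u v} * mixed k G U t e := by
    rw [mixed, mixed, mixed, ← mul_assoc, ← Ideal.sup_mul]
    refine Ideal.mul_mono_left ((Ideal.pow_right_mono hU _).trans
      ((sup_pow_succ_le _ _ _).trans (sup_le_sup_left (Ideal.mul_mono_right
        (Ideal.pow_right_mono hle _)) _)))
  obtain ⟨a, ha, b, hb, rfl⟩ := Submodule.mem_sup.mp (h1 hf)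
  obtain ⟨c, hc, rfl⟩ := Ideal.mem_span_singleton_mul.mp hb
  have hsum : a + br u v * c = comp δ a + comp δ (c * br u v) := by
    rw [mul_comm c, ← map_add, hδ.comp_eq]
  by_cases hγ : ∃ γ, γ + (Pi.single u 1 + Pi.single v 1) = δ
  · obtain ⟨γ, rfl⟩ := hγ
    refine ⟨_, comp γ c, homIdeal_mixed _ _ a ha _, homIdeal_mixed _ _ c hc γ,
      hom_comp _ a, ?_, Or.inr ⟨γ, rfl, hom_comp γ c⟩⟩
    rw [hsum, comp_mul (hom_br u v), mul_comm]
  · refine ⟨_, 0, homIdeal_mixed _ _ a ha δ, zero_mem _, hom_comp _ a, ?_, Or.inl rfl⟩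
    rw [hsum, comp_mul_eq_zero (hom_br u v) c fun γ h => hγ ⟨γ, h⟩, mul_zero]

end Lifting

section Order

variable {k V : Type} [Field k] [DecidableEq V]

/-- The configuration in which the vector at `w` is a multiple of `a (c w)` (zero for `w ∈ T`)
perturbed by `z • p w`. -/
def pt {B : Type} [CommRing B] (z : B) (l : V → B) (a : ℕ → B × B) (p : V → B × B)
    (T : Finset V) (c : V → ℕ) (w : V) : B × B :=
  (if w ∈ T then 0 else l w) • a (c w) + z • p w

/-- Coordinate ring of the universal family of configurations `pt`. -/
abbrev GenRing (k V : Type) [Field k] : Type :=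
  Polynomial (MvPolynomial (V ⊕ ((ℕ ⊕ ℕ) ⊕ (V ⊕ V))) k)

/-- The universal configuration. -/
noncomputable def genPt (T : Finset V) (c : V → ℕ) (w : V) : GenRing k V × GenRing k V :=
  pt Polynomial.X (fun w => Polynomial.C (X (Sum.inl w)))
    (fun n => (Polynomial.C (X (Sum.inr (Sum.inl (Sum.inl n)))),
      Polynomial.C (X (Sum.inr (Sum.inl (Sum.inr n))))))
    (fun w => (Polynomial.C (X (Sum.inr (Sum.inr (Sum.inl w)))),
      Polynomial.C (X (Sum.inr (Sum.inr (Sum.inr w)))))) T c w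

/-- Polynomials vanishing to order `n` in the perturbation parameter. -/
noncomputable def ordIdeal (k : Type) [Field k] (T : Finset V) (c : V → ℕ) (n : ℕ) :
    Ideal (EdgeRing k V) :=
  (Ideal.span {(Polynomial.X : GenRing k V) ^ n}).comap (ev (genPt T c))

variable {T : Finset V} {c : V → ℕ} {n m : ℕ} {f g : EdgeRing k V}

lemma mem_ordIdeal_iff_X : f ∈ ordIdeal k T c n ↔
    (Polynomial.X : GenRing k V) ^ n ∣ ev (genPt T c) f := by
  rw [ordIdeal, Ideal.mem_comap, Ideal.mem_span_singleton]

lemma mem_ordIdeal : f ∈ ordIdeal k T c n ↔ ∀ (B : Type) [CommRing B] [Algebra k B] (z : B)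
    (l : V → B) (a : ℕ → B × B) (p : V → B × B), z ^ n ∣ ev (pt z l a p T c) f := by
  rw [mem_ordIdeal_iff_X]
  refine ⟨fun h B _ _ z l a p => ?_, fun h => h (GenRing k V) Polynomial.X
    (fun w => Polynomial.C (X (Sum.inl w)))
    (fun n => (Polynomial.C (X (Sum.inr (Sum.inl (Sum.inl n)))),
      Polynomial.C (X (Sum.inr (Sum.inl (Sum.inr n))))))
    (fun w => (Polynomial.C (X (Sum.inr (Sum.inr (Sum.inl w)))),
      Polynomial.C (X (Sum.inr (Sum.inr (Sum.inr w))))))⟩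
  let φ : GenRing k V →ₐ[k] B := Polynomial.eval₂AlgHom
    (aeval (Sum.elim l (Sum.elim (Sum.elim (fun n => (a n).1) (fun n => (a n).2))
      (Sum.elim (fun w => (p w).1) (fun w => (p w).2))))) z (fun _ => Commute.all _ _)
  have hX : φ Polynomial.X = z := by simp [φ]
  have h1 := map_dvd φ h
  rw [map_pow, hX, map_ev] at h1
  convert h1 using 3
  funext w
  ext <;> by_cases hw : w ∈ T <;> simp [genPt, pt, hw, φ, mul_comm z]

lemma ordIdeal_anti (h : n ≤ m) : ordIdeal k T c m ≤ ordIdeal k T c n := by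
  intro f hf
  rw [mem_ordIdeal_iff_X] at *
  exact (pow_dvd_pow _ h).trans hf

lemma mul_mem_ordIdeal (hf : f ∈ ordIdeal k T c n) (hg : g ∈ ordIdeal k T c m) :
    f * g ∈ ordIdeal k T c (n + m) := by
  rw [mem_ordIdeal_iff_X] at *
  rw [map_mul, pow_add]
  exact mul_dvd_mul hf hg

lemma ordIdeal_mul_le : ordIdeal k T c n * ordIdeal k T c m ≤ ordIdeal k T c (n + m) :=
  Ideal.mul_le.mpr fun _ hf _ hg => mul_mem_ordIdeal hf hg

lemma ordIdeal_zero : ordIdeal k T c 0 = ⊤ := by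
  rw [eq_top_iff]
  intro f _
  rw [mem_ordIdeal_iff_X, pow_zero]
  exact one_dvd _

lemma pow_le_ordIdeal {I : Ideal (EdgeRing k V)} (h : I ≤ ordIdeal k T c 1) (t : ℕ) :
    I ^ t ≤ ordIdeal k T c t := by
  induction t with
  | zero =>
    rw [ordIdeal_zero]
    exact le_top
  | succ t ih =>
    rw [pow_succ]
    exact (Ideal.mul_mono ih h).trans ordIdeal_mul_le

instance isPrime_ordIdeal : (ordIdeal k T c 1).IsPrime := by
  have : (Ideal.span {(Polynomial.X : GenRing k V) ^ 1}).IsPrime := by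
    rw [pow_one, Ideal.span_singleton_prime Polynomial.X_ne_zero]
    exact Polynomial.prime_X
  exact Ideal.comap_isPrime _ _

lemma mem_of_mul_mem_of_notMem_one (hg : g ∉ ordIdeal k T c 1)
    (h : g * f ∈ ordIdeal k T c n) : f ∈ ordIdeal k T c n := by
  rw [mem_ordIdeal_iff_X] at *
  rw [map_mul] at h
  rw [pow_one] at hg
  exact Polynomial.prime_X.pow_dvd_of_dvd_mul_left n hg h

lemma mem_of_mul_mem_of_notMem_two (hg : g ∉ ordIdeal k T c 2)
    (h : g * f ∈ ordIdeal k T c (n + 1)) : f ∈ ordIdeal k T c n := by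
  by_cases h1 : g ∈ ordIdeal k T c 1
  · rw [mem_ordIdeal_iff_X] at *
    rw [map_mul] at h
    rw [pow_one] at h1
    obtain ⟨b, hb⟩ := h1
    rw [hb] at h hg
    refine Polynomial.prime_X.pow_dvd_of_dvd_mul_left (a := b) n (fun hd => hg ?_) ?_
    · rw [pow_two]
      exact mul_dvd_mul_left _ hd
    · rw [pow_succ', mul_assoc] at h
      exact (mul_dvd_mul_iff_left Polynomial.X_ne_zero).mp h
  · exact mem_of_mul_mem_of_notMem_one h1 (ordIdeal_anti (Nat.le_succ n) h)

lemma br_notMem_ordIdeal_two {v w : V} (hvw : v ≠ w) (hw : w ∉ T) :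
    br v w ∉ ordIdeal k T c 2 := by
  intro h
  have h1 := mem_ordIdeal.mp h (Polynomial k) Polynomial.X (Pi.single w 1) (fun _ => (1, 0))
    (Pi.single v (0, 1))
  have h2 : ev (pt (Polynomial.X : Polynomial k) (Pi.single w 1) (fun _ => (1, 0))
      (Pi.single v (0, 1)) T c) (br v w : EdgeRing k V) = -Polynomial.X := by
    rw [ev_br]
    simp [pt, hw, hvw.symm, hvw]
  rw [h2, dvd_neg] at h1
  have h3 := (pow_dvd_pow_iff (Polynomial.X_ne_zero (R := k)) Polynomial.not_isUnit_X
    (n := 2) (m := 1)).mp (by rwa [pow_one])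
  omega

lemma br_notMem_ordIdeal_one {v w : V} (hv : v ∉ T) (hw : w ∉ T) (hc : c v ≠ c w) :
    br v w ∉ ordIdeal k T c 1 := by
  intro h
  have h1 := mem_ordIdeal.mp h (Polynomial k) Polynomial.X 1
    (fun n => if n = c v then (1, 0) else (0, 1)) 0
  rw [ev_br, pow_one] at h1
  simp [pt, hv, hw, hc.symm] at h1
  exact Polynomial.not_isUnit_X (isUnit_of_dvd_one h1)

lemma inl_notMem_ordIdeal_one {w : V} (hw : w ∉ T) :
    (X (Sum.inl w) : EdgeRing k V) ∉ ordIdeal k T c 1 := by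
  intro h
  have h1 := mem_ordIdeal.mp h (Polynomial k) Polynomial.X 1 (fun n => (1, 0)) 0
  rw [ev_inl, pow_one] at h1
  simp [pt, hw] at h1
  exact Polynomial.not_isUnit_X (isUnit_of_dvd_one h1)

lemma mv_le_ordIdeal {w : V} (hw : w ∈ T) : mv w ≤ ordIdeal k T c 1 := by
  rw [mv, Ideal.span_le]
  rintro _ (rfl | rfl) <;> rw [SetLike.mem_coe, mem_ordIdeal] <;> intro B _ _ z l a p
  · simp [pt, hw]
  · simp [pt, hw]

lemma br_mem_ordIdeal {i j : V} (h : i ∉ T → j ∉ T → c i = c j) :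
    br i j ∈ ordIdeal k T c 1 := by
  rw [mem_ordIdeal]
  intro B _ _ z l a p
  rw [ev_br, pow_one]
  by_cases hi : i ∈ T
  · refine ⟨(p i).1 * (pt z l a p T c j).2 - (pt z l a p T c j).1 * (p i).2, ?_⟩
    have h1 : pt z l a p T c i = z • p i := by simp [pt, hi]
    rw [h1]
    simp only [Prod.smul_fst, Prod.smul_snd, smul_eq_mul]
    ring
  by_cases hj : j ∈ T
  · refine ⟨(pt z l a p T c i).1 * (p j).2 - (p j).1 * (pt z l a p T c i).2, ?_⟩
    have h1 : pt z l a p T c j = z • p j := by simp [pt, hj]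
    rw [h1]
    simp only [Prod.smul_fst, Prod.smul_snd, smul_eq_mul]
    ring
  · refine ⟨l i * (a (c j)).1 * (p j).2 + (p i).1 * (l j * (a (c j)).2) + z * ((p i).1 * (p j).2)
      - l j * (a (c j)).1 * (p i).2 - (p j).1 * (l i * (a (c j)).2) - z * ((p j).1 * (p i).2), ?_⟩
    simp only [pt, hi, hj, if_false, h hi hj, Prod.fst_add, Prod.snd_add, Prod.smul_fst,
      Prod.smul_snd, smul_eq_mul]
    ring

/-- Vanishing orders can only increase under specialization of the configuration type. -/
lemma ordIdeal_le_of_specialization {T' : Finset V} {c' : V → ℕ}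
    (h : ∀ (B : Type) [CommRing B] [Algebra k B] (z : B) (l : V → B) (a : ℕ → B × B)
      (p : V → B × B), ∃ l' a' p', pt z l a p T c = pt z l' a' p' T' c') :
    ordIdeal k T' c' n ≤ ordIdeal k T c n := by
  intro f hf
  rw [mem_ordIdeal] at hf ⊢
  intro B _ _ z l a p
  obtain ⟨l', a', p', hp⟩ := h B z l a p
  rw [hp]
  exact hf B z l' a' p'

variable [Fintype V]

lemma homIdeal_ordIdeal : HomIdeal (ordIdeal k T c n) := by
  intro f hf δ
  rw [mem_ordIdeal] at hf ⊢
  intro B _ _ z l a p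
  obtain ⟨s, hs⟩ := exists_sum_comp f
  have h1 := hf (MvPolynomial V B) (C z) (fun w => X w * C (l w))
    (fun n => (C (a n).1, C (a n).2)) (fun w => (X w : MvPolynomial V B) • (C (p w).1, C (p w).2))
  have hpt : pt (C z) (fun w => X w * C (l w)) (fun n => (C (a n).1, C (a n).2))
      (fun w => (X w : MvPolynomial V B) • (C (p w).1, C (p w).2)) T c =
      fun w => (X w : MvPolynomial V B) •
        (C (pt z l a p T c w).1, C (pt z l a p T c w).2) := by
    funext w
    by_cases hw : w ∈ T
    · ext1 <;> simp [pt, hw] <;> ring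
    · ext1 <;> simp [pt, hw] <;> ring
  have hcomp : ∀ γ, ev (fun w => (X w : MvPolynomial V B) •
      (C (pt z l a p T c w).1, C (pt z l a p T c w).2)) (comp γ f) =
      monomial (Finsupp.equivFunOnFinite.symm γ) (ev (pt z l a p T c) (comp γ f)) := by
    intro γ
    rw [ev_smul (hom_comp γ f)]
    have h2 := map_ev (Algebra.ofId B (MvPolynomial V B) |>.restrictScalars k) (pt z l a p T c)
      (comp γ f)
    change C (ev (pt z l a p T c) (comp γ f)) =
      ev (fun w => (C (pt z l a p T c w).1, C (pt z l a p T c w).2)) (comp γ f) at h2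
    rw [← h2, monomial_eq, mul_comm, Finsupp.prod_fintype _ _ (by simp)]
    rfl
  rw [hpt, hs, map_sum, Finset.sum_congr rfl fun γ _ => hcomp γ, ← C_pow,
    C_dvd_iff_dvd_coeff] at h1
  have h2 := h1 (Finsupp.equivFunOnFinite.symm δ)
  rw [coeff_sum] at h2
  by_cases hδ : δ ∈ s
  · rw [Finset.sum_eq_single_of_mem δ hδ, coeff_monomial, if_pos rfl] at h2
    · exact h2
    · intro γ _ hγ
      rw [coeff_monomial, if_neg]
      exact fun h => hγ (Finsupp.equivFunOnFinite.symm.injective h)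
  · have : comp δ f = 0 := by
      rw [hs, map_sum]
      refine Finset.sum_eq_zero fun γ hγ => (hom_comp γ f).comp_ne ?_
      rintro rfl
      exact hδ hγ
    rw [this, map_zero]
    exact dvd_zero _

/-- Configuration types on which all brackets of edges inside `U` vanish. -/
structure Valid (G : SimpleGraph V) (U T : Finset V) (c : V → ℕ) : Prop where
  subset : T ⊆ U
  eq : ∀ i ∈ U, ∀ j ∈ U, i ∉ T → j ∉ T → G.Adj i j → c i = c j

lemma Valid.edgeIdeal_le {G : SimpleGraph V} {U : Finset V} (h : Valid G U T c) :
    edgeIdeal k G U ≤ ordIdeal k T c 1 := by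
  rw [edgeIdeal, Ideal.span_le]
  rintro _ ⟨i, hi, j, hj, hij, rfl⟩
  exact br_mem_ordIdeal fun hiT hjT => h.eq i hi j hj hiT hjT hij

lemma prod_mv_le_ordIdeal (e : V → ℕ) : ∏ w, mv w ^ e w ≤ ordIdeal k T c (∑ w ∈ T, e w) := by
  have h1 : ∏ w, mv w ^ e w ≤ ∏ w ∈ T, (mv w ^ e w : Ideal (EdgeRing k V)) := by
    rw [← Finset.prod_sdiff (Finset.subset_univ T)]
    exact Ideal.mul_le_right
  refine h1.trans ?_
  have h2 : ∀ s ⊆ T, ∏ w ∈ s, mv w ^ e w ≤ ordIdeal k T c (∑ w ∈ s, e w) := by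
    intro s
    induction s using Finset.induction_on with
    | empty =>
      intro _
      rw [Finset.sum_empty, ordIdeal_zero]
      exact le_top
    | insert a s ha ih =>
      intro hs
      rw [Finset.prod_insert ha, Finset.sum_insert ha]
      exact (Ideal.mul_mono (pow_le_ordIdeal (mv_le_ordIdeal (hs (Finset.mem_insert_self a s))) _)
        (ih ((Finset.subset_insert a s).trans hs))).trans ordIdeal_mul_le
  exact h2 T subset_rfl

lemma Valid.mixed_le {G : SimpleGraph V} {U : Finset V} (h : Valid G U T c) (t : ℕ)
    (e : V → ℕ) : mixed k G U t e ≤ ordIdeal k T c (t + ∑ w ∈ T, e w) :=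
  (Ideal.mul_mono (pow_le_ordIdeal h.edgeIdeal_le t) (prod_mv_le_ordIdeal e)).trans
    ordIdeal_mul_le

end Order

section Membership

variable {k V : Type} [Field k] [DecidableEq V] [Fintype V] {G : SimpleGraph V}
  {T : Finset V} {c : V → ℕ} {n : ℕ} {f : EdgeRing k V}

lemma mixed_anti {U : Finset V} {t t' : ℕ} (h : t ≤ t') (e : V → ℕ) :
    mixed k G U t' e ≤ mixed k G U t e :=
  Ideal.mul_mono_left (Ideal.pow_le_pow_right h)

lemma le_of_mem_mixed {U : Finset V} (t : ℕ) (e : V → ℕ) {δ : V → ℕ}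
    (hf : f ∈ mixed k G U t e) (hδ : Hom δ f) (h0 : f ≠ 0) : e ≤ δ := by
  refine mixed_induction (p := fun t e => ∀ (δ : V → ℕ) (f : EdgeRing k V),
    f ∈ mixed k G U t e → Hom δ f → f ≠ 0 → e ≤ δ) ?_ ?_ ?_ t e δ f hf hδ h0
  · exact fun δ _ _ _ _ w => Nat.zero_le _
  · exact fun _ _ δ _ _ _ _ w => Nat.zero_le _
  · intro t e w ih δ f hf hδ h0
    rw [mixed_add_single, pow_one] at hf
    by_contra hle
    refine h0 (mul_span_induction (homIdeal_mixed t e) (fun z hz => ⟨_, hom_of_mem_coords hz⟩)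
      (p := fun f => f = 0) rfl (fun a b ha hb => by rw [ha, hb, add_zero]) ?_ hf hδ)
    intro r z γ d hr hz hγ hd hγd
    by_contra hrz
    have hz0 : z ≠ 0 := right_ne_zero_of_mul hrz
    obtain rfl := IsWeightedHomogeneous.inj_right hz0 hd (hom_of_mem_coords hz)
    exact hle (hγd ▸ add_le_add_left (ih γ r hr hγ (left_ne_zero_of_mul hrz)) _)

lemma mem_ordIdeal_of_insert {u : V} (hu : u ∉ T) {δ : V → ℕ} (hδ : Hom δ f)
    (h : f ∈ ordIdeal k (insert u T) c (n + δ u)) : f ∈ ordIdeal k T c n := by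
  rw [mem_ordIdeal_iff_X]
  have key : ∀ (B : Type) [CommRing B] [Algebra k B] (z : B) (l : V → B) (a : ℕ → B × B)
      (p : V → B × B), z ^ (n + δ u) ∣ z ^ δ u * ev (pt z l a p T c) f := by
    intro B _ _ z l a p
    have h1 := mem_ordIdeal.mp h B z l a (Function.update p u (pt z l a p T c u))
    have h2 : pt z l a (Function.update p u (pt z l a p T c u)) (insert u T) c =
        fun w => (if w = u then z else 1) • pt z l a p T c w := by
      funext w
      by_cases hw : w = u
      · subst hw
        simp [pt]
      · simp [pt, hw]
    rw [h2, ev_smul hδ] at h1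
    simpa [ite_pow, Finset.prod_ite_eq'] using h1
  have h3 := key (GenRing k V) Polynomial.X
    (fun w => Polynomial.C (X (Sum.inl w)))
    (fun n => (Polynomial.C (X (Sum.inr (Sum.inl (Sum.inl n)))),
      Polynomial.C (X (Sum.inr (Sum.inl (Sum.inr n))))))
    (fun w => (Polynomial.C (X (Sum.inr (Sum.inr (Sum.inl w)))),
      Polynomial.C (X (Sum.inr (Sum.inr (Sum.inr w))))))
  rw [add_comm, pow_add] at h3
  exact (mul_dvd_mul_iff_left (pow_ne_zero _ Polynomial.X_ne_zero)).mp h3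

/-- The vanishing orders of multihomogeneous polynomials along configurations of vectors
detect membership in mixed ideals on the induced subgraph `G[U]`. -/
def Detects (k : Type) [Field k] (G : SimpleGraph V) (A U : Finset V) : Prop :=
  ∀ (t : ℕ) (δ e : V → ℕ) (f : EdgeRing k V), e ≤ δ → (∀ w ∉ A, e w = 0) → Hom δ f →
    (∀ T c, T ⊆ A → Valid G U T c → f ∈ ordIdeal k T c (t + ∑ w ∈ T, e w)) →
    f ∈ mixed k G U t e

variable {A U : Finset V}

lemma detects_empty : Detects k G A ∅ := by
  intro t δ e f heδ _ hδ h
  cases t with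
  | zero => exact mem_mixed_zero hδ heδ
  | succ t =>
    obtain ⟨c, hc⟩ : ∃ c : V → ℕ, Function.Injective c :=
      ⟨fun v => Fintype.equivFin V v, fun a b hab => (Fintype.equivFin V).injective (Fin.ext hab)⟩
    have h1 := mem_ordIdeal.mp (h ∅ c (Finset.empty_subset _)
      ⟨subset_rfl, fun i hi => absurd hi (Finset.notMem_empty i)⟩) (EdgeRing k V) 0 1
      (Function.extend c gp 0) 0
    have h2 : pt (0 : EdgeRing k V) 1 (Function.extend c gp 0) 0 ∅ c = gp := by
      funext w
      simp [pt, hc.extend_apply]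
    rw [h2, ev_gp, zero_pow (by omega), zero_dvd_iff] at h1
    rw [h1]
    exact zero_mem _

lemma detects_of_isolated {v : V} (hiso : ∀ w ∈ U, ¬ G.Adj v w)
    (ih : Detects k G A (U.erase v)) : Detects k G A U := by
  intro t δ e f heδ heA hδ h
  refine mixed_mono (Finset.erase_subset v U) t e (ih t δ e f heδ heA hδ fun T c hT hval => ?_)
  refine h T c hT ⟨hval.subset.trans (Finset.erase_subset v U), fun i hi j hj hiT hjT hij => ?_⟩
  have hi' : i ≠ v := by
    rintro rfl
    exact hiso j hj hij
  have hj' : j ≠ v := by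
    rintro rfl
    exact hiso i hi hij.symm
  exact hval.eq i (Finset.mem_erase.mpr ⟨hi', hi⟩) j (Finset.mem_erase.mpr ⟨hj', hj⟩) hiT hjT hij

lemma mem_mixed_of_eq_degree {u : V} (huU : u ∈ U) (huA : u ∈ A)
    (ih : Detects k G A (U.erase u)) {t : ℕ} {δ e : V → ℕ} (heδ : e ≤ δ)
    (heA : ∀ w ∉ A, e w = 0) (hδ : Hom δ f) (hu : e u = δ u)
    (h : ∀ T c, T ⊆ A → Valid G U T c → f ∈ ordIdeal k T c (t + ∑ w ∈ T, e w)) :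
    f ∈ mixed k G U t e := by
  refine mixed_mono (Finset.erase_subset u U) t e (ih t δ e f heδ heA hδ fun T c hT hval => ?_)
  have huT : u ∉ T := fun h => Finset.notMem_erase u U (hval.subset h)
  refine mem_ordIdeal_of_insert huT hδ ?_
  have h1 := h (insert u T) c (Finset.insert_subset huA hT)
    ⟨Finset.insert_subset huU (hval.subset.trans (Finset.erase_subset u U)),
      fun i hi j hj hiT hjT hij => ?_⟩
  · rw [Finset.sum_insert huT, hu] at h1
    rwa [add_assoc, add_comm (∑ w ∈ T, e w)]
  · rw [Finset.mem_insert, not_or] at hiT hjT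
    exact hval.eq i (Finset.mem_erase.mpr ⟨hiT.1, hi⟩) j (Finset.mem_erase.mpr ⟨hjT.1, hj⟩)
      hiT.2 hjT.2 hij

/-- Induction step at a pair `v, w` of adjacent twins with `w ∉ A`. -/
lemma detects_of_twin {v w : V} (hv : v ∈ U) (hw : w ∈ U) (hwA : w ∉ A) (hvw : G.Adj v w)
    (hclv : ∀ i ∈ U, ∀ j ∈ U, G.Adj v i → G.Adj v j → i ≠ j → G.Adj i j)
    (hclw : ∀ i j, G.Adj w i → G.Adj w j → i ≠ j → G.Adj i j)
    (ihv : Detects k G A (U.erase v)) (ihw : Detects k G A (U.erase w)) : Detects k G A U := by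
  intro t δ e f heδ heA hδ h
  have hew : e w = 0 := heA w hwA
  induction t generalizing δ f with
  | zero => exact mem_mixed_zero hδ heδ
  | succ t iht =>
    by_cases hcap : v ∈ A ∧ e v = δ v
    · exact mem_mixed_of_eq_degree hv hcap.1 ihv heδ heA hδ hcap.2 h
    have hvw' : v ≠ w := hvw.ne
    have hsub : subst v w f ∈ mixed k G (U.erase w) (t + 1) e := by
      refine ihw (t + 1) _ e _ ?_ heA (hom_subst v w hδ) ?_
      · intro a
        by_cases ha : a = w
        · subst ha
          simp [hew]
        · simp only [Pi.add_apply, Function.update_of_ne ha]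
          exact (heδ a).trans (Nat.le_add_right _ _)
      · intro T c hT hval
        have hwT : w ∉ T := fun h => hwA (hT h)
        obtain ⟨m, hm, hm'⟩ : ∃ m, (v ∉ T → m = c v) ∧
            ∀ j ∈ U, j ≠ w → j ∉ T → G.Adj w j → m = c j := by
          by_cases hvT : v ∈ T
          · by_cases hex : ∃ j ∈ U, j ≠ w ∧ j ∉ T ∧ G.Adj w j
            · obtain ⟨j, hj, hjw, hjT, hwj⟩ := hex
              refine ⟨c j, fun h => absurd hvT h, fun i hi hiw hiT hwi => ?_⟩
              by_cases hij : j = i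
              · rw [hij]
              · exact hval.eq j (Finset.mem_erase.mpr ⟨hjw, hj⟩) i
                  (Finset.mem_erase.mpr ⟨hiw, hi⟩) hjT hiT (hclw j i hwj hwi hij)
            · exact ⟨0, fun h => absurd hvT h, fun i hi hiw hiT hwi =>
                absurd ⟨i, hi, hiw, hiT, hwi⟩ hex⟩
          · refine ⟨c v, fun _ => rfl, fun i hi hiw hiT hwi => ?_⟩
            by_cases hij : v = i
            · rw [hij]
            · exact hval.eq v (Finset.mem_erase.mpr ⟨hvw', hv⟩) i
                (Finset.mem_erase.mpr ⟨hiw, hi⟩) hvT hiT (hclw v i hvw.symm hwi hij)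
        have hval' : Valid G U T (Function.update c w m) := by
          refine ⟨hval.subset.trans (Finset.erase_subset w U), fun i hi j hj hiT hjT hij => ?_⟩
          by_cases hiw : i = w
          · subst hiw
            rw [Function.update_self, Function.update_of_ne hij.ne']
            exact hm' j hj hij.ne' hjT hij
          by_cases hjw : j = w
          · subst hjw
            rw [Function.update_self, Function.update_of_ne hiw]
            exact (hm' i hi hiw hiT hij.symm).symm
          rw [Function.update_of_ne hiw, Function.update_of_ne hjw]
          exact hval.eq i (Finset.mem_erase.mpr ⟨hiw, hi⟩) j (Finset.mem_erase.mpr ⟨hjw, hj⟩)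
            hiT hjT hij
        rw [mem_ordIdeal]
        intro B _ _ z l a p
        have h1 := mem_ordIdeal.mp (h T _ hT hval') B z
          (Function.update l w (if v ∈ T then 0 else l v)) a (Function.update p w (p v))
        rw [ev_subst]
        convert h1 using 3
        funext b
        by_cases hb : b = w
        · subst hb
          by_cases hvT : v ∈ T
          · simp [pt, hwT, hvT]
          · simp [pt, hwT, hvT, hm hvT]
        · simp [pt, hb]
    obtain ⟨F, hFm, hF, hFs⟩ := exists_mem_mixed_subst_eq (Finset.erase_subset w U) hw
      (Finset.notMem_erase w U) hvw'
      (fun b hb hvb => hclv w hw b (Finset.mem_of_mem_erase hb) hvw hvb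
        (Finset.ne_of_mem_erase hb).symm)
      (t + 1) e hew (γ := Function.update δ w 0) (q := δ w) (by simp)
      (by simpa [hvw'] using heδ v) hsub (hom_subst v w hδ)
    have hδ' : Function.update δ w 0 + Pi.single w (δ w) = δ := by
      funext a
      by_cases ha : a = w
      · subst ha
        simp
      · simp [ha]
    rw [hδ'] at hF
    obtain ⟨f', hf'⟩ := br_dvd_of_subst_eq_zero hvw' (hδ.sub hF) (by rw [map_sub, hFs, sub_self])
    have hsum : f = F + (f - F) := by ring
    rw [hsum]
    refine add_mem hFm ?_
    have hdeg := hδ.sub hF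
    rw [hf'] at hdeg ⊢
    rcases exists_hom_of_mul (hom_br v w) hdeg with h0 | ⟨γ, f'', hγ, hf'', heq⟩
    · rw [h0]
      exact zero_mem _
    have hγa : ∀ a, γ a + ((Pi.single v 1 : V → ℕ) a + (Pi.single w 1 : V → ℕ) a) = δ a :=
      fun a => congrFun hγ a
    have hvv := hγa v
    simp only [Pi.single_eq_same, ne_eq, hvw', not_false_eq_true, Pi.single_eq_of_ne] at hvv
    rw [heq, mixed_succ, mul_comm (br v w)]
    refine Ideal.mul_mem_mul (iht γ f'' ?_ hf'' fun T c hT hval => ?_)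
      (br_mem_edgeIdeal hv hw hvw)
    · intro a
      change e a ≤ γ a
      by_cases hav : a = v
      · subst hav
        have : e a ≤ δ a := heδ a
        by_cases haA : a ∈ A
        · have : e a ≠ δ a := fun h => hcap ⟨haA, h⟩
          omega
        · rw [heA a haA]
          exact Nat.zero_le _
      by_cases haw : a = w
      · subst haw
        rw [hew]
        exact Nat.zero_le _
      have h1 := hγa a
      have h2 : e a ≤ δ a := heδ a
      simp only [Pi.single_eq_of_ne hav, Pi.single_eq_of_ne haw] at h1
      omega
    · have hwT : w ∉ T := fun h => hwA (hT h)
      refine mem_of_mul_mem_of_notMem_two (br_notMem_ordIdeal_two hvw' hwT) ?_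
      rw [← heq, ← hf', add_right_comm]
      exact sub_mem (h T c hT hval) (hval.mixed_le _ _ hFm)

end Membership

section Pendant

variable {k V : Type} [Field k] [DecidableEq V] [Fintype V] {G : SimpleGraph V}
  {f : EdgeRing k V} {A U : Finset V}

lemma update_zero_add_single (δ : V → ℕ) (v : V) :
    Function.update δ v 0 + Pi.single v (δ v) = δ := by
  funext a
  by_cases ha : a = v
  · subst ha
    simp
  · simp [ha]

lemma exists_fresh (c : V → ℕ) : ∃ m, ∀ w, c w ≠ m := by
  obtain ⟨m, hm⟩ := Infinite.exists_notMem_finset (Finset.univ.image c)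
  exact ⟨m, fun w hw => hm (Finset.mem_image.mpr ⟨w, Finset.mem_univ w, hw⟩)⟩

lemma Valid.of_pendant {u v : V} {T : Finset V} {c : V → ℕ} {m : ℕ}
    (hN : ∀ w ∈ U, G.Adj v w → w = u) (hval : Valid G (U.erase v) T c) (hm : u ∉ T → m = c u) :
    Valid G U T (Function.update c v m) := by
  refine ⟨hval.subset.trans (Finset.erase_subset v U), fun i hi j hj hiT hjT hij => ?_⟩
  by_cases hiv : i = v
  · subst hiv
    obtain rfl := hN j hj hij
    rw [Function.update_self, Function.update_of_ne hij.ne', hm hjT]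
  by_cases hjv : j = v
  · subst hjv
    obtain rfl := hN i hi hij.symm
    rw [Function.update_self, Function.update_of_ne hiv, hm hiT]
  rw [Function.update_of_ne hiv, Function.update_of_ne hjv]
  exact hval.eq i (Finset.mem_erase.mpr ⟨hiv, hi⟩) j (Finset.mem_erase.mpr ⟨hjv, hj⟩) hiT hjT hij

/-- Membership criterion at a vertex `v` with a single neighbour `u` when the exponent at `v`
vanishes; only configurations with `v ∉ T` are needed. -/
lemma mem_mixed_of_pendant {u v : V} (hu : u ∈ U) (hv : v ∈ U) (huA : u ∈ A) (hvu : G.Adj v u)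
    (hN : ∀ w ∈ U, G.Adj v w → w = u) (ihv : Detects k G A (U.erase v))
    (ihvu : Detects k G A ((U.erase v).erase u)) {t : ℕ} {δ e : V → ℕ} (heδ : e ≤ δ)
    (heA : ∀ w ∉ A, e w = 0) (hev : e v = 0) (hδ : Hom δ f)
    (h : ∀ T c, T ⊆ A → v ∉ T → Valid G U T c → f ∈ ordIdeal k T c (t + ∑ w ∈ T, e w)) :
    f ∈ mixed k G U t e := by
  have huv' : u ≠ v := hvu.ne'
  induction t generalizing δ f with
  | zero => exact mem_mixed_zero hδ heδ
  | succ t iht =>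
    by_cases hcap : e u = δ u
    · refine mixed_mono ((Finset.erase_subset u _).trans (Finset.erase_subset v U)) (t + 1) e
        (ihvu (t + 1) δ e f heδ heA hδ fun T c hT hval => ?_)
      have huT : u ∉ T := fun h => Finset.notMem_erase u _ (hval.subset h)
      have hvT : v ∉ T := fun h =>
        Finset.notMem_erase v U (Finset.mem_of_mem_erase (hval.subset h))
      refine mem_ordIdeal_of_insert huT hδ ?_
      have h1 := h (insert u T) c (Finset.insert_subset huA hT) (by simp [huv'.symm, hvT])
        ⟨Finset.insert_subset hu (hval.subset.trans
          ((Finset.erase_subset u _).trans (Finset.erase_subset v U))),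
          fun i hi j hj hiT hjT hij => ?_⟩
      · rw [Finset.sum_insert huT, hcap] at h1
        rwa [add_assoc, add_comm (∑ w ∈ T, e w)]
      · rw [Finset.mem_insert, not_or] at hiT hjT
        have hiv : i ≠ v := by
          rintro rfl
          exact hjT.1 (hN j hj hij)
        have hjv : j ≠ v := by
          rintro rfl
          exact hiT.1 (hN i hi hij.symm)
        exact hval.eq i (by simp [hiT.1, hiv, hi]) j (by simp [hjT.1, hjv, hj]) hiT.2 hjT.2 hij
    have hsub : subst u v f ∈ mixed k G (U.erase v) (t + 1) (e + Pi.single u (δ v)) := by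
      refine ihv (t + 1) _ _ _ ?_ ?_ (hom_subst u v hδ) ?_
      · refine add_le_add_left (fun a => ?_) _
        by_cases ha : a = v
        · subst ha
          simp [hev]
        · simpa [ha] using heδ a
      · intro w hw
        have hwu : w ≠ u := fun h => hw (h ▸ huA)
        simp [heA w hw, hwu]
      · intro T c hT hval
        have hvT : v ∉ T := fun h => Finset.notMem_erase v U (hval.subset h)
        by_cases huT : u ∈ T
        · obtain ⟨m, hm⟩ := exists_fresh c
          have hsum : ∑ w ∈ T, (e + Pi.single u (δ v) : V → ℕ) w = ∑ w ∈ T, e w + δ v := by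
            simp only [Pi.add_apply, Finset.sum_add_distrib, Finset.sum_pi_single', huT, if_true]
          rw [hsum, ← add_assoc, mem_ordIdeal]
          intro B _ _ z l a p
          have h1 := mem_ordIdeal.mp (h T _ hT hvT (hval.of_pendant hN (m := m)
            fun h => absurd huT h)) B z (Function.update l v 1) (Function.update a m (p u))
            (Function.update p v 0)
          rw [ev_subst]
          have h2 : Function.update (pt z l a p T c) v (pt z l a p T c u) = fun w =>
              (if w = v then z else 1) • pt z (Function.update l v 1) (Function.update a m (p u))
                (Function.update p v 0) T (Function.update c v m) w := by
            funext w
            by_cases hw : w = v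
            · subst hw
              simp [pt, huT, hvT]
            · simp [pt, hw, hm w]
          rw [h2, ev_smul hδ, pow_add, mul_comm]
          simpa [ite_pow, Finset.prod_ite_eq'] using mul_dvd_mul_left (z ^ δ v) h1
        · have hsum : ∑ w ∈ T, (e + Pi.single u (δ v) : V → ℕ) w = ∑ w ∈ T, e w := by
            refine Finset.sum_congr rfl fun w hw => ?_
            have hwu : w ≠ u := fun h => huT (h ▸ hw)
            simp [hwu]
          rw [hsum, mem_ordIdeal]
          intro B _ _ z l a p
          have h1 := mem_ordIdeal.mp (h T _ hT hvT (hval.of_pendant hN (m := c u)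
            fun _ => rfl)) B z (Function.update l v (l u)) a (Function.update p v (p u))
          rw [ev_subst]
          convert h1 using 3
          funext b
          by_cases hb : b = v
          · subst hb
            simp [pt, hvT, huT]
          · simp [pt, hb]
    obtain ⟨F, hFm, hF, hFs⟩ := exists_mem_mixed_subst_eq_of_add (t + 1) (δ v) e
      (Function.update_self v 0 δ) hsub (hom_subst u v hδ)
    rw [update_zero_add_single] at hF
    replace hFm := mixed_mono (Finset.erase_subset v U) _ _ hFm
    obtain ⟨f', hf'⟩ := br_dvd_of_subst_eq_zero huv' (hδ.sub hF) (by rw [map_sub, hFs, sub_self])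
    have hsum : f = F + (f - F) := by ring
    rw [hsum]
    refine add_mem hFm ?_
    have hdeg := hδ.sub hF
    rw [hf'] at hdeg ⊢
    rcases exists_hom_of_mul (hom_br u v) hdeg with h0 | ⟨γ, f'', hγ, hf'', heq⟩
    · rw [h0]
      exact zero_mem _
    have hγa : ∀ a, γ a + ((Pi.single u 1 : V → ℕ) a + (Pi.single v 1 : V → ℕ) a) = δ a :=
      fun a => congrFun hγ a
    rw [heq, mixed_succ, mul_comm (br u v)]
    refine Ideal.mul_mem_mul (iht ?_ hf'' fun T c hT hvT hval => ?_)
      (br_mem_edgeIdeal hu hv hvu.symm)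
    · intro a
      change e a ≤ γ a
      have h1 := hγa a
      have h2 : e a ≤ δ a := heδ a
      by_cases hau : a = u
      · subst hau
        simp only [Pi.single_eq_same, ne_eq, huv', not_false_eq_true, Pi.single_eq_of_ne] at h1
        omega
      by_cases hav : a = v
      · subst hav
        rw [hev]
        exact Nat.zero_le _
      simp only [Pi.single_eq_of_ne hau, Pi.single_eq_of_ne hav] at h1
      omega
    · refine mem_of_mul_mem_of_notMem_two (br_notMem_ordIdeal_two huv' hvT) ?_
      rw [← heq, ← hf', add_right_comm]
      exact sub_mem (h T c hT hvT hval) (hval.mixed_le _ _ hFm)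

lemma edgeIdeal_le_of_pendant {u v : V} (hN : ∀ w ∈ U, G.Adj v w → w = u) :
    edgeIdeal k G U ≤ edgeIdeal k G (U.erase v) ⊔ Ideal.span {br u v} := by
  rw [edgeIdeal, Ideal.span_le]
  rintro _ ⟨i, hi, j, hj, hij, rfl⟩
  have hbr : (br u v : EdgeRing k V) ∈ edgeIdeal k G (U.erase v) ⊔ Ideal.span {br u v} :=
    Ideal.mem_sup_right (Ideal.mem_span_singleton_self _)
  by_cases hiv : i = v
  · subst hiv
    obtain rfl := hN j hj hij
    have h1 := neg_mem hbr
    rwa [← br_swap] at h1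
  by_cases hjv : j = v
  · subst hjv
    obtain rfl := hN i hi hij.symm
    exact hbr
  · exact Ideal.mem_sup_left (br_mem_edgeIdeal (Finset.mem_erase.mpr ⟨hiv, hi⟩)
      (Finset.mem_erase.mpr ⟨hjv, hj⟩) hij)

/-- Multiplication by powers of the bracket of a pendant edge can be cancelled. -/
lemma mem_mixed_of_br_pow_mul_mem {u v : V} (hvu : G.Adj v u)
    (hN : ∀ w ∈ U, G.Adj v w → w = u) (ihv : Detects k G A (U.erase v)) {t j : ℕ}
    {δ e : V → ℕ} (heA : ∀ w ∉ A, e w = 0) (hδ : Hom δ f) (hf : f ∈ mixed k G U t e)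
    (h : br u v ^ j * f ∈ mixed k G (U.erase v) t e) : f ∈ mixed k G (U.erase v) t e := by
  by_cases h0 : f = 0
  · rw [h0]
    exact zero_mem _
  refine ihv t δ e f (le_of_mem_mixed t e hf hδ h0) heA hδ fun T c _ hval => ?_
  obtain ⟨m, hm⟩ := exists_fresh c
  have hvT : v ∉ T := fun h => Finset.notMem_erase v U (hval.subset h)
  have key : f ∈ ordIdeal k T (Function.update c v m) (t + ∑ w ∈ T, e w) := by
    by_cases huT : u ∈ T
    · exact (hval.of_pendant hN fun h => absurd huT h).mixed_le t e hf
    · have hval' : Valid G (U.erase v) T (Function.update c v m) := by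
        refine ⟨hval.subset, fun i hi j hj hiT hjT hij => ?_⟩
        rw [Function.update_of_ne (Finset.ne_of_mem_erase hi),
          Function.update_of_ne (Finset.ne_of_mem_erase hj)]
        exact hval.eq i hi j hj hiT hjT hij
      refine mem_of_mul_mem_of_notMem_one (fun hbr => ?_) (hval'.mixed_le t e h)
      refine br_notMem_ordIdeal_one huT hvT ?_ (isPrime_ordIdeal.mem_of_pow_mem j hbr)
      rw [Function.update_self, Function.update_of_ne hvu.ne']
      exact hm u
  refine ordIdeal_le_of_specialization (fun B _ _ z l a p =>
    ⟨l, Function.update a m (a (c v)), p, ?_⟩) key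
  funext w
  by_cases hw : w = v
  · subst hw
    simp [pt]
  · simp [pt, hw, hm w]

lemma mem_mixed_mul_mv_pow_of_pendant {u v : V} (hu : u ∈ U) (hv : v ∈ U) (hvu : G.Adj v u)
    (hN : ∀ w ∈ U, G.Adj v w → w = u) (ihv : Detects k G A (U.erase v)) {m : ℕ} {e : V → ℕ}
    (heA : ∀ w ∉ A, e w = 0) (hev : e v = 0) (D : ℕ) {t j : ℕ} {δ : V → ℕ} (hδ : Hom δ f)
    (hf : f ∈ mixed k G U t e) (hδv : δ v = D + m)
    (h : br u v ^ j * f ∈ mixed k G (U.erase v) (t - D) e) :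
    f ∈ mixed k G U t e * mv v ^ m := by
  have hH : ∀ {t : ℕ} {δ : V → ℕ} {f : EdgeRing k V}, f ∈ mixed k G (U.erase v) t e → Hom δ f →
      m ≤ δ v → f ∈ mixed k G U t e * mv v ^ m := fun {t δ f} hf hδ hm =>
    Ideal.mul_mono (mixed_mono (Finset.erase_subset v U) t e) (Ideal.pow_le_pow_right hm)
      (mem_mixed_mul_mv_pow (Finset.notMem_erase v U) t e hev hf hδ)
  induction D generalizing t j δ f with
  | zero => exact hH (mem_mixed_of_br_pow_mul_mem hvu hN ihv heA hδ hf h) hδ (by omega)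
  | succ D ih =>
    cases t with
    | zero =>
      by_cases h0 : f = 0
      · rw [h0]
        exact zero_mem _
      rw [← mixed_add_single]
      refine mem_mixed_zero hδ fun w => ?_
      have h1 : e w ≤ δ w := le_of_mem_mixed 0 e hf hδ h0 w
      by_cases hw : w = v
      · subst hw
        simp only [Pi.add_apply, hev, Pi.single_eq_same]
        omega
      · simpa [hw] using h1
    | succ t =>
      obtain ⟨f₀, f', hf₀, hf', hδ₀, rfl, hγ⟩ := exists_eq_add_br_mul (edgeIdeal_le_of_pendant hN)
        (Finset.erase_subset v U) (br_mem_edgeIdeal hu hv hvu.symm) hf hδ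
      refine add_mem (hH hf₀ hδ₀ (by omega)) ?_
      rcases hγ with rfl | ⟨γ, hγ, hγf⟩
      · rw [mul_zero]
        exact zero_mem _
      have h1 : f' ∈ mixed k G U t e * mv v ^ m := by
        refine ih (j := j + 1) hγf hf' ?_ ?_
        · have h2 := congrFun hγ v
          simp only [Pi.add_apply, Pi.single_eq_same, Pi.single_eq_of_ne hvu.ne] at h2
          omega
        · have h2 : br u v ^ (j + 1) * f' = br u v ^ j * (f₀ + br u v * f') - br u v ^ j * f₀ := by
            ring
          rw [h2]
          rw [Nat.add_sub_add_right] at h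
          exact sub_mem h (Ideal.mul_mem_left _ _ (mixed_anti (by omega) e hf₀))
      rw [mixed_succ, mul_right_comm, mul_comm (br u v)]
      exact Ideal.mul_mem_mul h1 (br_mem_edgeIdeal hu hv hvu.symm)

/-- Induction step at a vertex `v` with a single neighbour `u ∈ A`. -/
lemma detects_of_pendant {u v : V} (hu : u ∈ U) (hv : v ∈ U) (huA : u ∈ A) (hvu : G.Adj v u)
    (hN : ∀ w ∈ U, G.Adj v w → w = u) (ihv : Detects k G A (U.erase v))
    (ihvu : Detects k G A ((U.erase v).erase u)) : Detects k G A U := by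
  intro t δ e f heδ heA hδ h
  by_cases hev : e v = 0
  · exact mem_mixed_of_pendant hu hv huA hvu hN ihv ihvu heδ heA hev hδ
      fun T c hT _ hval => h T c hT hval
  have hvA : v ∈ A := by_contra fun hvA => hev (heA v hvA)
  have he0 : Function.update e v 0 ≤ e := by
    intro w
    by_cases hw : w = v
    · subst hw
      simp
    · simp [hw]
  have heA0 : ∀ w ∉ A, Function.update e v 0 w = 0 := fun w hw =>
    Nat.le_zero.mp ((he0 w).trans (heA w hw).le)
  have hsum : ∀ T : Finset V, v ∉ T → ∑ w ∈ T, Function.update e v 0 w = ∑ w ∈ T, e w := by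
    intro T hvT
    refine Finset.sum_congr rfl fun w hw => ?_
    rw [Function.update_of_ne]
    rintro rfl
    exact hvT hw
  have h1 : f ∈ mixed k G U t (Function.update e v 0) := by
    refine mem_mixed_of_pendant hu hv huA hvu hN ihv ihvu (he0.trans heδ) heA0
      (Function.update_self v 0 e) hδ fun T c hT hvT hval => ?_
    rw [hsum T hvT]
    exact h T c hT hval
  have hle : e v ≤ δ v := heδ v
  have h2 : f ∈ mixed k G (U.erase v) (t - (δ v - e v)) (Function.update e v 0) := by
    by_cases ht : t ≤ δ v - e v
    · rw [Nat.sub_eq_zero_of_le ht]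
      exact mem_mixed_zero hδ (he0.trans heδ)
    refine ihv _ δ _ f (he0.trans heδ) heA0 hδ fun T c hT hval => ?_
    have hvT : v ∉ T := fun h => Finset.notMem_erase v U (hval.subset h)
    rw [hsum T hvT]
    refine mem_ordIdeal_of_insert hvT hδ ?_
    have h3 := h (insert v T) c (Finset.insert_subset hvA hT)
      ⟨Finset.insert_subset hv (hval.subset.trans (Finset.erase_subset v U)),
        fun i hi j hj hiT hjT hij => ?_⟩
    · rw [Finset.sum_insert hvT] at h3
      have h4 : t - (δ v - e v) + ∑ w ∈ T, e w + δ v = t + (e v + ∑ w ∈ T, e w) := by omega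
      rwa [h4]
    · rw [Finset.mem_insert, not_or] at hiT hjT
      exact hval.eq i (Finset.mem_erase.mpr ⟨hiT.1, hi⟩) j (Finset.mem_erase.mpr ⟨hjT.1, hj⟩)
        hiT.2 hjT.2 hij
  rw [← update_zero_add_single e v, mixed_add_single]
  exact mem_mixed_mul_mv_pow_of_pendant hu hv hvu hN ihv heA0 (Function.update_self v 0 e)
    (δ v - e v) (j := 0) hδ h1 (by omega) (by simpa using h2)

/-- Vanishing orders detect membership if every induced subgraph has a vertex whose
neighbourhood is a clique meeting `A` in at most one vertex, where the neighbourhoods of the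
vertices outside `A` are cliques. -/
theorem detects_of_elimination
    (hA : ∀ w ∉ A, ∀ i j, G.Adj w i → G.Adj w j → i ≠ j → G.Adj i j)
    (hU : ∀ U : Finset V, U.Nonempty → ∃ v ∈ U,
      (∀ i ∈ U, ∀ j ∈ U, G.Adj v i → G.Adj v j → i ≠ j → G.Adj i j) ∧
      ∀ i ∈ U, ∀ j ∈ U, G.Adj v i → G.Adj v j → i ∈ A → j ∈ A → i = j) (U : Finset V) :
    Detects k G A U := by
  induction U using Finset.strongInduction with
  | H U ih =>
    rcases U.eq_empty_or_nonempty with rfl | hne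
    · exact detects_empty
    obtain ⟨v, hv, hcl, huniq⟩ := hU U hne
    have ihv := ih _ (Finset.erase_ssubset hv)
    by_cases h1 : ∃ w ∈ U, w ∉ A ∧ G.Adj v w
    · obtain ⟨w, hw, hwA, hvw⟩ := h1
      exact detects_of_twin hv hw hwA hvw hcl (hA w hwA) ihv (ih _ (Finset.erase_ssubset hw))
    by_cases h2 : ∃ u ∈ U, G.Adj v u
    · obtain ⟨u, hu, hvu⟩ := h2
      have hmem : ∀ w ∈ U, G.Adj v w → w ∈ A := fun w hw hvw =>
        by_contra fun hwA => h1 ⟨w, hw, hwA, hvw⟩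
      refine detects_of_pendant hu hv (hmem u hu hvu) hvu
        (fun w hw hvw => huniq w hw u hu hvw hvu (hmem w hw hvw) (hmem u hu hvu)) ihv
        (ih _ ((Finset.erase_subset u _).trans_ssubset (Finset.erase_ssubset hv)))
    · exact detects_of_isolated (fun w hw hvw => h2 ⟨w, hw, hvw⟩) ihv

end Pendant

section Symbolic

lemma mem_symbolicPower {S : Type*} [CommRing S] {I : Ideal S} {t : ℕ} {f : S} :
    f ∈ symbolicPower I t ↔ ∀ p ∈ I.minimalPrimes, ∃ h ∉ p, h * f ∈ I ^ t := by
  simp only [symbolicPower, Ideal.mem_iInf]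
  refine forall₂_congr fun p hp => ?_
  have hprime : p.IsPrime := hp.1.1
  rw [Ideal.mem_comap, IsLocalization.algebraMap_mem_map_algebraMap_iff p.primeCompl]
  exact ⟨fun ⟨h, hh, hhf⟩ => ⟨h, hh, hhf⟩, fun ⟨h, hh, hhf⟩ => ⟨h, hh, hhf⟩⟩

lemma pow_le_symbolicPower {S : Type*} [CommRing S] (I : Ideal S) (t : ℕ) :
    I ^ t ≤ symbolicPower I t := fun f hf => mem_symbolicPower.mpr fun p hp =>
  have hprime : p.IsPrime := hp.1.1
  ⟨1, (Ideal.ne_top_iff_one p).mp hprime.ne_top, by rwa [one_mul]⟩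

variable {k V : Type} [Field k] [DecidableEq V] [Fintype V] {G : SimpleGraph V}
  {f : EdgeRing k V} {p : Ideal (EdgeRing k V)} {T T' : Finset V} {c c' : V → ℕ} {n : ℕ}

lemma binomialEdgeIdeal_eq : binomialEdgeIdeal k G = edgeIdeal k G Finset.univ := by
  rw [binomialEdgeIdeal, edgeIdeal]
  congr 1
  ext f
  simp [edgeBrackets, br]

lemma br_mem_of_br_mem (hp : p.IsPrime) {i j l : V}
    (hj : ¬ (X (Sum.inl j) ∈ p ∧ X (Sum.inr j) ∈ p)) (hij : br i j ∈ p) (hjl : br j l ∈ p) :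
    br i l ∈ p := by
  rw [not_and_or] at hj
  rcases hj with hj | hj
  · refine (hp.mem_or_mem (x := X (Sum.inl j)) ?_).resolve_left hj
    have h : (X (Sum.inl j) * br i l : EdgeRing k V) =
        X (Sum.inl l) * br i j + X (Sum.inl i) * br j l := by
      rw [br, br, br]
      ring
    rw [h]
    exact add_mem (Ideal.mul_mem_left _ _ hij) (Ideal.mul_mem_left _ _ hjl)
  · refine (hp.mem_or_mem (x := X (Sum.inr j)) ?_).resolve_left hj
    have h : (X (Sum.inr j) * br i l : EdgeRing k V) =
        X (Sum.inr l) * br i j + X (Sum.inr i) * br j l := by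
      rw [br, br, br]
      ring
    rw [h]
    exact add_mem (Ideal.mul_mem_left _ _ hij) (Ideal.mul_mem_left _ _ hjl)

/-- The configuration attached to a prime ideal: `T` is the set of vertices whose vector vanishes
and `c` labels the proportionality classes of the other ones. -/
lemma exists_config (hp : p.IsPrime) : ∃ (T : Finset V) (c : V → ℕ),
    (∀ w, w ∈ T ↔ X (Sum.inl w) ∈ p ∧ X (Sum.inr w) ∈ p) ∧
    ∀ i ∉ T, ∀ j ∉ T, c i = c j ↔ br i j ∈ p := by
  classical
  let T : Finset V := {w | X (Sum.inl w) ∈ p ∧ X (Sum.inr w) ∈ p}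
  have hT : ∀ w, w ∈ T ↔ X (Sum.inl w) ∈ p ∧ X (Sum.inr w) ∈ p := fun w => by simp [T]
  let s : V → Set ℕ := fun w => {n | ∃ w' ∉ T, br w w' ∈ p ∧ (Fintype.equivFin V w' : ℕ) = n}
  have hs : ∀ w ∉ T, sInf (s w) ∈ s w := fun w hw => Nat.sInf_mem
    ⟨_, w, hw, by simp [br], rfl⟩
  refine ⟨T, fun w => sInf (s w), hT, fun i hi j hj => ⟨fun h => ?_, fun h => ?_⟩⟩
  · obtain ⟨i', hi', hbi, hi''⟩ := hs i hi
    obtain ⟨j', hj', hbj, hj''⟩ := hs j hj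
    have h1 : i' = j' :=
      (Fintype.equivFin V).injective (Fin.ext (hi''.trans (h.trans hj''.symm)))
    subst h1
    refine br_mem_of_br_mem hp ((hT i').not.mp hi') hbi ?_
    rw [br_swap]
    exact neg_mem hbj
  · have h' : br j i ∈ p := by
      rw [br_swap]
      exact neg_mem h
    have hst : s i = s j := by
      ext n
      exact ⟨fun ⟨w, hw, hb, hn⟩ => ⟨w, hw, br_mem_of_br_mem hp ((hT i).not.mp hi) h' hb, hn⟩,
        fun ⟨w, hw, hb, hn⟩ => ⟨w, hw, br_mem_of_br_mem hp ((hT j).not.mp hj) h hb, hn⟩⟩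
    exact congrArg sInf hst

lemma exists_smul_eq {K : Type*} [Field K] {a b : K × K} (ha : a ≠ 0)
    (h : a.1 * b.2 - b.1 * a.2 = 0) : ∃ l : K, b = l • a := by
  by_cases h1 : a.1 = 0
  · have h2 : a.2 ≠ 0 := fun h2 => ha (Prod.ext h1 h2)
    refine ⟨b.2 / a.2, Prod.ext ?_ ?_⟩
    · simpa [h1, h2] using h
    · simp [h2]
  · refine ⟨b.1 / a.1, Prod.ext ?_ ?_⟩
    · simp [h1]
    · simp only [Prod.smul_snd, smul_eq_mul]
      field_simp
      linear_combination h

lemma ordIdeal_one_le (hp : p.IsPrime) (hT : ∀ w, w ∈ T ↔ X (Sum.inl w) ∈ p ∧ X (Sum.inr w) ∈ p)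
    (hc : ∀ i ∉ T, ∀ j ∉ T, c i = c j ↔ br i j ∈ p) : ordIdeal k T c 1 ≤ p := by
  classical
  intro f hf
  let K := FractionRing (EdgeRing k V ⧸ p)
  let φ : EdgeRing k V →ₐ[k] K :=
    (IsScalarTower.toAlgHom k (EdgeRing k V ⧸ p) K).comp (Ideal.Quotient.mkₐ k p)
  have hφ : ∀ g, φ g = 0 ↔ g ∈ p := fun g => by
    rw [← Ideal.Quotient.eq_zero_iff_mem]
    exact map_eq_zero_iff (algebraMap (EdgeRing k V ⧸ p) K) (IsFractionRing.injective _ K)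
  let P : V → K × K := fun w => (φ (X (Sum.inl w)), φ (X (Sum.inr w)))
  have hP : ∀ w, P w = 0 ↔ w ∈ T := fun w => by
    rw [hT, Prod.ext_iff]
    exact and_congr (hφ _) (hφ _)
  let a : ℕ → K × K := fun n => if h : ∃ w ∉ T, c w = n then P h.choose else 0
  have hl : ∀ w, ∃ l : K, P w = (if w ∈ T then 0 else l) • a (c w) := fun w => by
    by_cases hw : w ∈ T
    · exact ⟨0, by simp [(hP w).mpr hw]⟩
    have hex : ∃ w' ∉ T, c w' = c w := ⟨w, hw, rfl⟩
    have ha : a (c w) = P hex.choose := dif_pos hex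
    obtain ⟨l, hl⟩ := exists_smul_eq (a := P hex.choose) (b := P w)
      (fun h => hex.choose_spec.1 ((hP _).mp h)) (by
        have h1 := (hφ _).mpr ((hc _ hex.choose_spec.1 w hw).mp hex.choose_spec.2)
        simpa [br] using h1)
    exact ⟨l, by rw [if_neg hw, ha, hl]⟩
  choose l hl using hl
  have h1 := mem_ordIdeal.mp hf K 0 l a 0
  have h2 : pt 0 l a 0 T c = P := by
    funext w
    rw [pt, zero_smul, add_zero, ← hl]
  rw [h2, pow_one, zero_dvd_iff] at h1
  have h3 : ev P f = φ f := by
    have h4 := map_ev φ gp f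
    rw [ev_gp] at h4
    exact h4.symm
  exact (hφ f).mp (h3.symm.trans h1)

/-- Minimal primes of binomial edge ideals are given by valid configurations. -/
lemma exists_valid_of_mem_minimalPrimes (hp : p ∈ (binomialEdgeIdeal k G).minimalPrimes) :
    ∃ T c, Valid G Finset.univ T c ∧ p = ordIdeal k T c 1 := by
  have hprime : p.IsPrime := hp.1.1
  have hJ : binomialEdgeIdeal k G ≤ p := hp.1.2
  rw [binomialEdgeIdeal_eq] at hJ
  obtain ⟨T, c, hT, hc⟩ := exists_config hprime
  have hval : Valid G Finset.univ T c := ⟨Finset.subset_univ T, fun i hi j hj hiT hjT hij =>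
    (hc i hiT j hjT).mpr (hJ (br_mem_edgeIdeal hi hj hij))⟩
  have hle := ordIdeal_one_le hprime hT hc
  refine ⟨T, c, hval, le_antisymm (hp.2 ⟨isPrime_ordIdeal, ?_⟩ hle) hle⟩
  rw [binomialEdgeIdeal_eq]
  exact hval.edgeIdeal_le

lemma ordIdeal_le_of_one_le (h : ordIdeal k T' c' 1 ≤ ordIdeal k T c 1) :
    ordIdeal k T' c' n ≤ ordIdeal k T c n := by
  classical
  have hT : T' ⊆ T := fun w hw => by_contra fun hwT => inl_notMem_ordIdeal_one hwT
    (h (mv_le_ordIdeal hw (Ideal.subset_span (Or.inl rfl))))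
  have hc : ∀ i ∉ T, ∀ j ∉ T, c' i = c' j → c i = c j := fun i hi j hj hij =>
    by_contra fun hne => br_notMem_ordIdeal_one hi hj hne
      (h (br_mem_ordIdeal fun _ _ => hij))
  refine ordIdeal_le_of_specialization fun B _ _ z l a q => ⟨fun w => if w ∈ T then 0 else l w,
    fun n => if h : ∃ w ∉ T, c' w = n then a (c h.choose) else 0, q, ?_⟩
  funext w
  by_cases hw : w ∈ T
  · simp [pt, hw]
  · have hex : ∃ w' ∉ T, c' w' = c' w := ⟨w, hw, rfl⟩
    have hw' : w ∉ T' := fun h => hw (hT h)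
    rw [pt, pt, dif_pos hex, hc _ hex.choose_spec.1 w hw hex.choose_spec.2]
    simp [hw, hw']

lemma mem_ordIdeal_of_mem_symbolicPower {t : ℕ}
    (hf : f ∈ symbolicPower (binomialEdgeIdeal k G) t) (hval : Valid G Finset.univ T c) :
    f ∈ ordIdeal k T c t := by
  have hJ : binomialEdgeIdeal k G ≤ ordIdeal k T c 1 := by
    rw [binomialEdgeIdeal_eq]
    exact hval.edgeIdeal_le
  obtain ⟨p, hp, hle⟩ := Ideal.exists_minimalPrimes_le hJ
  obtain ⟨h, hh, hhf⟩ := mem_symbolicPower.mp hf p hp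
  obtain ⟨T', c', hval', rfl⟩ := exists_valid_of_mem_minimalPrimes hp
  refine ordIdeal_le_of_one_le hle (mem_of_mul_mem_of_notMem_one hh ?_)
  rw [binomialEdgeIdeal_eq] at hhf
  exact pow_le_ordIdeal hval'.edgeIdeal_le t hhf

theorem pow_eq_symbolicPower_of_detects {A : Finset V} (hA : Detects k G A Finset.univ) (t : ℕ) :
    binomialEdgeIdeal k G ^ t = symbolicPower (binomialEdgeIdeal k G) t := by
  refine le_antisymm (pow_le_symbolicPower _ t) fun f hf => ?_
  obtain ⟨s, hs⟩ := exists_sum_comp f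
  rw [hs]
  refine sum_mem fun δ _ => ?_
  have h1 : comp δ f ∈ mixed k G Finset.univ t 0 := hA t δ 0 (comp δ f) (fun _ => Nat.zero_le _) (fun _ _ => rfl) (hom_comp δ f)
    fun T c _ hval => by
      simpa using homIdeal_ordIdeal f (mem_ordIdeal_of_mem_symbolicPower hf hval) δ
  have h2 : mixed k G Finset.univ t 0 ≤ edgeIdeal k G Finset.univ ^ t := Ideal.mul_le_left
  rw [binomialEdgeIdeal_eq]
  exact h2 h1

end Symbolic

section Net

variable {k V : Type} [Field k] [DecidableEq V] [Fintype V] {G : SimpleGraph V}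
  {p : Ideal (EdgeRing k V)}

/-- The coordinates of a vertex vanishing along a minimal prime `p` belong to the binomial edge
ideal locally at `p`. -/
lemma exists_mul_mem_of_mem_mv (hp : p ∈ (binomialEdgeIdeal k G).minimalPrimes) {w : V}
    (hw : X (Sum.inl w) ∈ p ∧ X (Sum.inr w) ∈ p) :
    ∃ h ∉ p, h * X (Sum.inl w) ∈ binomialEdgeIdeal k G ∧
      h * X (Sum.inr w) ∈ binomialEdgeIdeal k G := by
  by_cases hex : ∃ i j, G.Adj w i ∧ G.Adj w j ∧ br i j ∉ p
  · obtain ⟨i, j, hi, hj, hij⟩ := hex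
    have hwi : (br w i : EdgeRing k V) ∈ binomialEdgeIdeal k G := Ideal.subset_span ⟨w, i, hi, rfl⟩
    have hwj : (br w j : EdgeRing k V) ∈ binomialEdgeIdeal k G := Ideal.subset_span ⟨w, j, hj, rfl⟩
    have h1 : (br i j * X (Sum.inl w) : EdgeRing k V) =
        X (Sum.inl i) * br w j - X (Sum.inl j) * br w i := by
      rw [br, br, br]
      ring
    have h2 : (br i j * X (Sum.inr w) : EdgeRing k V) =
        X (Sum.inr i) * br w j - X (Sum.inr j) * br w i := by
      rw [br, br, br]
      ring
    refine ⟨br i j, hij, ?_, ?_⟩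
    · rw [h1]
      exact sub_mem (Ideal.mul_mem_left _ _ hwj) (Ideal.mul_mem_left _ _ hwi)
    · rw [h2]
      exact sub_mem (Ideal.mul_mem_left _ _ hwj) (Ideal.mul_mem_left _ _ hwi)
  exfalso
  obtain ⟨T, c, hval, rfl⟩ := exists_valid_of_mem_minimalPrimes hp
  have hcl : ∀ i j, G.Adj w i → G.Adj w j → i ∉ T → j ∉ T → c i = c j :=
    fun i j hi hj hiT hjT => by_contra fun hne =>
      hex ⟨i, j, hi, hj, br_notMem_ordIdeal_one hiT hjT hne⟩
  obtain ⟨m, hm⟩ : ∃ m, ∀ i, G.Adj w i → i ∉ T → c i = m := by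
    by_cases h : ∃ i, G.Adj w i ∧ i ∉ T
    · obtain ⟨i, hi, hiT⟩ := h
      exact ⟨c i, fun j hj hjT => hcl j i hj hi hjT hiT⟩
    · exact ⟨0, fun i hi hiT => absurd ⟨i, hi, hiT⟩ h⟩
  have hval' : Valid G Finset.univ (T.erase w) (Function.update c w m) := by
    refine ⟨Finset.subset_univ _, fun i hi j hj hiT hjT hij => ?_⟩
    by_cases hiw : i = w
    · subst hiw
      rw [Function.update_self, Function.update_of_ne hij.ne']
      exact (hm j hij fun h => hjT (Finset.mem_erase.mpr ⟨hij.ne', h⟩)).symm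
    by_cases hjw : j = w
    · subst hjw
      rw [Function.update_self, Function.update_of_ne hiw]
      exact hm i hij.symm fun h => hiT (Finset.mem_erase.mpr ⟨hiw, h⟩)
    rw [Function.update_of_ne hiw, Function.update_of_ne hjw]
    exact hval.eq i hi j hj (fun h => hiT (Finset.mem_erase.mpr ⟨hiw, h⟩))
      (fun h => hjT (Finset.mem_erase.mpr ⟨hjw, h⟩)) hij
  have hwT : w ∈ T := by_contra fun h => inl_notMem_ordIdeal_one h hw.1
  have hle : ordIdeal k (T.erase w) (Function.update c w m) 1 ≤ ordIdeal k T c 1 := by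
    refine ordIdeal_le_of_specialization fun B _ _ z l a q => ⟨Function.update l w 0, a, q, ?_⟩
    funext b
    by_cases hb : b = w
    · subst hb
      simp [pt, hwT]
    · simp [pt, hb]
  have hJ : binomialEdgeIdeal k G ≤ ordIdeal k (T.erase w) (Function.update c w m) 1 := by
    rw [binomialEdgeIdeal_eq]
    exact hval'.edgeIdeal_le
  exact inl_notMem_ordIdeal_one (Finset.notMem_erase w T) (hp.2 ⟨isPrime_ordIdeal, hJ⟩ hle hw.1)

/-- A bracket `[i l]` belongs to the binomial edge ideal locally at a minimal prime if `j` is a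
common neighbour and the vector at `j` does not vanish or the vector at `i` does. -/
lemma exists_mul_br_mem (hp : p ∈ (binomialEdgeIdeal k G).minimalPrimes) {i j l : V}
    (hij : G.Adj i j) (hjl : G.Adj j l)
    (h : ¬ (X (Sum.inl j) ∈ p ∧ X (Sum.inr j) ∈ p) ∨ (X (Sum.inl i) ∈ p ∧ X (Sum.inr i) ∈ p)) :
    ∃ h ∉ p, h * br i l ∈ binomialEdgeIdeal k G := by
  have hbij : (br i j : EdgeRing k V) ∈ binomialEdgeIdeal k G := Ideal.subset_span ⟨i, j, hij, rfl⟩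
  have hbjl : (br j l : EdgeRing k V) ∈ binomialEdgeIdeal k G := Ideal.subset_span ⟨j, l, hjl, rfl⟩
  rcases h with h | h
  · rw [not_and_or] at h
    rcases h with h | h
    · refine ⟨_, h, ?_⟩
      have h1 : (X (Sum.inl j) * br i l : EdgeRing k V) =
          X (Sum.inl l) * br i j + X (Sum.inl i) * br j l := by
        rw [br, br, br]
        ring
      rw [h1]
      exact add_mem (Ideal.mul_mem_left _ _ hbij) (Ideal.mul_mem_left _ _ hbjl)
    · refine ⟨_, h, ?_⟩
      have h1 : (X (Sum.inr j) * br i l : EdgeRing k V) =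
          X (Sum.inr l) * br i j + X (Sum.inr i) * br j l := by
        rw [br, br, br]
        ring
      rw [h1]
      exact add_mem (Ideal.mul_mem_left _ _ hbij) (Ideal.mul_mem_left _ _ hbjl)
  · obtain ⟨g, hg, hg1, hg2⟩ := exists_mul_mem_of_mem_mv hp h
    refine ⟨g, hg, ?_⟩
    have h1 : (g * br i l : EdgeRing k V) =
        X (Sum.inr l) * (g * X (Sum.inl i)) - X (Sum.inl l) * (g * X (Sum.inr i)) := by
      rw [br]
      ring
    rw [h1]
    exact sub_mem (Ideal.mul_mem_left _ _ hg1) (Ideal.mul_mem_left _ _ hg2)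

lemma exists_mul_mem_sq {J : Ideal (EdgeRing k V)} (hp : p.IsPrime) {a b : EdgeRing k V}
    (ha : ∃ h ∉ p, h * a ∈ J) (hb : ∃ h ∉ p, h * b ∈ J) (r : EdgeRing k V) :
    ∃ h ∉ p, h * (a * b * r) ∈ J ^ 2 := by
  obtain ⟨g, hg, hga⟩ := ha
  obtain ⟨h, hh, hhb⟩ := hb
  refine ⟨g * h, fun hgh => (hp.mem_or_mem hgh).elim hg hh, ?_⟩
  have h1 : g * h * (a * b * r) = r * ((g * a) * (h * b)) := by ring
  rw [h1, pow_two]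
  exact Ideal.mul_mem_left _ _ (Ideal.mul_mem_mul hga hhb)

/-- The product of brackets witnessing that the square of the binomial edge ideal of a graph
containing an induced net differs from the second symbolic power. -/
noncomputable def netElement (φ : netGraph ↪g G) : EdgeRing k V :=
  br (φ 0) (φ 4) * br (φ 1) (φ 5) * br (φ 2) (φ 3)

lemma netElement_mem (φ : netGraph ↪g G) :
    netElement φ ∈ symbolicPower (binomialEdgeIdeal k G) 2 := by
  rw [mem_symbolicPower]
  intro p hp
  have hprime : p.IsPrime := hp.1.1
  have adj : ∀ a b, netGraph.Adj a b → G.Adj (φ a) (φ b) := fun a b => φ.map_adj_iff.mpr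
  have h04 := exists_mul_br_mem hp (adj 0 1 (by simp [netGraph])) (adj 1 4 (by simp [netGraph]))
  have h15 := exists_mul_br_mem hp (adj 1 2 (by simp [netGraph])) (adj 2 5 (by simp [netGraph]))
  have h23 := exists_mul_br_mem hp (adj 2 0 (by simp [netGraph])) (adj 0 3 (by simp [netGraph]))
  by_cases h0 : X (Sum.inl (φ 0)) ∈ p ∧ X (Sum.inr (φ 0)) ∈ p
  · by_cases h2 : X (Sum.inl (φ 2)) ∈ p ∧ X (Sum.inr (φ 2)) ∈ p
    · have h := exists_mul_mem_sq hprime (h04 (Or.inr h0)) (h23 (Or.inr h2)) (br (φ 1) (φ 5))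
      rwa [mul_right_comm] at h
    · exact exists_mul_mem_sq hprime (h04 (Or.inr h0)) (h15 (Or.inl h2)) _
  · by_cases h1 : X (Sum.inl (φ 1)) ∈ p ∧ X (Sum.inr (φ 1)) ∈ p
    · have h := exists_mul_mem_sq hprime (h15 (Or.inr h1)) (h23 (Or.inl h0)) (br (φ 0) (φ 4))
      rwa [mul_comm, ← mul_assoc] at h
    · have h := exists_mul_mem_sq hprime (h04 (Or.inl h1)) (h23 (Or.inl h0)) (br (φ 1) (φ 5))
      rwa [mul_right_comm] at h

lemma netElement_notMem (φ : netGraph ↪g G) : netElement φ ∉ binomialEdgeIdeal k G ^ 2 := by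
  classical
  let Q : Fin 6 → Polynomial k × Polynomial k := ![(Polynomial.X, 0), (0, Polynomial.X),
    (Polynomial.X, Polynomial.X), (1, 0), (0, 1), (1, 1)]
  let P : V → Polynomial k × Polynomial k := Function.extend φ Q fun _ => 0
  have hP : ∀ a, P (φ a) = Q a := fun a => φ.injective.extend_apply Q (fun _ => 0) a
  have hP0 : ∀ w, (¬ ∃ a, φ a = w) → P w = 0 := fun w hw => Function.extend_apply' Q (fun _ => 0) w hw
  have hJ : binomialEdgeIdeal k G ≤
      (Ideal.span {(Polynomial.X : Polynomial k) ^ 2}).comap (ev (k := k) P) := by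
    rw [binomialEdgeIdeal, Ideal.span_le]
    rintro _ ⟨i, j, hij, rfl⟩
    rw [SetLike.mem_coe, Ideal.mem_comap, Ideal.mem_span_singleton]
    simp only [map_sub, map_mul, ev_inl, ev_inr]
    by_cases hi : ∃ a, φ a = i
    · by_cases hj : ∃ b, φ b = j
      · obtain ⟨a, rfl⟩ := hi
        obtain ⟨b, rfl⟩ := hj
        have hab : netGraph.Adj a b := φ.map_adj_iff.mp hij
        rw [hP, hP]
        fin_cases a <;> fin_cases b <;> simp [netGraph] at hab <;> simp [Q, pow_two]
      · simp [hP0 j hj]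
    · simp [hP0 i hi]
  intro h
  have h1 := Ideal.pow_right_mono hJ 2 h
  have h2 := Ideal.le_comap_pow (ev (k := k) P) 2 h1
  rw [Ideal.mem_comap, Ideal.span_singleton_pow, Ideal.mem_span_singleton, netElement] at h2
  have h3 : ev P (br (φ 0) (φ 4) * br (φ 1) (φ 5) * br (φ 2) (φ 3) : EdgeRing k V) =
      (Polynomial.X : Polynomial k) ^ 3 := by
    simp only [map_mul, ev_br, hP]
    simp [Q]
    ring
  rw [h3, ← pow_mul, pow_dvd_pow_iff Polynomial.X_ne_zero Polynomial.not_isUnit_X] at h2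
  omega

theorem netFree_of_sq_eq
    (h2 : binomialEdgeIdeal k G ^ 2 = symbolicPower (binomialEdgeIdeal k G) 2) : NetFree G :=
  ⟨fun φ => netElement_notMem (k := k) φ (h2 ▸ netElement_mem φ)⟩

end Net

section Skeleton

/-- A description of the graphs obtained from a chain of cliques, consecutive ones sharing one
vertex, by attaching trees. Vertices with `d x = 0` lie on the chain; the `i`-th clique consists
of the chain vertices with `2 * i ≤ s (root x) ≤ 2 * i + 2`, and those with an even value of
`s (root x)` are determined by it. -/
structure Skeleton {V M : Type} (G : SimpleGraph V) (s : M → ℕ) (d : V → ℕ) (root : V → M) :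
    Prop where
  inj : ∀ x y, d x = 0 → d y = 0 → root x = root y → x = y
  even_inj : ∀ x y, d x = 0 → d y = 0 → s (root x) = s (root y) → Even (s (root x)) → x = y
  adj_iff : ∀ x y, d x = 0 → d y = 0 → (G.Adj x y ↔ x ≠ y ∧ ∃ i, 2 * i ≤ s (root x) ∧
    s (root x) ≤ 2 * i + 2 ∧ 2 * i ≤ s (root y) ∧ s (root y) ≤ 2 * i + 2)
  root_eq : ∀ x y, G.Adj x y → d x ≠ 0 ∨ d y ≠ 0 → root x = root y
  parent_unique : ∀ x y z, d x ≠ 0 → G.Adj x y → G.Adj x z → d y ≤ d x → d z ≤ d x → y = z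

variable {V M : Type} {G : SimpleGraph V}

lemma Skeleton.comap {V' : Type} {G' : SimpleGraph V'} {s : M → ℕ} {d : V → ℕ} {root : V → M}
    (h : Skeleton G s d root) (φ : G' ≃g G) : Skeleton G' s (d ∘ φ) (root ∘ φ) where
  inj x y hx hy hxy := φ.injective (h.inj _ _ hx hy hxy)
  even_inj x y hx hy hxy he := φ.injective (h.even_inj _ _ hx hy hxy he)
  adj_iff x y hx hy := by
    rw [← φ.map_adj_iff, h.adj_iff _ _ hx hy, φ.injective.ne_iff]
    rfl
  root_eq x y hxy hd := h.root_eq _ _ (φ.map_adj_iff.mpr hxy) hd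
  parent_unique x y z hx hy hz hyx hzx := φ.injective
    (h.parent_unique _ _ _ hx (φ.map_adj_iff.mpr hy) (φ.map_adj_iff.mpr hz) hyx hzx)

instance : DecidableRel netGraph.Adj :=
  inferInstanceAs (DecidableRel fun a b : Fin 6 => a ≠ b ∧ (_ ∨ _))

lemma netGraph_adj_ext :
    ∀ x y : Fin 6, (∀ z, netGraph.Adj x z ↔ netGraph.Adj y z) → x = y := by
  decide

lemma nonempty_net_embedding (a b : Fin 3 → V) (haa : ∀ i j, i ≠ j → G.Adj (a i) (a j))
    (hab : ∀ i j, G.Adj (a i) (b j) ↔ i = j) (hbb : ∀ i j, ¬ G.Adj (b i) (b j)) :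
    Nonempty (netGraph ↪g G) := by
  have hba : ∀ i j, G.Adj (b j) (a i) ↔ i = j := fun i j => by rw [G.adj_comm, hab]
  have haa' : ∀ i j, G.Adj (a i) (a j) ↔ i ≠ j := fun i j =>
    ⟨fun h hij => G.irrefl (hij ▸ h), haa i j⟩
  let F : Fin 6 → V := ![a 0, a 1, a 2, b 0, b 1, b 2]
  have hadj : ∀ x y, G.Adj (F x) (F y) ↔ netGraph.Adj x y := by
    intro x y
    fin_cases x <;> fin_cases y <;> simp [F, netGraph, hab, hba, haa', hbb]
  have hinj : Function.Injective F := by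
    intro x y hxy
    have h1 : ∀ z, netGraph.Adj x z ↔ netGraph.Adj y z := fun z => by
      rw [← hadj, ← hadj, hxy]
    exact netGraph_adj_ext x y h1
  exact ⟨⟨⟨F, hinj⟩, hadj _ _⟩⟩

/-- The vertices whose neighbourhood is not a clique. -/
def IsCore (G : SimpleGraph V) (v : V) : Prop :=
  ∃ i j, G.Adj v i ∧ G.Adj v j ∧ i ≠ j ∧ ¬ G.Adj i j

variable {s : M → ℕ} {d : V → ℕ} {root : V → M}

/-- Three core vertices in a common clique of the chain yield a net. -/
lemma Skeleton.not_netFree (h : Skeleton G s d root) (i : ℕ) (a : Fin 3 → V)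
    (ha : Function.Injective a) (hd : ∀ n, d (a n) = 0) (hlo : ∀ n, 2 * i ≤ s (root (a n)))
    (hhi : ∀ n, s (root (a n)) ≤ 2 * i + 2) (hcore : ∀ n, IsCore G (a n)) : ¬ NetFree G := by
  classical
  let I : V → Prop := fun x => d x = 0 ∧ 2 * i ≤ s (root x) ∧ s (root x) ≤ 2 * i + 2
  have hI : ∀ n, I (a n) := fun n => ⟨hd n, hlo n, hhi n⟩
  let lab : V → Option M × Bool := fun x =>
    if s (root x) ≤ 2 * i then (none, false)
    else if 2 * i + 2 ≤ s (root x) then (none, true) else (some (root x), true)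
  have hlab : ∀ x y, G.Adj x y → ¬ (I x ∧ I y) → lab x = lab y := by
    intro x y hxy hn
    by_cases hxy0 : d x ≠ 0 ∨ d y ≠ 0
    · simp only [lab, h.root_eq x y hxy hxy0]
    rw [not_or, not_not, not_not] at hxy0
    obtain ⟨-, j, h1, h2, h3, h4⟩ := (h.adj_iff x y hxy0.1 hxy0.2).mp hxy
    rcases lt_trichotomy j i with hj | rfl | hj
    · simp only [lab]
      rw [if_pos (by omega), if_pos (by omega)]
    · exact absurd ⟨⟨hxy0.1, h1, h2⟩, hxy0.2, h3, h4⟩ hn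
    · simp only [lab]
      rw [if_neg (by omega), if_pos (by omega), if_neg (by omega), if_pos (by omega)]
  have hlab_inj : ∀ x y, I x → I y → lab x = lab y → x = y := by
    rintro x y ⟨hx, hx1, hx2⟩ ⟨hy, hy1, hy2⟩ hxy
    simp only [lab] at hxy
    split_ifs at hxy with h1 h2 h3 h4 h5 h6
    · exact h.even_inj x y hx hy (by omega) ⟨i, by omega⟩
    · simp at hxy
    · simp at hxy
    · simp at hxy
    · exact h.even_inj x y hx hy (by omega) ⟨i + 1, by omega⟩
    · simp at hxy
    · simp at hxy
    · simp at hxy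
    · exact h.inj x y hx hy (by simpa using hxy)
  have hadj : ∀ x y, I x → I y → x ≠ y → G.Adj x y := fun x y hx hy hxy =>
    (h.adj_iff x y hx.1 hy.1).mpr ⟨hxy, i, hx.2.1, hx.2.2, hy.2.1, hy.2.2⟩
  have hb : ∀ n, ∃ b, G.Adj (a n) b ∧ ¬ I b := by
    intro n
    obtain ⟨x, y, hx, hy, hne, hxy⟩ := hcore n
    by_cases hIx : I x
    · exact ⟨y, hy, fun hIy => hxy (hadj x y hIx hIy hne)⟩
    · exact ⟨x, hx, hIx⟩
  choose b hab hIb using hb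
  have hlb : ∀ n, lab (b n) = lab (a n) := fun n => (hlab _ _ (hab n) fun h => hIb n h.2).symm
  have key : ∀ m n, lab (a m) = lab (a n) → m = n := fun m n hmn =>
    ha (hlab_inj _ _ (hI m) (hI n) hmn)
  intro hnet
  obtain ⟨φ⟩ := nonempty_net_embedding a b
    (fun m n hmn => hadj _ _ (hI m) (hI n) (ha.ne hmn))
    (fun m n => ⟨fun hmn => key m n ((hlab _ _ hmn fun h => hIb n h.2).trans (hlb n)),
      fun hmn => hmn ▸ hab m⟩)
    (fun m n hmn => by
      have hmn' := key m n ((hlb m).symm.trans ((hlab _ _ hmn fun h => hIb n h.2).trans (hlb n)))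
      exact G.irrefl (hmn' ▸ hmn))
  exact hnet.false φ

open Classical in
/-- Position of a vertex in the elimination order of the chain. -/
noncomputable def Skeleton.rank (G : SimpleGraph V) (s : M → ℕ) (root : V → M) (x : V) : ℕ :=
  if s (root x) = 0 then 0 else 3 * ((s (root x) - 1) / 2) + if IsCore G x then 2 else 1

lemma Skeleton.elimination (h : Skeleton G s d root) (hnet : NetFree G) (U : Finset V)
    (hU : U.Nonempty) : ∃ v ∈ U,
      (∀ i ∈ U, ∀ j ∈ U, G.Adj v i → G.Adj v j → i ≠ j → G.Adj i j) ∧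
      ∀ i ∈ U, ∀ j ∈ U, G.Adj v i → G.Adj v j → IsCore G i → IsCore G j → i = j := by
  classical
  obtain ⟨v, hv, hmax⟩ := U.exists_max_image (fun x => toLex (d x, Skeleton.rank G s root x)) hU
  refine ⟨v, hv, ?_⟩
  have hdle : ∀ x ∈ U, d x ≤ d v := fun x hx => by
    rcases Prod.Lex.toLex_le_toLex.mp (hmax x hx) with h1 | h1
    · exact h1.le
    · exact h1.1.le
  by_cases hdv : d v = 0
  · have hd : ∀ x ∈ U, d x = 0 := fun x hx => Nat.le_zero.mp (hdv ▸ hdle x hx)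
    have hr : ∀ x ∈ U, Skeleton.rank G s root x ≤ Skeleton.rank G s root v := fun x hx => by
      rcases Prod.Lex.toLex_le_toLex.mp (hmax x hx) with h1 | h1
      · exact absurd h1 (by simp [hd x hx, hdv])
      · exact h1.2
    have hblock : ∀ x ∈ U, G.Adj v x → s (root v) ≠ 0 ∧ 2 * ((s (root v) - 1) / 2) ≤ s (root x) ∧
        s (root x) ≤ 2 * ((s (root v) - 1) / 2) + 2 := by
      intro x hx hvx
      obtain ⟨-, j, h1, h2, h3, h4⟩ := (h.adj_iff v x hdv (hd x hx)).mp hvx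
      have h5 : s (root v) = s (root x) → ¬ Even (s (root v)) := fun h5 h6 =>
        hvx.ne (h.even_inj v x hdv (hd x hx) h5 h6)
      rw [Nat.not_even_iff] at h5
      have h6 := hr x hx
      rw [Skeleton.rank, Skeleton.rank] at h6
      split_ifs at h6 <;> omega
    refine ⟨fun x hx y hy hvx hvy hxy => ?_, fun x hx y hy hvx hvy hcx hcy => ?_⟩
    · exact (h.adj_iff x y (hd x hx) (hd y hy)).mpr ⟨hxy, _, (hblock x hx hvx).2.1,
        (hblock x hx hvx).2.2, (hblock y hy hvy).2.1, (hblock y hy hvy).2.2⟩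
    obtain ⟨hv0, hx1, hx2⟩ := hblock x hx hvx
    obtain ⟨-, hy1, hy2⟩ := hblock y hy hvy
    by_contra hxy
    by_cases hcv : IsCore G v
    · refine h.not_netFree ((s (root v) - 1) / 2) ![v, x, y] ?_ ?_ ?_ ?_ ?_ hnet
      · intro m n hmn
        fin_cases m <;> fin_cases n <;>
          simp_all [hvx.ne, hvx.ne', hvy.ne, hvy.ne', Ne.symm hxy]
      · intro n
        fin_cases n
        exacts [hdv, hd x hx, hd y hy]
      · intro n
        fin_cases n
        exacts [by simp; omega, hx1, hy1]
      · intro n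
        fin_cases n
        exacts [by simp; omega, hx2, hy2]
      · intro n
        fin_cases n
        exacts [hcv, hcx, hcy]
    · have hx3 := hr x hx
      have hy3 := hr y hy
      rw [Skeleton.rank, Skeleton.rank, if_neg hv0, if_neg hcv, if_pos hcx] at hx3
      rw [Skeleton.rank, Skeleton.rank, if_neg hv0, if_neg hcv, if_pos hcy] at hy3
      have hx4 : s (root x) = 2 * ((s (root v) - 1) / 2) := by
        split_ifs at hx3 <;> omega
      have hy4 : s (root y) = 2 * ((s (root v) - 1) / 2) := by
        split_ifs at hy3 <;> omega
      exact hxy (h.even_inj x y (hd x hx) (hd y hy) (hx4.trans hy4.symm)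
        ⟨(s (root v) - 1) / 2, by omega⟩)
  · have huniq : ∀ x ∈ U, ∀ y ∈ U, G.Adj v x → G.Adj v y → x = y := fun x hx y hy hvx hvy =>
      h.parent_unique v x y hdv hvx hvy (hdle x hx) (hdle y hy)
    exact ⟨fun x hx y hy hvx hvy hxy => absurd (huniq x hx y hy hvx hvy) hxy,
      fun x hx y hy hvx hvy _ _ => huniq x hx y hy hvx hvy⟩

end Skeleton

section Caterpillar

open SimpleGraph

variable {V₀ : Type} {H : SimpleGraph V₀} {u v : V₀} {p : H.Walk u v}

lemma length_eq_one_of_adj (hH : H.IsAcyclic) {a b : V₀} {q : H.Walk a b} (hq : q.IsPath)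
    (hab : H.Adj a b) : q.length = 1 := by
  have h := (hH.subsingleton_path a b).elim ⟨q, hq⟩ (Path.singleton hab)
  rw [show q = (Path.singleton hab : H.Path a b).1 from congrArg Subtype.val h]
  rfl

lemma exists_path_getVert (hp : p.IsPath) {i j : ℕ} (hij : i ≤ j) (hj : j ≤ p.length) :
    ∃ q : H.Walk (p.getVert i) (p.getVert j), q.IsPath ∧ q.length = j - i ∧
      ∀ z ∈ q.support, z ∈ p.support := by
  have hi : (p.take j).getVert i = p.getVert i := by
    rw [Walk.take_getVert, min_eq_right hij]
  refine ⟨((p.take j).drop i).copy hi rfl, ?_, ?_, ?_⟩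
  · rw [Walk.isPath_copy]
    exact (hp.take j).drop i
  · rw [Walk.length_copy, Walk.drop_length, Walk.take_length, min_eq_left hj]
  · intro z hz
    rw [Walk.support_copy] at hz
    exact (p.isSubwalk_take j).support_subset (((p.take j).isSubwalk_drop i).support_subset hz)

lemma adj_getVert_iff (hH : H.IsAcyclic) (hp : p.IsPath) {i j : ℕ} (hi : i ≤ p.length)
    (hj : j ≤ p.length) : H.Adj (p.getVert i) (p.getVert j) ↔ j = i + 1 ∨ i = j + 1 := by
  constructor
  · intro h
    rcases le_total i j with hij | hij
    · obtain ⟨q, hq, hl, -⟩ := exists_path_getVert hp hij hj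
      have := length_eq_one_of_adj hH hq h
      omega
    · obtain ⟨q, hq, hl, -⟩ := exists_path_getVert hp hij hi
      have := length_eq_one_of_adj hH hq h.symm
      omega
  · rintro (rfl | rfl)
    · exact p.adj_getVert_succ (by omega)
    · exact (p.adj_getVert_succ (by omega)).symm

lemma eq_of_adj_getVert (hH : H.IsAcyclic) (hp : p.IsPath) {z : V₀} (hz : z ∉ p.support)
    {i j : ℕ} (hi : i ≤ p.length) (hj : j ≤ p.length) (hzi : H.Adj z (p.getVert i))
    (hzj : H.Adj z (p.getVert j)) : i = j := by
  wlog hij : i ≤ j generalizing i j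
  · exact (this hj hi hzj hzi (by omega)).symm
  obtain ⟨q, hq, hl, hs⟩ := exists_path_getVert hp hij hj
  have h := length_eq_one_of_adj hH (hq.cons (h := hzi) fun h => hz (hs z h)) hzj
  rw [Walk.length_cons] at h
  omega

lemma not_adj_of_notMem_support (hH : H.IsAcyclic) (hp : p.IsPath) {z y : V₀}
    (hz : z ∉ p.support) (hy : y ∉ p.support) {i j : ℕ} (hi : i ≤ p.length) (hj : j ≤ p.length)
    (hzi : H.Adj z (p.getVert i)) (hyj : H.Adj y (p.getVert j)) : ¬ H.Adj z y := by
  intro hzy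
  wlog hij : i ≤ j generalizing i j z y
  · exact this hy hz hj hi hyj hzi hzy.symm (by omega)
  obtain ⟨q, hq, hl, hs⟩ := exists_path_getVert hp hij hj
  have hq' := hq.concat (fun h => hy (hs y h)) hyj.symm
  have h := length_eq_one_of_adj hH (hq'.cons (h := hzi) fun h => by
    rw [Walk.support_concat, List.mem_append, List.mem_singleton] at h
    exact h.elim (fun h => hz (hs z h)) hzy.ne) hzy
  rw [Walk.length_cons, Walk.length_concat] at h
  omega

section Adj

variable {C W : Type} {g : C → ℕ} {f : W → V₀ ⊕ C}

lemma genCatGraph_adj_tree {a b : V₀} :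
    (genCatGraph H p g f).Adj (.inl (.inl a)) (.inl (.inl b)) ↔ H.Adj a b := by
  rw [genCatGraph, fromRel_adj]
  exact ⟨fun h => h.2.elim id Adj.symm, fun h => ⟨by simpa using h.ne, Or.inl h⟩⟩

lemma genCatGraph_adj_tree_clique {a : V₀} {c : C} :
    (genCatGraph H p g f).Adj (.inl (.inl a)) (.inl (.inr c)) ↔
      a = p.getVert (g c) ∨ a = p.getVert (g c + 1) := by
  rw [genCatGraph, fromRel_adj]
  exact ⟨fun h => h.2.elim id False.elim, fun h => ⟨by simp, Or.inl h⟩⟩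

lemma genCatGraph_adj_clique {c c' : C} :
    (genCatGraph H p g f).Adj (.inl (.inr c)) (.inl (.inr c')) ↔ c ≠ c' ∧ g c = g c' := by
  rw [genCatGraph, fromRel_adj]
  exact ⟨fun h => ⟨by simpa using h.1, h.2.elim id Eq.symm⟩, fun h => ⟨by simpa using h.1,
    Or.inl h.2⟩⟩

lemma eq_inl_of_genCatGraph_adj_whisker {w : W} {z : (V₀ ⊕ C) ⊕ W}
    (h : (genCatGraph H p g f).Adj (.inr w) z) : z = .inl (f w) := by
  rw [genCatGraph, fromRel_adj] at h
  rcases z with (z | z) | z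
  · exact congrArg Sum.inl (h.2.elim id False.elim)
  · exact congrArg Sum.inl (h.2.elim id False.elim)
  · exact (h.2.elim id id).elim

end Adj

lemma exists_skeleton_genCatGraph {C W : Type} (hH : H.IsAcyclic) (hp : p.IsPath)
    (hcat : ∀ z : V₀, z ∈ p.support ∨ ∃ y ∈ p.support, H.Adj z y) (g : C → ℕ)
    (hg : ∀ c, g c < p.length) (f : W → V₀ ⊕ C) :
    ∃ (s : V₀ ⊕ C → ℕ) (d : (V₀ ⊕ C) ⊕ W → ℕ) (root : (V₀ ⊕ C) ⊕ W → V₀ ⊕ C),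
      Skeleton (genCatGraph H p g f) s d root := by
  classical
  have hidx : ∀ z, ∃ i ≤ p.length, (z ∈ p.support → p.getVert i = z) ∧
      (z ∉ p.support → H.Adj z (p.getVert i)) := by
    intro z
    by_cases hz : z ∈ p.support
    · obtain ⟨i, hi, hl⟩ := Walk.mem_support_iff_exists_getVert.mp hz
      exact ⟨i, hl, fun _ => hi, fun h => absurd hz h⟩
    · obtain ⟨y, hy, hzy⟩ := (hcat z).resolve_left hz
      obtain ⟨i, hi, hl⟩ := Walk.mem_support_iff_exists_getVert.mp hy
      exact ⟨i, hl, fun h => absurd h hz, fun _ => hi ▸ hzy⟩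
  choose idx hle hon hoff using hidx
  have hidx_getVert : ∀ j ≤ p.length, idx (p.getVert j) = j := fun j hj =>
    hp.getVert_injOn (hle _) hj (hon _ (p.getVert_mem_support j))
  have hHoff : ∀ z y, H.Adj z y → z ∉ p.support →
      y ∈ p.support ∧ y = p.getVert (idx z) := by
    intro z y hzy hz
    have hy : y ∈ p.support := by
      by_contra hy
      exact not_adj_of_notMem_support hH hp hz hy (hle z) (hle y) (hoff z hz) (hoff y hy) hzy
    refine ⟨hy, ?_⟩
    rw [eq_of_adj_getVert hH hp hz (hle z) (hle y) (hoff z hz) ((hon y hy).symm ▸ hzy), hon y hy]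
  have hHon : ∀ z y, z ∈ p.support → y ∈ p.support →
      (H.Adj z y ↔ idx y = idx z + 1 ∨ idx z = idx y + 1) := by
    intro z y hz hy
    rw [← adj_getVert_iff hH hp (hle z) (hle y), hon z hz, hon y hy]
  have hCon : ∀ z c, z ∈ p.support → ((z = p.getVert (g c) ∨ z = p.getVert (g c + 1)) ↔
      idx z = g c ∨ idx z = g c + 1) := by
    intro z c hz
    have hc := hg c
    constructor
    · rintro (rfl | rfl)
      · exact Or.inl (hidx_getVert _ (by omega))
      · exact Or.inr (hidx_getVert _ (by omega))
    · rintro (h | h)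
      · exact Or.inl (by rw [← h, hon z hz])
      · exact Or.inr (by rw [← h, hon z hz])
  have hCmem : ∀ z c, (z = p.getVert (g c) ∨ z = p.getVert (g c + 1)) → z ∈ p.support := by
    rintro z c (rfl | rfl) <;> exact p.getVert_mem_support _
  let s : V₀ ⊕ C → ℕ := Sum.elim (fun z => 2 * idx z) fun c => 2 * g c + 1
  let base : V₀ ⊕ C → V₀ ⊕ C := Sum.elim (fun z => Sum.inl (p.getVert (idx z))) Sum.inr
  let root : (V₀ ⊕ C) ⊕ W → V₀ ⊕ C := Sum.elim base fun w => base (f w)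
  let d : (V₀ ⊕ C) ⊕ W → ℕ :=
    Sum.elim (Sum.elim (fun z => if z ∈ p.support then 0 else 1) fun _ => 0) fun _ => 2
  have hsV : ∀ z, s (root (.inl (.inl z))) = 2 * idx z := fun z =>
    congrArg (2 * ·) (hidx_getVert _ (hle z))
  have hsC : ∀ c, s (root (.inl (.inr c))) = 2 * g c + 1 := fun _ => rfl
  have hdV : ∀ z, d (.inl (.inl z)) ≠ 0 → z ∉ p.support := fun z hz h => hz (if_pos h)
  have hchain : ∀ x, d x = 0 →
      (∃ z ∈ p.support, x = .inl (.inl z)) ∨ ∃ c, x = .inl (.inr c) := by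
    rintro ((z | c) | w) hx
    · refine Or.inl ⟨z, ?_, rfl⟩
      by_contra hz
      exact one_ne_zero ((if_neg hz).symm.trans hx)
    · exact Or.inr ⟨c, rfl⟩
    · exact absurd hx two_ne_zero
  have hoff_adj : ∀ z ∉ p.support, ∀ y, (genCatGraph H p g f).Adj (.inl (.inl z)) y →
      y = .inl (.inl (p.getVert (idx z))) ∨ ∃ w, f w = .inl z ∧ y = .inr w := by
    rintro z hz ((y | c) | w) hzy
    · rw [(hHoff z y (genCatGraph_adj_tree.mp hzy) hz).2]
      exact Or.inl rfl
    · exact absurd (hCmem z c (genCatGraph_adj_tree_clique.mp hzy)) hz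
    · exact Or.inr ⟨w, (Sum.inl_injective (eq_inl_of_genCatGraph_adj_whisker hzy.symm)).symm, rfl⟩
  have hroot : ∀ x y, (genCatGraph H p g f).Adj x y → d x ≠ 0 → root x = root y := by
    rintro ((z | c) | w) y hxy hx
    · obtain rfl | ⟨w, hw, rfl⟩ := hoff_adj z (hdV z hx) y hxy
      · change Sum.inl _ = Sum.inl (p.getVert (idx (p.getVert (idx z))))
        rw [hidx_getVert _ (hle z)]
      · change base (.inl z) = base (f w)
        rw [hw]
    · exact absurd rfl hx
    · rw [eq_inl_of_genCatGraph_adj_whisker hxy]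
      rfl
  refine ⟨s, d, root, fun x y hx hy hxy => ?_, fun x y hx hy hxy he => ?_, fun x y hx hy => ?_,
    fun x y hxy h => ?_, ?_⟩
  · obtain ⟨z, hz, rfl⟩ | ⟨c, rfl⟩ := hchain x hx <;>
      obtain ⟨z', hz', rfl⟩ | ⟨c', rfl⟩ := hchain y hy
    · rw [← hon z hz, ← hon z' hz', Sum.inl_injective hxy]
    · exact absurd hxy Sum.inl_ne_inr
    · exact absurd hxy Sum.inr_ne_inl
    · rw [Sum.inr_injective hxy]
  · obtain ⟨z, hz, rfl⟩ | ⟨c, rfl⟩ := hchain x hx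
    · obtain ⟨z', hz', rfl⟩ | ⟨c', rfl⟩ := hchain y hy
      · rw [hsV, hsV] at hxy
        rw [← hon z hz, ← hon z' hz', Nat.eq_of_mul_eq_mul_left two_pos hxy]
      · rw [hsV, hsC] at hxy
        omega
    · rw [hsC] at he
      exact absurd he (by simp)
  · obtain ⟨z, hz, rfl⟩ | ⟨c, rfl⟩ := hchain x hx <;>
      obtain ⟨z', hz', rfl⟩ | ⟨c', rfl⟩ := hchain y hy
    · rw [genCatGraph_adj_tree, hHon z z' hz hz', hsV, hsV]
      constructor
      · intro h
        refine ⟨?_, min (idx z) (idx z'), by omega⟩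
        rintro ⟨⟩
        omega
      · rintro ⟨hne, i, hi⟩
        have hne' : idx z ≠ idx z' := fun h => hne (by rw [← hon z hz, h, hon z' hz'])
        omega
    · rw [genCatGraph_adj_tree_clique, hCon z c' hz, hsV, hsC]
      exact ⟨fun h => ⟨by simp, g c', by omega⟩, fun ⟨_, i, hi⟩ => by omega⟩
    · rw [adj_comm, genCatGraph_adj_tree_clique, hCon z' c hz', hsV, hsC]
      exact ⟨fun h => ⟨by simp, g c, by omega⟩, fun ⟨_, i, hi⟩ => by omega⟩
    · rw [genCatGraph_adj_clique, hsC, hsC]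
      exact ⟨fun h => ⟨by simpa using h.1, g c, by omega⟩,
        fun ⟨hne, i, hi⟩ => ⟨by simpa using hne, by omega⟩⟩
  · exact h.elim (hroot x y hxy) fun h => (hroot y x hxy.symm h).symm
  · rintro ((x | c) | w) y z hx hy hz hyx hzx
    · have hx' := hdV x hx
      have hparent : ∀ y, (genCatGraph H p g f).Adj (.inl (.inl x)) y →
          d y ≤ d (.inl (.inl x)) → y = .inl (.inl (p.getVert (idx x))) := by
        intro y hy hyx
        obtain h | ⟨w, -, rfl⟩ := hoff_adj x hx' y hy
        · exact h
        · exact absurd (hyx.trans_eq (if_neg hx')) (by simp [d])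
      rw [hparent y hy hyx, hparent z hz hzx]
    · exact absurd rfl hx
    · rw [eq_inl_of_genCatGraph_adj_whisker hy, eq_inl_of_genCatGraph_adj_whisker hz]

end Caterpillar

end BinomialEdge

/-- If `G` is a generalized caterpillar graph with `J_G ^ 2 = J_G ^ (2)`, then
`J_G ^ i = J_G ^ (i)` for every `i ≥ 1`. -/
theorem ordinary_eq_symbolic_of_sq_generalizedCaterpillar {V : Type} [Fintype V]
    (k : Type) [Field k] (G : SimpleGraph V) (hG : IsGeneralizedCaterpillar G)
    (h2 : binomialEdgeIdeal k G ^ 2 = symbolicPower (binomialEdgeIdeal k G) 2) :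
    ∀ i : ℕ, 1 ≤ i →
      binomialEdgeIdeal k G ^ i = symbolicPower (binomialEdgeIdeal k G) i := by
  classical
  obtain ⟨V₀, C, W, -, -, -, H, u, v, p, g, f, hH, hp, hcat, hg, ⟨φ⟩⟩ := hG
  obtain ⟨s, d, root, hS⟩ :=
    BinomialEdge.exists_skeleton_genCatGraph hH.isAcyclic hp hcat g hg f
  have hnet := BinomialEdge.netFree_of_sq_eq h2
  intro t _
  refine BinomialEdge.pow_eq_symbolicPower_of_detects (A := Finset.univ.filter
    (BinomialEdge.IsCore G)) (BinomialEdge.detects_of_elimination ?_ ?_ _) t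
  · intro w hw i j hi hj hij
    by_contra h
    exact hw (Finset.mem_filter.mpr ⟨Finset.mem_univ w, i, j, hi, hj, hij, h⟩)
  · intro U hU
    obtain ⟨x, hx, hclique, hcore⟩ := (hS.comap φ).elimination hnet U hU
    exact ⟨x, hx, hclique, fun i hi j hj hxi hxj hiA hjA =>
      hcore i hi j hj hxi hxj (Finset.mem_filter.mp hiA).2 (Finset.mem_filter.mp hjA).2⟩
end

section
/- If a graph G contains the net as an induced subgraph, then G is not weakly closed. -/
instance : DecidableRel netGraph.Adj := fun a b => by
  unfold netGraph
  rw [SimpleGraph.fromRel_adj]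
  infer_instance

/-- In a labelling witnessing weak closedness, a vertex `b` to the right of `a` is also to the
right of every neighbour `c` of `a`, provided that `b ≠ c` is adjacent to neither of them. -/
lemma lt_of_adj_of_not_adj {V : Type*} {G : SimpleGraph V} {n : ℕ} (f : V ≃ Fin n)
    (hf : ∀ a b c : V, f a < f b → f b < f c → G.Adj a c → G.Adj a b ∨ G.Adj b c)
    {a b c : V} (hac : G.Adj a c) (hbc : b ≠ c) (hab : ¬ G.Adj a b) (hcb : ¬ G.Adj b c)
    (h : f a < f b) : f c < f b := by
  refine lt_of_not_ge fun hle => ?_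
  have hlt : f b < f c := lt_of_le_of_ne hle (f.injective.ne hbc)
  exact (hf a b c h hlt hac).elim hab hcb

/-- If a graph `G` contains the net as an induced subgraph (i.e. there is a graph embedding
of the net into `G`), then `G` is not weakly closed. -/
theorem not_weaklyClosed_of_net_embedding {V : Type} [Fintype V] (G : SimpleGraph V)
    (h : Nonempty (netGraph ↪g G)) : ¬ WeaklyClosed G := by
  obtain ⟨e⟩ := h
  rintro ⟨f, hf⟩
  have step (a b c : Fin 6)
      (hab : netGraph.Adj a c ∧ b ≠ c ∧ ¬ netGraph.Adj a b ∧ ¬ netGraph.Adj b c)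
      (hlt : f (e a) < f (e b)) : f (e c) < f (e b) :=
    lt_of_adj_of_not_adj f hf (e.map_adj_iff.2 hab.1) (e.injective.ne hab.2.1)
      (mt e.map_adj_iff.1 hab.2.2.1) (mt e.map_adj_iff.1 hab.2.2.2) hlt
  -- The pendant vertices form an asteroidal triple, so none of them lies between the others.
  have h₁ : f (e 3) < f (e 4) → f (e 5) < f (e 4) := fun hlt =>
    step 2 4 5 (by decide) <| step 0 4 2 (by decide) <| step 3 4 0 (by decide) hlt
  have h₂ : f (e 5) < f (e 4) → f (e 3) < f (e 4) := fun hlt =>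
    step 0 4 3 (by decide) <| step 2 4 0 (by decide) <| step 5 4 2 (by decide) hlt
  have h₃ : f (e 3) < f (e 5) → f (e 4) < f (e 5) := fun hlt =>
    step 1 5 4 (by decide) <| step 0 5 1 (by decide) <| step 3 5 0 (by decide) hlt
  have h₄ : f (e 4) < f (e 5) → f (e 3) < f (e 5) := fun hlt =>
    step 0 5 3 (by decide) <| step 1 5 0 (by decide) <| step 4 5 1 (by decide) hlt
  have h₅ : f (e 4) < f (e 3) → f (e 5) < f (e 3) := fun hlt =>
    step 2 3 5 (by decide) <| step 1 3 2 (by decide) <| step 4 3 1 (by decide) hlt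
  have h₆ : f (e 5) < f (e 3) → f (e 4) < f (e 3) := fun hlt =>
    step 1 3 4 (by decide) <| step 2 3 1 (by decide) <| step 5 3 2 (by decide) hlt
  have n₁ : f (e 3) ≠ f (e 4) := by simp
  have n₂ : f (e 3) ≠ f (e 5) := by simp
  have n₃ : f (e 4) ≠ f (e 5) := by simp
  omega
end

section
/- Let G be a connected graph on the vertex set [n] = {1,…,n} and let T_G = {v ∈ [n] : deg(v) = n − 1}. Then the binomial edge ideal J_G has exactly two associated primes (|Ass(S/J_G)| = 2) if and only if the following two conditions hold: (1) T_G ≠ ∅ and the induced subgraph of G on [n] ∖ T_G is disconnected; (2) the induced subgraph of G on [n] ∖ T_G is a disjoint union of complete graphs. Moreover, under these assumptions, J_G = J_{K_n} ∩ P_{T_G}(G), where K_n is the complete graph on [n]. -/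
open MvPolynomial

/-- For `U ⊆ [n]`, the prime ideal `P_U(G)`: generated by the variables `x_i, y_i` for
`i ∈ U` together with the binomials `x_i y_j - x_j y_i` for all pairs of distinct vertices
`i, j ∉ U` lying in the same connected component of the induced subgraph of `G` on the
complement of `U`. -/
noncomputable def PUIdeal (k : Type) [Field k] {n : ℕ} (G : SimpleGraph (Fin n))
    (U : Set (Fin n)) : Ideal (MvPolynomial (Fin n ⊕ Fin n) k) :=
  Ideal.span
    ({f | ∃ i ∈ U, f = X (Sum.inl i) ∨ f = X (Sum.inr i)} ∪
     {f | ∃ (i j : Fin n) (hi : i ∈ Uᶜ) (hj : j ∈ Uᶜ),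
        (G.induce Uᶜ).Reachable ⟨i, hi⟩ ⟨j, hj⟩ ∧ i ≠ j ∧
        f = X (Sum.inl i) * X (Sum.inr j) - X (Sum.inl j) * X (Sum.inr i)})

section Toric

variable (k : Type) [Field k] {V C : Type}

/-- The binomial `x_i y_j - x_j y_i`. -/
noncomputable def edgeBinomial (i j : V) : MvPolynomial (V ⊕ V) k :=
  X (Sum.inl i) * X (Sum.inr j) - X (Sum.inl j) * X (Sum.inr i)

/-- The ideal generated by the binomials of all pairs of vertices of equal colour. -/
noncomputable def colorIdeal (c : V → C) : Ideal (MvPolynomial (V ⊕ V) k) :=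
  Ideal.span {f | ∃ i j, c i = c j ∧ f = edgeBinomial k i j}

/-- The monomial parametrization `x_i ↦ s_i a_{c i}`, `y_i ↦ s_i`. -/
noncomputable def colorParam (c : V → C) :
    MvPolynomial (V ⊕ V) k →ₐ[k] MvPolynomial (V ⊕ C) k :=
  aeval (Sum.elim (fun i => X (Sum.inl i) * X (Sum.inr (c i))) (fun i => X (Sum.inl i)))

/-- The exponent of the image of a monomial under `colorParam`. -/
noncomputable def colorDegree (c : V → C) (d : V ⊕ V →₀ ℕ) : V ⊕ C →₀ ℕ :=
  d.sum fun v m => m • Sum.elim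
    (fun i => Finsupp.single (Sum.inl i) 1 + Finsupp.single (Sum.inr (c i)) 1)
    (fun i => Finsupp.single (Sum.inl i) 1) v

variable {k} in
theorem colorParam_edgeBinomial (c : V → C) (i j : V) :
    colorParam k c (edgeBinomial k i j) =
      X (Sum.inl i) * X (Sum.inl j) * (X (Sum.inr (c i)) - X (Sum.inr (c j))) := by
  simp only [colorParam, edgeBinomial, map_sub, map_mul, aeval_X, Sum.elim_inl, Sum.elim_inr]
  ring

theorem colorParam_monomial (c : V → C) (d : V ⊕ V →₀ ℕ) (a : k) :
    colorParam k c (monomial d a) = monomial (colorDegree c d) a := by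
  rw [colorParam, aeval_monomial, colorDegree, monomial_finsupp_sum_index]
  congr 1
  refine Finsupp.prod_congr fun v _ => ?_
  rcases v with i | i <;> simp [X, monomial_mul, monomial_pow]

theorem colorDegree_add (c : V → C) (d e : V ⊕ V →₀ ℕ) :
    colorDegree c (d + e) = colorDegree c d + colorDegree c e :=
  Finsupp.sum_add_index' (by simp) (by simp [add_smul])

theorem colorDegree_single_add_single (c : V → C) (i j : V) :
    colorDegree c (Finsupp.single (Sum.inl i) 1 + Finsupp.single (Sum.inr j) 1) =
      Finsupp.single (Sum.inl i) 1 + Finsupp.single (Sum.inl j) 1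
        + Finsupp.single (Sum.inr (c i)) 1 := by
  rw [colorDegree_add]
  simp [colorDegree, Finsupp.sum_single_index]
  abel

theorem colorDegree_inl [Fintype V] (c : V → C) (d : V ⊕ V →₀ ℕ) (i : V) :
    colorDegree c d (Sum.inl i) = d (Sum.inl i) + d (Sum.inr i) := by
  classical
  rw [colorDegree, Finsupp.sum_fintype _ _ (by simp), Fintype.sum_sum_type]
  simp [Finsupp.single_apply]

open Classical in
theorem colorDegree_inr [Fintype V] (c : V → C) (d : V ⊕ V →₀ ℕ) (a : C) :
    colorDegree c d (Sum.inr a) = ∑ i with c i = a, d (Sum.inl i) := by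
  rw [colorDegree, Finsupp.sum_fintype _ _ (by simp), Fintype.sum_sum_type]
  simp [Finsupp.single_apply, Finset.sum_filter]

open Classical in
theorem exists_lt_of_sum_fiber_eq [Fintype V] {c : V → C} {f g : V → ℕ} {i : V}
    (h : ∑ j with c j = c i, f j = ∑ j with c j = c i, g j) (hi : g i < f i) :
    ∃ j, c j = c i ∧ f j < g j := by
  obtain ⟨j, hj, hlt⟩ := Finset.exists_lt_of_sum_lt
    (s := Finset.univ.filter (fun j => c j = c i) \ {i})
    (f := f) (g := g) (by
      have hmem : i ∈ Finset.univ.filter fun j => c j = c i := by simp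
      rw [← Finset.sum_sdiff (Finset.singleton_subset_iff.2 hmem),
        ← Finset.sum_sdiff (f := g) (Finset.singleton_subset_iff.2 hmem)] at h
      simp only [Finset.sum_singleton] at h
      lia)
  exact ⟨j, by simp at hj; exact hj.1, hlt⟩

theorem monomial_add_sub_monomial_add_mem (c : V → C) {i j : V} (hij : c i = c j)
    (e : V ⊕ V →₀ ℕ) :
    monomial (e + (Finsupp.single (Sum.inl i) 1 + Finsupp.single (Sum.inr j) 1)) (1 : k) -
      monomial (e + (Finsupp.single (Sum.inl j) 1 + Finsupp.single (Sum.inr i) 1)) 1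
        ∈ colorIdeal k c := by
  have key : monomial (e + (Finsupp.single (Sum.inl i) 1 + Finsupp.single (Sum.inr j) 1)) (1 : k) -
      monomial (e + (Finsupp.single (Sum.inl j) 1 + Finsupp.single (Sum.inr i) 1)) 1 =
      monomial e 1 * edgeBinomial k i j := by
    simp [edgeBinomial, X, monomial_mul, mul_sub]
  rw [key]
  exact Ideal.mul_mem_left _ _ (Ideal.subset_span ⟨i, j, hij, rfl⟩)

theorem monomial_sub_monomial_mem [Fintype V] (c : V → C) (d d' : V ⊕ V →₀ ℕ)
    (h : colorDegree c d = colorDegree c d') :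
    monomial d (1 : k) - monomial d' 1 ∈ colorIdeal k c := by
  classical
  induction hN : ∑ i, (d (Sum.inl i) - d' (Sum.inl i)) using Nat.strong_induction_on
    generalizing d with
  | _ N ih =>
  have hs : ∀ a : C, ∑ i with c i = a, d (Sum.inl i) = ∑ i with c i = a, d' (Sum.inl i) := by
    intro a
    rw [← colorDegree_inr, ← colorDegree_inr, h]
  have ht : ∀ i, d (Sum.inl i) + d (Sum.inr i) = d' (Sum.inl i) + d' (Sum.inr i) := by
    intro i
    rw [← colorDegree_inl c, ← colorDegree_inl c, h]
  by_cases hi : ∃ i, d' (Sum.inl i) < d (Sum.inl i)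
  · obtain ⟨i, hi⟩ := hi
    obtain ⟨j, hcj, hj⟩ := exists_lt_of_sum_fiber_eq (hs (c i)) hi
    have hne : i ≠ j := by rintro rfl; lia
    set m : V ⊕ V →₀ ℕ := Finsupp.single (Sum.inl i) 1 + Finsupp.single (Sum.inr j) 1 with hm
    set m' : V ⊕ V →₀ ℕ := Finsupp.single (Sum.inl j) 1 + Finsupp.single (Sum.inr i) 1 with hm'
    have hle : m ≤ d := by
      intro v
      have := ht j
      rcases v with v | v
      · by_cases hv : i = v
        · subst hv; simp [m]; lia
        · simp [m, hv]
      · by_cases hv : j = v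
        · subst hv; simp [m]; lia
        · simp [m, hv]
    obtain ⟨e, rfl⟩ : ∃ e, d = e + m := ⟨d - m, (tsub_add_cancel_of_le hle).symm⟩
    have hdeg : colorDegree c (e + m') = colorDegree c (e + m) := by
      rw [colorDegree_add, colorDegree_add c e m, hm, hm', colorDegree_single_add_single,
        colorDegree_single_add_single, hcj]
      abel
    have hlt : ∑ l, ((e + m') (Sum.inl l) - d' (Sum.inl l)) < N := by
      rw [← hN]
      refine Finset.sum_lt_sum (fun l _ => ?_) ⟨i, Finset.mem_univ _, ?_⟩
      · by_cases hl : j = l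
        · subst hl
          simp [m, m', hne] at hj ⊢
          lia
        · simp [m', hl]
          lia
      · simp [m, m', hne.symm] at hi ⊢
        lia
    have h1 := ih _ hlt (e + m') (hdeg.trans h) rfl
    have h2 := monomial_add_sub_monomial_add_mem k c hcj.symm e
    rw [← hm, ← hm'] at h2
    simpa only [sub_add_sub_cancel] using Ideal.add_mem _ h2 h1
  · have heq : ∀ i, d (Sum.inl i) = d' (Sum.inl i) := by
      intro i
      by_contra hcon
      have hlt : d (Sum.inl i) < d' (Sum.inl i) := by
        by_contra h'
        exact hi ⟨i, by lia⟩
      obtain ⟨j, -, hj⟩ := exists_lt_of_sum_fiber_eq (hs (c i)).symm hlt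
      exact hi ⟨j, hj⟩
    have : d = d' := by
      ext v
      rcases v with v | v
      · exact heq v
      · have := heq v
        have := ht v
        lia
    simp [this]

theorem colorIdeal_eq_ker [Fintype V] (c : V → C) :
    colorIdeal k c = RingHom.ker (colorParam k c) := by
  apply le_antisymm
  · rw [colorIdeal, Ideal.span_le]
    rintro _ ⟨i, j, hij, rfl⟩
    simp [RingHom.mem_ker, colorParam_edgeBinomial, hij]
  · let L : MvPolynomial (V ⊕ C) k →ₗ[k] MvPolynomial (V ⊕ V) k :=
      (basisMonomials (V ⊕ C) k).constr k
        fun w => monomial (Function.invFun (colorDegree c) w) 1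
    have hL : ∀ w, L (monomial w 1) = monomial (Function.invFun (colorDegree c) w) 1 := fun w => by
      have := (basisMonomials (V ⊕ C) k).constr_basis k
        (fun w => monomial (Function.invFun (colorDegree c) w) (1 : k)) w
      simpa using this
    have key : ∀ f, f - L (colorParam k c f) ∈ colorIdeal k c := by
      intro f
      induction f using MvPolynomial.induction_on' with
      | monomial d a =>
        have ha : ∀ {σ : Type} (w : σ →₀ ℕ), monomial w a = a • monomial w (1 : k) := by
          intros; simp [smul_monomial]
        rw [colorParam_monomial, ha, ha, map_smul, hL, ← smul_sub]
        refine Submodule.smul_of_tower_mem _ a (monomial_sub_monomial_mem k c _ _ ?_)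
        exact (Function.invFun_eq ⟨d, rfl⟩).symm
      | add p q hp hq =>
        rw [map_add, map_add, add_sub_add_comm]
        exact Ideal.add_mem _ hp hq
    intro f hf
    have := key f
    rwa [RingHom.mem_ker.1 hf, map_zero, sub_zero] at this

end Toric

section Combinatorics

variable {k : Type} [Field k] {V : Type}

theorem edgeBinomial_self (i : V) : edgeBinomial k i i = 0 := sub_self _

theorem edgeBinomial_mem_of_adj {G : SimpleGraph V} {i j : V} (h : G.Adj i j) :
    edgeBinomial k i j ∈ binomialEdgeIdeal k G :=
  Ideal.subset_span ⟨i, j, h, rfl⟩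

theorem X_mul_edgeBinomial_mem {I : Ideal (MvPolynomial (V ⊕ V) k)} {i j l : V} {v : V ⊕ V}
    (hv : v.elim id id = j) (hij : edgeBinomial k i j ∈ I) (hjl : edgeBinomial k j l ∈ I) :
    X v * edgeBinomial k i l ∈ I := by
  rcases v with v | v
  · obtain rfl : v = j := hv
    have : X (Sum.inl v) * edgeBinomial k i l =
        X (Sum.inl i) * edgeBinomial k v l + X (Sum.inl l) * edgeBinomial k i v := by
      simp only [edgeBinomial]
      ring
    rw [this]
    exact I.add_mem (I.mul_mem_left _ hjl) (I.mul_mem_left _ hij)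
  · obtain rfl : v = j := hv
    have : X (Sum.inr v) * edgeBinomial k i l =
        X (Sum.inr i) * edgeBinomial k v l + X (Sum.inr l) * edgeBinomial k i v := by
      simp only [edgeBinomial]
      ring
    rw [this]
    exact I.add_mem (I.mul_mem_left _ hjl) (I.mul_mem_left _ hij)

/-- A prime containing `J_G` contains `f_{ij}` as soon as `i` and `j` are joined by a walk each of
whose vertices has a variable outside the prime. -/
theorem edgeBinomial_mem_of_reachable {G : SimpleGraph V} {Q : Ideal (MvPolynomial (V ⊕ V) k)}
    (hQ : Q.IsPrime) (hJ : binomialEdgeIdeal k G ≤ Q) {W : Type} {H : SimpleGraph W} (φ : H →g G)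
    (hφ : ∀ w, ∃ v : V ⊕ V, v.elim id id = φ w ∧ X v ∉ Q) {a b : W} (hab : H.Reachable a b) :
    edgeBinomial k (φ a) (φ b) ∈ Q := by
  obtain ⟨p⟩ := hab
  induction p with
  | nil => simp [edgeBinomial_self]
  | @cons a b c h p ih =>
    obtain ⟨v, hv, hvQ⟩ := hφ b
    exact (hQ.mem_or_mem (X_mul_edgeBinomial_mem hv
      (hJ (edgeBinomial_mem_of_adj (φ.map_adj h))) ih)).resolve_left hvQ

theorem edgeBinomial_mem_top (i j : V) :
    edgeBinomial k i j ∈ binomialEdgeIdeal k (⊤ : SimpleGraph V) := by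
  by_cases h : i = j
  · simp [h, edgeBinomial_self]
  · exact edgeBinomial_mem_of_adj (by simpa using h)

theorem binomialEdgeIdeal_top_le_iff {I : Ideal (MvPolynomial (V ⊕ V) k)} :
    binomialEdgeIdeal k (⊤ : SimpleGraph V) ≤ I ↔ ∀ i j, edgeBinomial k i j ∈ I := by
  refine ⟨fun h i j => h (edgeBinomial_mem_top i j), fun h => ?_⟩
  rw [binomialEdgeIdeal, Ideal.span_le]
  rintro _ ⟨i, j, -, rfl⟩
  exact h i j

theorem binomialEdgeIdeal_mono {G H : SimpleGraph V} (h : G ≤ H) :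
    binomialEdgeIdeal k G ≤ binomialEdgeIdeal k H := by
  rw [binomialEdgeIdeal, Ideal.span_le]
  rintro _ ⟨i, j, hij, rfl⟩
  exact edgeBinomial_mem_of_adj (h hij)

theorem binomialEdgeIdeal_top_eq_ker [Fintype V] :
    binomialEdgeIdeal k (⊤ : SimpleGraph V) =
      RingHom.ker (colorParam k (fun _ : V => ())) := by
  rw [← colorIdeal_eq_ker]
  apply le_antisymm
  · exact binomialEdgeIdeal_top_le_iff.2 fun i j => Ideal.subset_span ⟨i, j, rfl, rfl⟩
  · rw [colorIdeal, Ideal.span_le]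
    rintro _ ⟨i, j, -, rfl⟩
    exact edgeBinomial_mem_top i j

theorem isPrime_binomialEdgeIdeal_top [Fintype V] :
    (binomialEdgeIdeal k (⊤ : SimpleGraph V)).IsPrime := by
  rw [binomialEdgeIdeal_top_eq_ker]
  exact RingHom.ker_isPrime _

theorem X_notMem_binomialEdgeIdeal_top [Fintype V] (v : V ⊕ V) :
    X v ∉ binomialEdgeIdeal k (⊤ : SimpleGraph V) := by
  rw [binomialEdgeIdeal_top_eq_ker, RingHom.mem_ker]
  rcases v with v | v <;> simp [colorParam, X_ne_zero]

/-- `J_{K_n}` is a minimal prime of `J_G` for connected `G`. -/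
theorem binomialEdgeIdeal_top_mem_minimalPrimes [Fintype V] {G : SimpleGraph V}
    (hG : G.Preconnected) :
    binomialEdgeIdeal k (⊤ : SimpleGraph V) ∈ (binomialEdgeIdeal k G).minimalPrimes := by
  refine ⟨⟨isPrime_binomialEdgeIdeal_top, binomialEdgeIdeal_mono le_top⟩, ?_⟩
  rintro Q ⟨hQ, hJQ⟩ hle
  exact binomialEdgeIdeal_top_le_iff.2 fun i j =>
    edgeBinomial_mem_of_reachable hQ hJQ SimpleGraph.Hom.id
      (fun w => ⟨Sum.inl w, rfl, fun h => X_notMem_binomialEdgeIdeal_top _ (hle h)⟩) (hG i j)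

open Classical in
/-- The endomorphism setting the variables of the vertices in `U` to zero. -/
noncomputable def killVars (k : Type) [Field k] (U : Set V) :
    MvPolynomial (V ⊕ V) k →ₐ[k] MvPolynomial (V ⊕ V) k :=
  aeval fun v => if v.elim id id ∈ U then 0 else X v

theorem killVars_X_of_mem {U : Set V} {v : V ⊕ V} (h : v.elim id id ∈ U) :
    killVars k U (X v) = 0 := by simp [killVars, h]

theorem killVars_X_of_notMem {U : Set V} {v : V ⊕ V} (h : v.elim id id ∉ U) :
    killVars k U (X v) = X v := by simp [killVars, h]

theorem killVars_edgeBinomial_of_mem {U : Set V} {i j : V} (h : i ∈ U ∨ j ∈ U) :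
    killVars k U (edgeBinomial k i j) = 0 := by
  rcases h with h | h <;> simp [edgeBinomial, killVars, h]

theorem killVars_edgeBinomial_of_notMem {U : Set V} {i j : V} (hi : i ∉ U) (hj : j ∉ U) :
    killVars k U (edgeBinomial k i j) = edgeBinomial k i j := by
  simp [edgeBinomial, killVars, hi, hj]

theorem sub_killVars_mem {U : Set V} {I : Ideal (MvPolynomial (V ⊕ V) k)}
    (hI : ∀ v : V ⊕ V, v.elim id id ∈ U → X v ∈ I) (f : MvPolynomial (V ⊕ V) k) :
    f - killVars k U f ∈ I := by
  rw [← Ideal.Quotient.eq]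
  have : Ideal.Quotient.mkₐ k I = (Ideal.Quotient.mkₐ k I).comp (killVars k U) := by
    refine MvPolynomial.algHom_ext fun v => ?_
    by_cases hv : v.elim id id ∈ U
    · simpa [killVars_X_of_mem hv] using Ideal.Quotient.eq_zero_iff_mem.2 (hI v hv)
    · simp [killVars_X_of_notMem hv]
  exact DFunLike.congr_fun this f

theorem edgeBinomial_ne_zero {i j : V} (h : i ≠ j) : edgeBinomial k i j ≠ 0 := by
  intro h0
  have := congrArg (colorParam k (id : V → V)) h0
  rw [colorParam_edgeBinomial, map_zero] at this
  simp only [mul_eq_zero, X_ne_zero, false_or, sub_eq_zero, id] at this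
  exact h (Sum.inr_injective (X_injective this))

theorem binomialEdgeIdeal_le_ker_killVars {G : SimpleGraph V} {u w : V} (h : ¬ G.Adj u w) :
    binomialEdgeIdeal k G ≤ RingHom.ker (killVars k ({u, w}ᶜ : Set V)) := by
  rw [binomialEdgeIdeal, Ideal.span_le]
  rintro _ ⟨i, j, hij, rfl⟩
  refine RingHom.mem_ker.2 (killVars_edgeBinomial_of_mem ?_)
  by_contra hcon
  rw [not_or, Set.notMem_compl_iff, Set.notMem_compl_iff] at hcon
  obtain ⟨rfl | rfl, rfl | rfl⟩ := hcon
  · exact G.irrefl hij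
  · exact h hij
  · exact h hij.symm
  · exact G.irrefl hij

theorem edgeBinomial_notMem_ker_killVars {u w : V} (h : u ≠ w) :
    edgeBinomial k u w ∉ RingHom.ker (killVars k ({u, w}ᶜ : Set V)) := by
  rw [RingHom.mem_ker, killVars_edgeBinomial_of_notMem (by simp) (by simp)]
  exact edgeBinomial_ne_zero h

theorem X_notMem_ker_killVars {u w : V} :
    X (Sum.inl u) ∉ RingHom.ker (killVars k ({u, w}ᶜ : Set V)) := by
  rw [RingHom.mem_ker, killVars_X_of_notMem (by simp)]
  exact X_ne_zero _

end Combinatorics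

section AssociatedPrimes

variable {R : Type*} [CommRing R] [IsNoetherianRing R]

theorem minimalPrimes_subset_associatedPrimes (I : Ideal R) :
    I.minimalPrimes ⊆ associatedPrimes R (R ⧸ I) := by
  have := Module.associatedPrimes.minimalPrimes_annihilator_subset_associatedPrimes R (R ⧸ I)
  rwa [Ideal.annihilator_quotient] at this

theorem associatedPrimes_quotient_of_isPrime {P : Ideal R} (hP : P.IsPrime) :
    associatedPrimes R (R ⧸ P) = {P} := by
  rw [associatedPrimes.eq_singleton_of_isPrimary hP.isPrimary, hP.radical]

theorem associatedPrimes_quotient_inf {P Q : Ideal R} (hP : P.IsPrime) (hQ : Q.IsPrime)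
    (hPQ : ¬ P ≤ Q) (hQP : ¬ Q ≤ P) : associatedPrimes R (R ⧸ P ⊓ Q) = {P, Q} := by
  apply Set.Subset.antisymm
  · let f : (R ⧸ P ⊓ Q) →ₗ[R] (R ⧸ P) × (R ⧸ Q) :=
      Submodule.liftQ (P ⊓ Q) (P.mkQ.prod Q.mkQ) (by simp [LinearMap.ker_prod])
    have hf : Function.Injective f := by
      rw [← LinearMap.ker_eq_bot]
      exact Submodule.ker_liftQ_eq_bot _ _ _ (by simp [LinearMap.ker_prod])
    have := associatedPrimes.subset_of_injective hf
    rw [associatedPrimes.prod, associatedPrimes_quotient_of_isPrime hP,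
      associatedPrimes_quotient_of_isPrime hQ] at this
    exact this
  · refine Set.Subset.trans ?_ (minimalPrimes_subset_associatedPrimes _)
    rintro _ (rfl | rfl)
    · refine ⟨⟨hP, inf_le_left⟩, fun L hL hle => ?_⟩
      exact (hL.1.inf_le.1 hL.2).resolve_right fun h => hQP (h.trans hle)
    · refine ⟨⟨hQ, inf_le_right⟩, fun L hL hle => ?_⟩
      exact (hL.1.inf_le.1 hL.2).resolve_left fun h => hPQ (h.trans hle)

end AssociatedPrimes

section PUIdeal

variable {k : Type} [Field k] {n : ℕ} {G : SimpleGraph (Fin n)}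

theorem X_mem_PUIdeal {U : Set (Fin n)} {v : Fin n ⊕ Fin n} (hv : v.elim id id ∈ U) :
    X v ∈ PUIdeal k G U := by
  refine Ideal.subset_span (Or.inl ⟨_, hv, ?_⟩)
  rcases v with v | v
  · exact Or.inl rfl
  · exact Or.inr rfl

open Classical in
/-- The connected component of a vertex in the complement of `U`. -/
noncomputable def componentColor (G : SimpleGraph (Fin n)) (U : Set (Fin n)) (i : Fin n) :
    Option (G.induce Uᶜ).ConnectedComponent :=
  if h : i ∈ Uᶜ then some ((G.induce Uᶜ).connectedComponentMk ⟨i, h⟩) else none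

theorem componentColor_eq_iff {U : Set (Fin n)} {i j : Fin n} (hi : i ∈ Uᶜ) (hj : j ∈ Uᶜ) :
    componentColor G U i = componentColor G U j ↔
      (G.induce Uᶜ).Reachable ⟨i, hi⟩ ⟨j, hj⟩ := by
  rw [componentColor, componentColor, dif_pos hi, dif_pos hj, Option.some_inj,
    SimpleGraph.ConnectedComponent.eq]

theorem PUIdeal_eq_ker (U : Set (Fin n)) :
    PUIdeal k G U =
      RingHom.ker ((colorParam k (componentColor G U)).comp (killVars k U)) := by
  apply le_antisymm
  · rw [PUIdeal, Ideal.span_le]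
    rintro _ (⟨i, hi, rfl | rfl⟩ | ⟨i, j, hi, hj, hij, -, rfl⟩)
    · simp [RingHom.mem_ker, killVars, hi]
    · simp [RingHom.mem_ker, killVars, hi]
    · rw [← edgeBinomial, SetLike.mem_coe, RingHom.mem_ker, AlgHom.comp_apply,
        killVars_edgeBinomial_of_notMem hi hj, colorParam_edgeBinomial,
        (componentColor_eq_iff hi hj).2 hij, sub_self, mul_zero]
  · intro f hf
    have h1 : killVars k U f ∈ colorIdeal k (componentColor G U) := by
      rw [colorIdeal_eq_ker, RingHom.mem_ker, ← AlgHom.comp_apply]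
      exact RingHom.mem_ker.1 hf
    have h2 : colorIdeal k (componentColor G U) ≤
        (PUIdeal k G U).comap (killVars k U) := by
      rw [colorIdeal, Ideal.span_le]
      rintro _ ⟨i, j, hij, rfl⟩
      rw [SetLike.mem_coe, Ideal.mem_comap]
      by_cases h : i ∈ U ∨ j ∈ U
      · simp [killVars_edgeBinomial_of_mem h]
      · rw [not_or] at h
        rw [killVars_edgeBinomial_of_notMem h.1 h.2]
        by_cases hne : i = j
        · simp [hne, edgeBinomial_self]
        · exact Ideal.subset_span
            (Or.inr ⟨i, j, h.1, h.2, (componentColor_eq_iff h.1 h.2).1 hij, hne, rfl⟩)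
    have h3 := sub_killVars_mem (I := PUIdeal k G U) (fun v hv => X_mem_PUIdeal hv)
    have h4 := Ideal.add_mem _ (h3 (killVars k U f)) (Ideal.mem_comap.1 (h2 h1))
    rw [sub_add_cancel] at h4
    simpa using Ideal.add_mem _ (h3 f) h4

theorem isPrime_PUIdeal (U : Set (Fin n)) : (PUIdeal k G U).IsPrime := by
  rw [PUIdeal_eq_ker]
  exact RingHom.ker_isPrime _

theorem edgeBinomial_notMem_PUIdeal {U : Set (Fin n)} {i j : Fin n} (hi : i ∈ Uᶜ) (hj : j ∈ Uᶜ)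
    (hij : ¬ (G.induce Uᶜ).Reachable ⟨i, hi⟩ ⟨j, hj⟩) : edgeBinomial k i j ∉ PUIdeal k G U := by
  rw [PUIdeal_eq_ker, RingHom.mem_ker, AlgHom.comp_apply, killVars_edgeBinomial_of_notMem hi hj,
    colorParam_edgeBinomial]
  simp only [mul_eq_zero, X_ne_zero, false_or, sub_eq_zero]
  exact fun h => hij ((componentColor_eq_iff hi hj).1 (Sum.inr_injective (X_injective h)))

end PUIdeal

section Main

theorem SimpleGraph.Reachable.adj_of_trans {W : Type*} {H : SimpleGraph W}
    (hH : ∀ a b c, H.Adj a b → H.Adj b c → a ≠ c → H.Adj a c) {a b : W} (h : H.Reachable a b)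
    (hne : a ≠ b) : H.Adj a b := by
  obtain ⟨p⟩ := h
  induction p with
  | nil => exact absurd rfl hne
  | @cons a b c hab p ih =>
    by_cases hbc : b = c
    · exact hbc ▸ hab
    · exact hH _ _ _ hab (ih hbc) hne

theorem SimpleGraph.ncard_neighborSet_eq_sub_one_iff {n : ℕ} (G : SimpleGraph (Fin n))
    (v : Fin n) : (G.neighborSet v).ncard = n - 1 ↔ ∀ w, w ≠ v → G.Adj v w := by
  have hsub : G.neighborSet v ⊆ {v}ᶜ := fun w hw => (G.ne_of_adj hw).symm
  have hcard : ({v}ᶜ : Set (Fin n)).ncard = n - 1 := by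
    rw [Set.ncard_compl]
    simp
  rw [← hcard]
  refine ⟨fun h w hw => ?_, fun h => ?_⟩
  · have := Set.eq_of_subset_of_ncard_le hsub h.ge
    exact this.ge hw
  · rw [hsub.antisymm fun w hw => h w hw]

variable {k : Type} [Field k] {n : ℕ} {G : SimpleGraph (Fin n)} {T : Set (Fin n)}

theorem binomialEdgeIdeal_eq_inf (hT : ∀ v, v ∈ T ↔ ∀ w, w ≠ v → G.Adj v w)
    (hclique : ∀ a b c : ↥(Tᶜ), (G.induce Tᶜ).Adj a b → (G.induce Tᶜ).Adj b c → a ≠ c →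
      (G.induce Tᶜ).Adj a c) :
    binomialEdgeIdeal k G = binomialEdgeIdeal k (⊤ : SimpleGraph (Fin n)) ⊓ PUIdeal k G T := by
  have hmem : ∀ i j, i ∈ T ∨ j ∈ T → edgeBinomial k i j ∈ binomialEdgeIdeal k G := by
    intro i j hij
    by_cases hne : i = j
    · simp [hne, edgeBinomial_self]
    · refine edgeBinomial_mem_of_adj ?_
      rcases hij with h | h
      · exact (hT _).1 h _ (Ne.symm hne)
      · exact ((hT _).1 h _ hne).symm
  have hX : ∀ v : Fin n ⊕ Fin n, v.elim id id ∈ T →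
      ∀ f ∈ binomialEdgeIdeal k (⊤ : SimpleGraph (Fin n)), X v * f ∈ binomialEdgeIdeal k G := by
    intro v hv f hf
    have hle : binomialEdgeIdeal k (⊤ : SimpleGraph (Fin n)) ≤
        (binomialEdgeIdeal k G).colon {X v} :=
      binomialEdgeIdeal_top_le_iff.2 fun i j => by
        rw [Submodule.mem_colon_singleton, smul_eq_mul, mul_comm]
        exact X_mul_edgeBinomial_mem rfl (hmem _ _ (Or.inr hv)) (hmem _ _ (Or.inl hv))
    rw [mul_comm]
    exact Submodule.mem_colon_singleton.1 (hle hf)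
  apply le_antisymm
  · refine le_inf (binomialEdgeIdeal_mono le_top) ?_
    rw [binomialEdgeIdeal, Ideal.span_le]
    rintro _ ⟨i, j, hij, rfl⟩
    by_cases hi : i ∈ T
    · exact Ideal.sub_mem _ (Ideal.mul_mem_right _ _ (X_mem_PUIdeal hi))
        (Ideal.mul_mem_left _ _ (X_mem_PUIdeal hi))
    by_cases hj : j ∈ T
    · exact Ideal.sub_mem _ (Ideal.mul_mem_left _ _ (X_mem_PUIdeal hj))
        (Ideal.mul_mem_right _ _ (X_mem_PUIdeal hj))
    · refine Ideal.subset_span (Or.inr ⟨i, j, hi, hj, ?_, hij.ne, rfl⟩)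
      exact SimpleGraph.Adj.reachable (G := G.induce Tᶜ) hij
  · rintro f ⟨hf, hfT⟩
    have h1 : f - killVars k T f ∈ binomialEdgeIdeal k G := by
      clear hfT
      induction hf using Submodule.span_induction with
      | mem f hf =>
        obtain ⟨i, j, -, rfl⟩ := hf
        change edgeBinomial k i j - killVars k T (edgeBinomial k i j) ∈ _
        by_cases h : i ∈ T ∨ j ∈ T
        · rw [killVars_edgeBinomial_of_mem h, sub_zero]
          exact hmem i j h
        · rw [not_or] at h
          simp [killVars_edgeBinomial_of_notMem h.1 h.2]
      | zero => simp
      | add f g _ _ hf hg =>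
        rw [map_add, add_sub_add_comm]
        exact Ideal.add_mem _ hf hg
      | smul r f hf ih =>
        have hr : r - killVars k T r ∈ (binomialEdgeIdeal k G).colon {f} :=
          sub_killVars_mem (fun v hv => Submodule.mem_colon_singleton.2 (hX v hv f hf)) r
        have := Ideal.add_mem _ (Submodule.mem_colon_singleton.1 hr)
          (Ideal.mul_mem_left _ (killVars k T r) ih)
        rw [smul_eq_mul, map_mul]
        convert this using 1
        rw [smul_eq_mul]
        ring
    have h2 : PUIdeal k G T ≤ (binomialEdgeIdeal k G).comap (killVars k T) := by
      rw [PUIdeal, Ideal.span_le]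
      rintro _ (⟨i, hi, rfl | rfl⟩ | ⟨i, j, hi, hj, hij, hne, rfl⟩)
      · simp [killVars, hi]
      · simp [killVars, hi]
      · rw [← edgeBinomial, SetLike.mem_coe, Ideal.mem_comap, killVars_edgeBinomial_of_notMem hi hj]
        exact edgeBinomial_mem_of_adj (hij.adj_of_trans hclique (by simpa using hne))
    simpa using Ideal.add_mem _ h1 (Ideal.mem_comap.1 (h2 hfT))

theorem ncard_associatedPrimes_eq_two_of_isClique_components
    (hT : ∀ v, v ∈ T ↔ ∀ w, w ≠ v → G.Adj v w) (hne : T.Nonempty)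
    (hdis : ¬ (G.induce Tᶜ).Preconnected)
    (hclique : ∀ a b c : ↥(Tᶜ), (G.induce Tᶜ).Adj a b → (G.induce Tᶜ).Adj b c → a ≠ c →
      (G.induce Tᶜ).Adj a c) :
    (associatedPrimes (MvPolynomial (Fin n ⊕ Fin n) k)
      (MvPolynomial (Fin n ⊕ Fin n) k ⧸ binomialEdgeIdeal k G)).ncard = 2 := by
  have h1 : ¬ binomialEdgeIdeal k (⊤ : SimpleGraph (Fin n)) ≤ PUIdeal k G T := by
    intro h
    refine hdis fun a b => ?_
    by_contra hab
    exact edgeBinomial_notMem_PUIdeal a.2 b.2 hab (h (edgeBinomial_mem_top _ _))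
  have h2 : ¬ PUIdeal k G T ≤ binomialEdgeIdeal k (⊤ : SimpleGraph (Fin n)) := by
    intro h
    obtain ⟨t, ht⟩ := hne
    exact X_notMem_binomialEdgeIdeal_top (Sum.inl t) (h (X_mem_PUIdeal ht))
  rw [binomialEdgeIdeal_eq_inf hT hclique,
    associatedPrimes_quotient_inf isPrime_binomialEdgeIdeal_top (isPrime_PUIdeal T) h1 h2]
  exact Set.ncard_pair fun h => h1 h.le

/-- If `J_G` has exactly two associated primes, then some prime containing `J_G` but not all
binomials lies in `(x_i, y_i : i ≠ u, w)` for every pair `u, w` of non-adjacent vertices. -/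
theorem exists_isPrime_le_ker_killVars (hconn : G.Connected)
    (h : (associatedPrimes (MvPolynomial (Fin n ⊕ Fin n) k)
      (MvPolynomial (Fin n ⊕ Fin n) k ⧸ binomialEdgeIdeal k G)).ncard = 2) :
    ∃ Q : Ideal (MvPolynomial (Fin n ⊕ Fin n) k), Q.IsPrime ∧ binomialEdgeIdeal k G ≤ Q ∧
      ¬ binomialEdgeIdeal k (⊤ : SimpleGraph (Fin n)) ≤ Q ∧
      ∀ u w, u ≠ w → ¬ G.Adj u w → Q ≤ RingHom.ker (killVars k ({u, w}ᶜ : Set (Fin n))) := by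
  set P := binomialEdgeIdeal k (⊤ : SimpleGraph (Fin n)) with hPdef
  have hPmin : P ∈ (binomialEdgeIdeal k G).minimalPrimes :=
    binomialEdgeIdeal_top_mem_minimalPrimes hconn.preconnected
  obtain ⟨Q, hQ⟩ : ∃ Q, associatedPrimes (MvPolynomial (Fin n ⊕ Fin n) k)
      (MvPolynomial (Fin n ⊕ Fin n) k ⧸ binomialEdgeIdeal k G) = {P, Q} := by
    have hPA := minimalPrimes_subset_associatedPrimes _ hPmin
    obtain ⟨A, B, -, hAB⟩ := Set.ncard_eq_two.1 h
    rw [hAB] at hPA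
    rcases hPA with hPA | hPA
    · exact ⟨B, by rw [hAB, hPA]⟩
    · exact ⟨A, by rw [hAB, hPA, Set.pair_comm]⟩
  have hmin : ∀ u w, u ≠ w → ¬ G.Adj u w → Q ∈ (binomialEdgeIdeal k G).minimalPrimes ∧
      Q ≤ RingHom.ker (killVars k ({u, w}ᶜ : Set (Fin n))) := by
    intro u w huw hadj
    have : (RingHom.ker (killVars k ({u, w}ᶜ : Set (Fin n)))).IsPrime := RingHom.ker_isPrime _
    obtain ⟨p, hp, hple⟩ := Ideal.exists_minimalPrimes_le
      (binomialEdgeIdeal_le_ker_killVars (k := k) hadj)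
    have hpA := minimalPrimes_subset_associatedPrimes _ hp
    rw [hQ] at hpA
    rcases hpA with rfl | rfl
    · exact absurd (hple (edgeBinomial_mem_top u w)) (edgeBinomial_notMem_ker_killVars huw)
    · exact ⟨hp, hple⟩
  obtain ⟨u, w, huw, hadj⟩ : ∃ u w, u ≠ w ∧ ¬ G.Adj u w := by
    by_contra! hcon
    have hG : G = ⊤ := top_le_iff.1 fun u w huw => hcon u w huw
    rw [hG, associatedPrimes_quotient_of_isPrime isPrime_binomialEdgeIdeal_top,
      Set.ncard_singleton] at h
    exact absurd h (by decide)
  have hQmin := (hmin u w huw hadj).1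
  refine ⟨Q, hQmin.1.1, hQmin.1.2, fun hle => ?_, fun u w huw hadj => (hmin u w huw hadj).2⟩
  exact edgeBinomial_notMem_ker_killVars huw
    ((hmin u w huw hadj).2 (hle (edgeBinomial_mem_top u w)))

theorem isClique_components_of_ncard_eq_two (hT : ∀ v, v ∈ T ↔ ∀ w, w ≠ v → G.Adj v w)
    (hconn : G.Connected)
    (h : (associatedPrimes (MvPolynomial (Fin n ⊕ Fin n) k)
      (MvPolynomial (Fin n ⊕ Fin n) k ⧸ binomialEdgeIdeal k G)).ncard = 2) :
    (T.Nonempty ∧ ¬ (G.induce Tᶜ).Preconnected) ∧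
      ∀ a b c : ↥(Tᶜ), (G.induce Tᶜ).Adj a b → (G.induce Tᶜ).Adj b c → a ≠ c →
        (G.induce Tᶜ).Adj a c := by
  obtain ⟨Q, hQ, hJQ, hPQ, hker⟩ := exists_isPrime_le_ker_killVars hconn h
  have hXQ : ∀ v, v ∉ T → X (Sum.inl v) ∉ Q := by
    intro v hv hX
    rw [hT] at hv
    push Not at hv
    obtain ⟨w, hwv, hadj⟩ := hv
    exact X_notMem_ker_killVars (hker v w hwv.symm hadj hX)
  have hreach : ∀ a b : ↥(Tᶜ), (G.induce Tᶜ).Reachable a b → edgeBinomial k (a : Fin n) b ∈ Q :=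
    fun a b hab => edgeBinomial_mem_of_reachable hQ hJQ (SimpleGraph.Embedding.induce _).toHom
      (fun w => ⟨Sum.inl w, rfl, hXQ w w.2⟩) hab
  have hmemT : ∀ i j, i ∈ T ∨ j ∈ T → edgeBinomial k i j ∈ Q := by
    intro i j hij
    by_cases hne : i = j
    · simp [hne, edgeBinomial_self]
    · refine hJQ (edgeBinomial_mem_of_adj ?_)
      rcases hij with h | h
      · exact (hT _).1 h _ (Ne.symm hne)
      · exact ((hT _).1 h _ hne).symm
  refine ⟨⟨?_, fun hpre => hPQ (binomialEdgeIdeal_top_le_iff.2 fun i j => ?_)⟩, ?_⟩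
  · by_contra hemp
    rw [Set.not_nonempty_iff_eq_empty] at hemp
    subst hemp
    exact hPQ (binomialEdgeIdeal_top_le_iff.2 fun i j =>
      edgeBinomial_mem_of_reachable hQ hJQ SimpleGraph.Hom.id
        (fun w => ⟨Sum.inl w, rfl, hXQ w (Set.notMem_empty w)⟩) (hconn.preconnected i j))
  · by_cases hij : i ∈ T ∨ j ∈ T
    · exact hmemT i j hij
    · rw [not_or] at hij
      exact hreach ⟨i, hij.1⟩ ⟨j, hij.2⟩ (hpre _ _)
  · intro a b c hab hbc hac
    by_contra hadj
    have hne : (a : Fin n) ≠ c := fun h => hac (Subtype.ext h)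
    exact edgeBinomial_notMem_ker_killVars hne
      (hker a c hne hadj (hreach a c (hab.reachable.trans hbc.reachable)))

end Main

/-- Let `G` be a connected graph on `[n]` and `T_G = {v : deg v = n - 1}`. Then `J_G` has
exactly two associated primes iff (1) `T_G ≠ ∅` and the induced subgraph of `G` on
`[n] ∖ T_G` is disconnected, and (2) that induced subgraph is a disjoint union of complete
graphs (i.e. adjacency is transitive on distinct vertices there). Moreover, in that case
`J_G = J_{K_n} ∩ P_{T_G}(G)`. -/
theorem ncard_associatedPrimes_eq_two_iff {n : ℕ} (k : Type) [Field k]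
    (G : SimpleGraph (Fin n)) (hconn : G.Connected) :
    (((associatedPrimes (MvPolynomial (Fin n ⊕ Fin n) k)
        ((MvPolynomial (Fin n ⊕ Fin n) k) ⧸ binomialEdgeIdeal k G)).ncard = 2) ↔
      (({v : Fin n | (G.neighborSet v).ncard = n - 1}.Nonempty ∧
          ¬ (G.induce {v : Fin n | (G.neighborSet v).ncard = n - 1}ᶜ).Preconnected) ∧
        (∀ a b c : ↥({v : Fin n | (G.neighborSet v).ncard = n - 1}ᶜ),
          (G.induce {v : Fin n | (G.neighborSet v).ncard = n - 1}ᶜ).Adj a b →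
          (G.induce {v : Fin n | (G.neighborSet v).ncard = n - 1}ᶜ).Adj b c →
          a ≠ c →
          (G.induce {v : Fin n | (G.neighborSet v).ncard = n - 1}ᶜ).Adj a c))) ∧
    (((associatedPrimes (MvPolynomial (Fin n ⊕ Fin n) k)
        ((MvPolynomial (Fin n ⊕ Fin n) k) ⧸ binomialEdgeIdeal k G)).ncard = 2) →
      binomialEdgeIdeal k G =
        binomialEdgeIdeal k (⊤ : SimpleGraph (Fin n)) ⊓
          PUIdeal k G {v : Fin n | (G.neighborSet v).ncard = n - 1}) := by
  have hT : ∀ v, v ∈ {v : Fin n | (G.neighborSet v).ncard = n - 1} ↔ ∀ w, w ≠ v → G.Adj v w :=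
    G.ncard_neighborSet_eq_sub_one_iff
  refine ⟨⟨isClique_components_of_ncard_eq_two hT hconn, fun h => ?_⟩, fun h => ?_⟩
  · exact ncard_associatedPrimes_eq_two_of_isClique_components hT h.1.1 h.1.2 h.2
  · exact binomialEdgeIdeal_eq_inf hT (isClique_components_of_ncard_eq_two hT hconn h).2
end
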